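/- Let λ > 1 and W > 0, and let ω_L = ω_L^{λ,W} be the Lamb dipole. Then ω_L is orbitally stable under the conservation laws, in the following sense: for every ε > 0 there exists δ > 0 such that whenever ζ₀ and ζ are nonnegative functions in L¹(Π) ∩ L²(Π) with x₂ζ₀, x₂ζ ∈ L¹(Π) satisfying E(ζ) = E(ζ₀), I(ζ) = I(ζ₀), ‖ζ‖_{L¹(Π)} = ‖ζ₀‖_{L¹(Π)}, ‖ζ‖_{L²(Π)} = ‖ζ₀‖_{L²(Π)}, and inf_{c∈ℝ} { ‖ζ₀−ω_L(·+c e₁)‖_{L¹(Π)} + ‖ζ₀−ω_L(·+c e₁)‖_{L²(Π)} + ‖x₂(ζ₀−ω_L(·+c e₁))‖_{L¹(Π)} } ≤ δ, then inf_{c∈ℝ} { ‖ζ−ω_L(·+c e₁)‖_{L¹(Π)} + ‖ζ−ω_L(·+c e₁)‖_{L²(Π)} + ‖x₂(ζ−ω_L(·+c e₁))‖_{L¹(Π)} } ≤ ε, where e₁ = (1,0). -/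

import Mathlib

open MeasureTheory Real Filter

noncomputable section

/-- The upper half plane `Π = {x ∈ ℝ² : x₂ > 0}`. -/
def UHP : Set (ℝ × ℝ) := {x | 0 < x.2}

/-- Euclidean norm of a point of `ℝ²`. -/
def rad (x : ℝ × ℝ) : ℝ := Real.sqrt (x.1 ^ 2 + x.2 ^ 2)

/-- Modified Bessel function of the second kind of order `0`:
`K₀(r) = ∫₀^∞ exp(-r cosh t) dt`. -/
def K0 (r : ℝ) : ℝ := ∫ t in Set.Ioi (0 : ℝ), Real.exp (-(r * Real.cosh t))

/-- Fundamental solution `G(x,y) = (1/2π) K₀(|x-y|)` of `−Δ + Id` on `ℝ²`. -/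
def Gker (x y : ℝ × ℝ) : ℝ := (1 / (2 * Real.pi)) * K0 (rad (x - y))

/-- Reflection `x̄ = (x₁, −x₂)` across the `x₁`-axis. -/
def reflPt (x : ℝ × ℝ) : ℝ × ℝ := (x.1, -x.2)

/-- Green's function `G_Π(x,y) = G(x,y) − G(x̄,y)` of `−Δ + Id` on the half plane. -/
def GUHP (x y : ℝ × ℝ) : ℝ := Gker x y - Gker (reflPt x) y

/-- The operator `𝒢ω(x) = ∫_Π G_Π(x,y) ω(y) dy`. -/
def Gop (ω : ℝ × ℝ → ℝ) (x : ℝ × ℝ) : ℝ := ∫ y in UHP, GUHP x y * ω y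

/-- Kinetic energy `E(ω) = (1/2) ∫_Π ω 𝒢ω`. -/
def kineticE (ω : ℝ × ℝ → ℝ) : ℝ := (1 / 2) * ∫ x in UHP, ω x * Gop ω x

/-- Impulse `I(ω) = ∫_Π x₂ ω dx`. -/
def impulse (ω : ℝ × ℝ → ℝ) : ℝ := ∫ x in UHP, x.2 * ω x

/-- `L¹(Π)` norm. -/
def normL1 (f : ℝ × ℝ → ℝ) : ℝ := ∫ x in UHP, |f x|

/-- `L²(Π)` norm. -/
def normL2 (f : ℝ × ℝ → ℝ) : ℝ := (∫ x in UHP, (f x) ^ 2) ^ ((1 : ℝ) / 2)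

/-- `L^s(Π)` norm. -/
def normLs (s : ℝ) (f : ℝ × ℝ → ℝ) : ℝ := (∫ x in UHP, |f x| ^ s) ^ (1 / s)

/-- Nonnegative member of `L¹(Π) ∩ L²(Π)`. -/
def NonnegL1L2 (ω : ℝ × ℝ → ℝ) : Prop :=
  (∀ x ∈ UHP, 0 ≤ ω x) ∧ IntegrableOn ω UHP ∧ IntegrableOn (fun x => (ω x) ^ 2) UHP

/-- Steiner symmetry in the `x₁` variable. -/
def SteinerSym (f : ℝ × ℝ → ℝ) : Prop :=
  (∀ x : ℝ × ℝ, f (-x.1, x.2) = f x) ∧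
  ∀ x₂ : ℝ, 0 < x₂ → AntitoneOn (fun x₁ => f (x₁, x₂)) (Set.Ioi (0 : ℝ))

/-- The admissible class `𝒜_{μ,ν}`. -/
def InAdm (μ ν : ℝ) (ω : ℝ × ℝ → ℝ) : Prop :=
  (∀ x ∈ UHP, 0 ≤ ω x) ∧ IntegrableOn ω UHP ∧ IntegrableOn (fun x => (ω x) ^ 2) UHP ∧
  IntegrableOn (fun x => x.2 * ω x) UHP ∧
  impulse ω = μ ∧ (∫ x in UHP, ω x) ≤ ν

/-- The energy functional `ℰ_λ(ω) = E(ω) − (1/(2λ)) ∫_Π ω²`. -/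
def Efun (lam : ℝ) (ω : ℝ × ℝ → ℝ) : ℝ :=
  kineticE ω - (1 / (2 * lam)) * ∫ x in UHP, (ω x) ^ 2

/-- The supremum `S_{μ,ν,λ} = sup_{ω ∈ 𝒜_{μ,ν}} ℰ_λ(ω)`. -/
def Sval (lam μ ν : ℝ) : ℝ := sSup {s | ∃ ω, InAdm μ ν ω ∧ s = Efun lam ω}

/-- `ω` is a maximizer, i.e. `ω ∈ Σ_{μ,ν,λ}`. -/
def IsMaximizer (lam μ ν : ℝ) (ω : ℝ × ℝ → ℝ) : Prop :=
  InAdm μ ν ω ∧ Efun lam ω = Sval lam μ ν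

/-- Bessel function of the first kind of order one. -/
def J1 (r : ℝ) : ℝ :=
  ∑' k : ℕ, ((-1 : ℝ) ^ k / ((Nat.factorial k : ℝ) * (Nat.factorial (k + 1) : ℝ))) *
    (r / 2) ^ (2 * k + 1)

/-- Modified Bessel function of the second kind of order one. -/
def K1 (r : ℝ) : ℝ := ∫ t in Set.Ioi (0 : ℝ), Real.exp (-(r * Real.cosh t)) * Real.cosh t

/-- The set of `t > 0` with `J₁(√(λ−1) t) ≠ 0` solving the transcendental equation
`t (K₁'(t)/K₁(t) + (λ−1)^{-1/2} J₁'(√(λ−1)t)/J₁(√(λ−1)t)) = λ/(λ−1)`. -/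
def aSet (lam : ℝ) : Set ℝ :=
  {t | 0 < t ∧ J1 (Real.sqrt (lam - 1) * t) ≠ 0 ∧
    t * (deriv K1 t / K1 t +
      (1 / Real.sqrt (lam - 1)) *
        (deriv J1 (Real.sqrt (lam - 1) * t) / J1 (Real.sqrt (lam - 1) * t))) = lam / (lam - 1)}

/-- The smallest positive solution `a = a(λ)`. -/
def aLam (lam : ℝ) : ℝ := sInf (aSet lam)

/-- The stream function `Ψ_L^{λ,W}` of the Lamb dipole, written in polar coordinates
`x₁ = r cos θ`, `x₂ = r sin θ` (so that `sin θ = x₂ / r`). -/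
def PsiL (lam W : ℝ) (x : ℝ × ℝ) : ℝ :=
  if rad x ≤ aLam lam then
    ((-(W * aLam lam / (lam - 1)) / J1 (Real.sqrt (lam - 1) * aLam lam)) *
        J1 (Real.sqrt (lam - 1) * rad x) + (W * lam / (lam - 1)) * rad x) * (x.2 / rad x)
  else (W * aLam lam / K1 (aLam lam)) * K1 (rad x) * (x.2 / rad x)

/-- The Lamb dipole `ω_L^{λ,W} = λ (Ψ_L^{λ,W} − W x₂)₊` restricted to `Π`. -/
def omegaL (lam W : ℝ) (x : ℝ × ℝ) : ℝ :=
  if 0 < x.2 then lam * max (PsiL lam W x - W * x.2) 0 else 0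

/-- `ϱ(λ) = (∫_Π ω_L^{λ,1} dx) / I(ω_L^{λ,1})`. -/
def varrho (lam : ℝ) : ℝ := (∫ x in UHP, omegaL lam 1 x) / impulse (omegaL lam 1)

/-- The Laplacian on `ℝ²`, written coordinatewise. -/
def lap (ψ : ℝ × ℝ → ℝ) (x : ℝ × ℝ) : ℝ :=
  deriv (deriv fun t => ψ (t, x.2)) x.1 + deriv (deriv fun t => ψ (x.1, t)) x.2

/-- Distance (in `L¹ ∩ L²` plus weighted `L¹`) from `ζ` to a set of functions `S`. -/
def distToSet (S : Set ((ℝ × ℝ) → ℝ)) (ζ : (ℝ × ℝ) → ℝ) : ℝ :=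
  sInf {d | ∃ ω ∈ S, d = normL1 (fun x => ζ x - ω x) + normL2 (fun x => ζ x - ω x) +
    normL1 (fun x => x.2 * (ζ x - ω x))}

end

section LambPart1
open Set Topology

abbrev VV : Type := EuclideanSpace ℝ (Fin 4)

noncomputable def hk (t q : ℝ) : ℝ := ((4 * π * t) ^ 2)⁻¹ * Real.exp (-(q / (4 * t)))

noncomputable def gq (q : ℝ) : ℝ := ∫ t in Ioi (0 : ℝ), Real.exp (-t) * hk t q

noncomputable def gv (x : VV) : ℝ := gq (‖x‖ ^ 2)

lemma hk_pos {t : ℝ} (ht : 0 < t) (q : ℝ) : 0 < hk t q := by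
  unfold hk; positivity

lemma hk_measurable : Measurable (fun p : ℝ × ℝ => Real.exp (-p.2) * hk p.2 p.1) := by
  unfold hk; fun_prop

lemma hk_le {t q : ℝ} (ht : 0 < t) (hq : 0 < q) : hk t q ≤ 2 / (π ^ 2 * q ^ 2) := by
  unfold hk
  have hy : 0 < q / (4 * t) := by positivity
  have h1 : (q / (4 * t)) ^ 2 / 2 ≤ Real.exp (q / (4 * t)) := by
    have := Real.quadratic_le_exp_of_nonneg hy.le
    linarith
  rw [Real.exp_neg, ← mul_inv]
  rw [show 2 / (π ^ 2 * q ^ 2) = ((4 * π * t) ^ 2 * ((q / (4 * t)) ^ 2 / 2))⁻¹ by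
    field_simp]
  apply inv_anti₀ (by positivity)
  gcongr

lemma integrableOn_exp_hk {q : ℝ} (hq : 0 < q) :
    IntegrableOn (fun t => Real.exp (-t) * hk t q) (Ioi 0) := by
  have h : IntegrableOn (fun t : ℝ => Real.exp (-t) * (2 / (π ^ 2 * q ^ 2))) (Ioi 0) := by
    apply Integrable.mul_const
    exact integrableOn_exp_neg_Ioi 0
  refine Integrable.mono' h ?_ ?_
  · exact (hk_measurable.comp (measurable_prodMk_left (x := q))).aestronglyMeasurable
  · filter_upwards [ae_restrict_mem measurableSet_Ioi] with t ht
    rw [Real.norm_of_nonneg (mul_nonneg (Real.exp_pos _).le (hk_pos ht q).le)]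
    exact mul_le_mul_of_nonneg_left (hk_le ht hq) (Real.exp_pos _).le

lemma gq_nonneg (q : ℝ) : 0 ≤ gq q := by
  unfold gq
  apply setIntegral_nonneg measurableSet_Ioi
  intro t ht
  exact mul_nonneg (Real.exp_pos _).le (hk_pos ht q).le

lemma setIntegral_Ioi_pos {f : ℝ → ℝ} (hf : IntegrableOn f (Ioi 0)) (hp : ∀ t ∈ Ioi (0 : ℝ), 0 < f t) :
    0 < ∫ t in Ioi (0 : ℝ), f t := by
  rw [setIntegral_pos_iff_support_of_nonneg_ae]
  · have : Function.support f ∩ Ioi 0 = Ioi 0 := by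
      ext t; simp only [mem_inter_iff, Function.mem_support]
      exact ⟨fun h => h.2, fun h => ⟨(hp t h).ne', h⟩⟩
    rw [this]; simp
  · filter_upwards [ae_restrict_mem measurableSet_Ioi] with t ht using (hp t ht).le
  · exact hf

lemma gq_pos {q : ℝ} (hq : 0 < q) : 0 < gq q :=
  setIntegral_Ioi_pos (integrableOn_exp_hk hq) fun t ht => mul_pos (Real.exp_pos _) (hk_pos ht q)

lemma gq_strictAnti : StrictAntiOn gq (Ioi 0) := by
  intro q1 h1 q2 h2 h
  have : 0 < ∫ t in Ioi (0 : ℝ), (Real.exp (-t) * hk t q1 - Real.exp (-t) * hk t q2) := by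
    apply setIntegral_Ioi_pos ((integrableOn_exp_hk h1).sub (integrableOn_exp_hk h2))
    intro t ht
    have ht' : (0:ℝ) < t := ht
    simp only [Pi.sub_apply]
    rw [← mul_sub]
    apply mul_pos (Real.exp_pos _)
    unfold hk
    rw [← mul_sub]
    apply mul_pos (by positivity)
    rw [sub_pos, Real.exp_lt_exp, neg_lt_neg_iff]
    gcongr
  rw [integral_sub (integrableOn_exp_hk h1) (integrableOn_exp_hk h2)] at this
  unfold gq; linarith

lemma gq_measurable : Measurable gq := by
  unfold gq
  exact (StronglyMeasurable.integral_prod_right (ν := volume.restrict (Ioi 0))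
    hk_measurable.stronglyMeasurable).measurable

lemma gv_measurable : Measurable gv := gq_measurable.comp (by fun_prop)

lemma gv_nonneg (x : VV) : 0 ≤ gv x := gq_nonneg _

lemma gv_neg (x : VV) : gv (-x) = gv x := by simp [gv]

lemma gq_tendsto : Tendsto gq atTop (𝓝 0) := by
  have h : ∀ᶠ q : ℝ in atTop, gq q ≤ 2 / (π ^ 2 * q ^ 2) := by
    filter_upwards [eventually_gt_atTop 0] with q hq
    have h : IntegrableOn (fun t : ℝ => Real.exp (-t) * (2 / (π ^ 2 * q ^ 2))) (Ioi 0) := by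
      apply Integrable.mul_const
      exact integrableOn_exp_neg_Ioi 0
    calc gq q ≤ ∫ t in Ioi (0:ℝ), Real.exp (-t) * (2 / (π ^ 2 * q ^ 2)) := by
          apply setIntegral_mono_on (integrableOn_exp_hk hq) h measurableSet_Ioi
          intro t ht
          exact mul_le_mul_of_nonneg_left (hk_le ht hq) (Real.exp_pos _).le
      _ = _ := by rw [integral_mul_const, integral_exp_neg_Ioi]; simp
  refine squeeze_zero' (Eventually.of_forall gq_nonneg) h ?_
  apply Tendsto.div_atTop tendsto_const_nhds
  apply Tendsto.const_mul_atTop (by positivity)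
  exact tendsto_pow_atTop (by norm_num)

lemma integral_hk {t : ℝ} (ht : 0 < t) : ∫ x : VV, hk t (‖x‖ ^ 2) = 1 := by
  unfold hk
  rw [integral_const_mul]
  have h := GaussianFourier.integral_rexp_neg_mul_sq_norm (V := VV) (b := 1 / (4 * t)) (by positivity)
  have e : ∀ x : VV, -(‖x‖ ^ 2 / (4 * t)) = -(1 / (4 * t)) * ‖x‖ ^ 2 := by intro x; ring
  simp_rw [e]
  rw [h]
  simp only [finrank_euclideanSpace, Fintype.card_fin]
  rw [show ((4:ℕ):ℝ) / 2 = ((2:ℕ):ℝ) by norm_num, Real.rpow_natCast]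
  field_simp

lemma integrable_hk {t : ℝ} (ht : 0 < t) : Integrable (fun x : VV => hk t (‖x‖ ^ 2)) := by
  by_contra h
  have := integral_hk ht
  rw [integral_undef h] at this
  norm_num at this

lemma integrable_gprod : Integrable (fun p : VV × ℝ => Real.exp (-p.2) * hk p.2 (‖p.1‖ ^ 2))
    ((volume : Measure VV).prod (volume.restrict (Ioi (0:ℝ)))) := by
  have hm : Measurable (fun p : VV × ℝ => Real.exp (-p.2) * hk p.2 (‖p.1‖ ^ 2)) :=
    hk_measurable.comp (by fun_prop : Measurable (fun p : VV × ℝ => (‖p.1‖ ^ 2, p.2)))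
  rw [integrable_prod_iff' hm.aestronglyMeasurable]
  constructor
  · filter_upwards [ae_restrict_mem measurableSet_Ioi] with t ht
    exact (integrable_hk ht).const_mul _
  · have : IntegrableOn (fun t : ℝ => Real.exp (-t)) (Ioi 0) := integrableOn_exp_neg_Ioi 0
    refine Integrable.congr this ?_
    filter_upwards [ae_restrict_mem measurableSet_Ioi] with t ht
    have : ∀ x : VV, ‖Real.exp (-t) * hk t (‖x‖ ^ 2)‖ = Real.exp (-t) * hk t (‖x‖ ^ 2) := fun x =>
      Real.norm_of_nonneg (mul_nonneg (Real.exp_pos _).le (hk_pos ht _).le)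
    simp_rw [this]
    rw [integral_const_mul, integral_hk ht, mul_one]

lemma gv_integrable : Integrable gv := integrable_gprod.integral_prod_left

lemma gv_integral : ∫ x, gv x = 1 := by
  have h := integral_integral_swap (f := fun (x : VV) (t : ℝ) => Real.exp (-t) * hk t (‖x‖ ^ 2))
    integrable_gprod
  change ∫ x : VV, ∫ t in Ioi (0:ℝ), Real.exp (-t) * hk t (‖x‖ ^ 2) = 1
  rw [h]
  have : ∀ t ∈ Ioi (0:ℝ), ∫ x : VV, Real.exp (-t) * hk t (‖x‖ ^ 2) = Real.exp (-t) := by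
    intro t ht; rw [integral_const_mul, integral_hk ht, mul_one]
  rw [setIntegral_congr_fun measurableSet_Ioi this, integral_exp_neg_Ioi]; simp
end LambPart1

section LambPart2
open Set Topology

/-- squared L2 norm -/
noncomputable def N2 (w : VV → ℝ) : ℝ := ∫ x, w x ^ 2

noncomputable def cv (k w : VV → ℝ) (x : VV) : ℝ := ∫ y, k (x - y) * w y

noncomputable def Bf (k v w : VV → ℝ) : ℝ :=
  ∫ p : VV × VV, v p.1 * (k (p.1 - p.2) * w p.2) ∂(volume.prod volume)

lemma N2_nonneg (w : VV → ℝ) : 0 ≤ N2 w := integral_nonneg fun _ => sq_nonneg _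

lemma sh_int2 {k f : VV → ℝ} (hk : Integrable k) (hf : Integrable f) :
    Integrable (fun p : VV × VV => k (p.1 - p.2) * f p.2) (volume.prod volume) := by
  have := hf.convolution_integrand (ContinuousLinearMap.mul ℝ ℝ) hk
  simpa [mul_comm] using this

lemma sh_int1 {k f : VV → ℝ} (hk : Integrable k) (hf : Integrable f) :
    Integrable (fun p : VV × VV => k (p.1 - p.2) * f p.1) (volume.prod volume) := by
  have h := (sh_int2 (hk.comp_neg) hf).swap
  refine h.congr (Eventually.of_forall fun p => ?_)
  simp [Function.comp]

lemma sh_integral2 {k f : VV → ℝ} (hk : Integrable k) (hf : Integrable f) :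
    ∫ p : VV × VV, k (p.1 - p.2) * f p.2 ∂(volume.prod volume) = (∫ x, k x) * ∫ x, f x := by
  rw [integral_prod_symm _ (sh_int2 hk hf)]
  simp only [integral_mul_const]
  simp_rw [integral_sub_right_eq_self k]
  rw [integral_const_mul]

lemma sh_integral1 {k f : VV → ℝ} (hk : Integrable k) (hf : Integrable f) :
    ∫ p : VV × VV, k (p.1 - p.2) * f p.1 ∂(volume.prod volume) = (∫ x, k x) * ∫ x, f x := by
  rw [integral_prod _ (sh_int1 hk hf)]
  simp only [integral_mul_const]
  simp_rw [integral_sub_left_eq_self k]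
  rw [integral_const_mul]

lemma L2sq {w : VV → ℝ} (hw : MemLp w 2) : Integrable (fun x => w x ^ 2) := hw.integrable_sq

lemma Bf_meas {k v w : VV → ℝ} (hk : Integrable k) (hv : AEStronglyMeasurable v)
    (hw : AEStronglyMeasurable w) :
    AEStronglyMeasurable (fun p : VV × VV => v p.1 * (k (p.1 - p.2) * w p.2))
      (volume.prod volume) := by
  refine AEStronglyMeasurable.mul (hv.comp_fst) (AEStronglyMeasurable.mul ?_ (hw.comp_snd))
  exact hk.aestronglyMeasurable.comp_quasiMeasurePreserving
    (quasiMeasurePreserving_sub_of_right_invariant volume volume)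

lemma young_pt (s a b k : ℝ) (hs : 0 < s) : |a * (k * b)| ≤ 2⁻¹ * (s * (|k| * a ^ 2) + s⁻¹ * (|k| * b ^ 2)) := by
  have h : |a| * |b| ≤ 2⁻¹ * (s * a ^ 2 + s⁻¹ * b ^ 2) := by
    have h1 : s⁻¹ * b ^ 2 = b ^ 2 / s := by ring
    have : 0 ≤ (s * |a| - |b|) ^ 2 / s := by positivity
    have h2 : (s * |a| - |b|) ^ 2 / s = s * a ^ 2 - 2 * (|a| * |b|) + b ^ 2 / s := by
      rw [← sq_abs a, ← sq_abs b]; field_simp; ring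
    rw [h1]; linarith
  rw [abs_mul, abs_mul]
  nlinarith [abs_nonneg k, mul_le_mul_of_nonneg_left h (abs_nonneg k)]

lemma Bf_integrable {k v w : VV → ℝ} (hk : Integrable k) (hv : MemLp v 2) (hw : MemLp w 2) :
    Integrable (fun p : VV × VV => v p.1 * (k (p.1 - p.2) * w p.2)) (volume.prod volume) := by
  have h := (((sh_int1 hk.abs (L2sq hv)).const_mul 1).add
    ((sh_int2 hk.abs (L2sq hw)).const_mul 1⁻¹)).const_mul 2⁻¹
  refine h.mono' (Bf_meas hk hv.1 hw.1) (Eventually.of_forall fun p => ?_)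
  exact young_pt 1 _ _ _ one_pos

lemma Bf_bound {k v w : VV → ℝ} (hk : Integrable k) (hv : MemLp v 2) (hw : MemLp w 2)
    {s : ℝ} (hs : 0 < s) :
    |Bf k v w| ≤ 2⁻¹ * (∫ x, |k x|) * (s * N2 v + s⁻¹ * N2 w) := by
  have h := (((sh_int1 hk.abs (L2sq hv)).const_mul s).add
    ((sh_int2 hk.abs (L2sq hw)).const_mul s⁻¹)).const_mul 2⁻¹
  have := norm_integral_le_of_norm_le (f := fun p : VV × VV => v p.1 * (k (p.1 - p.2) * w p.2)) h (Eventually.of_forall fun p => by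
    exact young_pt s (v p.1) (w p.2) (k (p.1 - p.2)) hs)
  rw [Real.norm_eq_abs] at this
  unfold Bf
  refine this.trans (le_of_eq ?_)
  simp only [Pi.add_apply]
  rw [integral_const_mul, integral_add ((sh_int1 hk.abs (L2sq hv)).const_mul s)
    ((sh_int2 hk.abs (L2sq hw)).const_mul s⁻¹), integral_const_mul, integral_const_mul,
    sh_integral1 hk.abs (L2sq hv), sh_integral2 hk.abs (L2sq hw)]
  unfold N2; ring

lemma Bf_bound_self {k w : VV → ℝ} (hk : Integrable k) (hw : MemLp w 2) :
    |Bf k w w| ≤ (∫ x, |k x|) * N2 w := by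
  have := Bf_bound hk hw hw one_pos
  simp at this; linarith

lemma Bf_add_left {k u v w : VV → ℝ} (hk : Integrable k) (hu : MemLp u 2) (hv : MemLp v 2)
    (hw : MemLp w 2) : Bf k (fun x => u x + v x) w = Bf k u w + Bf k v w := by
  unfold Bf
  rw [← integral_add (Bf_integrable hk hu hw) (Bf_integrable hk hv hw)]
  congr 1; ext p; ring

lemma Bf_add_right {k u v w : VV → ℝ} (hk : Integrable k) (hu : MemLp u 2) (hv : MemLp v 2)
    (hw : MemLp w 2) : Bf k w (fun x => u x + v x) = Bf k w u + Bf k w v := by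
  unfold Bf
  rw [← integral_add (Bf_integrable hk hw hu) (Bf_integrable hk hw hv)]
  congr 1; ext p; ring

lemma Bf_add_ker {k l v w : VV → ℝ} (hk : Integrable k) (hl : Integrable l) (hv : MemLp v 2)
    (hw : MemLp w 2) : Bf (fun x => k x + l x) v w = Bf k v w + Bf l v w := by
  unfold Bf
  rw [← integral_add (Bf_integrable hk hv hw) (Bf_integrable hl hv hw)]
  congr 1; ext p; ring

lemma Bf_smul_left (k v w : VV → ℝ) (c : ℝ) : Bf k (fun x => c * v x) w = c * Bf k v w := by
  unfold Bf; rw [← integral_const_mul]; congr 1; ext p; ring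

lemma Bf_smul_right (k v w : VV → ℝ) (c : ℝ) : Bf k v (fun x => c * w x) = c * Bf k v w := by
  unfold Bf; rw [← integral_const_mul]; congr 1; ext p; ring

lemma Bf_symm {k : VV → ℝ} (hk : ∀ x, k (-x) = k x) (v w : VV → ℝ) : Bf k v w = Bf k w v := by
  unfold Bf
  rw [← integral_prod_swap]
  congr 1; ext p
  simp only [Prod.fst_swap, Prod.snd_swap]
  rw [← hk, neg_sub]; ring

lemma Bf_congr {k v v' w w' : VV → ℝ} (h1 : v =ᵐ[volume] v') (h2 : w =ᵐ[volume] w') :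
    Bf k v w = Bf k v' w' := by
  unfold Bf
  apply integral_congr_ae
  have e1 : ∀ᵐ p : VV × VV ∂(volume.prod volume), v p.1 = v' p.1 :=
    Measure.quasiMeasurePreserving_fst.ae h1
  have e2 : ∀ᵐ p : VV × VV ∂(volume.prod volume), w p.2 = w' p.2 :=
    Measure.quasiMeasurePreserving_snd.ae h2
  filter_upwards [e1, e2] with p a b
  rw [a, b]

lemma Bf_nonneg {k v w : VV → ℝ} (hk : ∀ x, 0 ≤ k x) (hv : ∀ x, 0 ≤ v x) (hw : ∀ x, 0 ≤ w x) :
    0 ≤ Bf k v w :=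
  integral_nonneg fun p => mul_nonneg (hv _) (mul_nonneg (hk _) (hw _))

lemma Bf_mono {k l v w : VV → ℝ} (hk : Integrable k) (hl : Integrable l) (h : ∀ x, k x ≤ l x)
    (hv : MemLp v 2) (hw : MemLp w 2) (hv0 : ∀ x, 0 ≤ v x) (hw0 : ∀ x, 0 ≤ w x) :
    Bf k v w ≤ Bf l v w :=
  integral_mono (Bf_integrable hk hv hw) (Bf_integrable hl hv hw) fun p =>
    mul_le_mul_of_nonneg_left (mul_le_mul_of_nonneg_right (h _) (hw0 _)) (hv0 _)

lemma Bf_le_sup {k v w : VV → ℝ} (hk : Integrable k) {M : ℝ} (hM : ∀ x, k x ≤ M)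
    (hv : MemLp v 2) (hw : MemLp w 2) (hv1 : Integrable v) (hw1 : Integrable w)
    (hv0 : ∀ x, 0 ≤ v x) (hw0 : ∀ x, 0 ≤ w x) :
    Bf k v w ≤ M * ((∫ x, v x) * ∫ x, w x) := by
  rw [← integral_prod_mul, ← integral_const_mul]
  apply integral_mono (Bf_integrable hk hv hw) ((hv1.mul_prod hw1).const_mul M)
  intro p
  have := mul_le_mul_of_nonneg_right (hM (p.1 - p.2)) (mul_nonneg (hv0 p.1) (hw0 p.2))
  dsimp only
  linarith

lemma Bf_eq_cv {k v w : VV → ℝ} (hk : Integrable k) (hv : MemLp v 2) (hw : MemLp w 2) :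
    Bf k v w = ∫ x, v x * cv k w x := by
  unfold Bf
  rw [integral_prod _ (Bf_integrable hk hv hw)]
  simp only [cv, integral_const_mul]

lemma Bf_eq_cv_integrable {k v w : VV → ℝ} (hk : Integrable k) (hv : MemLp v 2) (hw : MemLp w 2) :
    Integrable (fun x => v x * cv k w x) := by
  have := (Bf_integrable hk hv hw).integral_prod_left
  simpa only [cv, integral_const_mul] using this

lemma Bf_comp {k v w : VV → ℝ} (T : VV ≃ᵐ VV) (hT : MeasurePreserving T)
    (hk : ∀ x y, k (T x - T y) = k (x - y)) :
    Bf k (fun x => v (T x)) (fun x => w (T x)) = Bf k v w := by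
  have h := (hT.prod hT).integral_comp (MeasurableEquiv.prodCongr T T).measurableEmbedding
    (fun p : VV × VV => v p.1 * (k (p.1 - p.2) * w p.2))
  unfold Bf
  rw [← h]
  congr 1; ext p
  simp [hk]

lemma N2_comp {w : VV → ℝ} (T : VV ≃ᵐ VV) (hT : MeasurePreserving T) :
    N2 (fun x => w (T x)) = N2 w :=
  hT.integral_comp T.measurableEmbedding (fun x => w x ^ 2)

/-- quadratic functional -/
noncomputable def Df (lam : ℝ) (w : VV → ℝ) : ℝ := Bf gv w w - lam⁻¹ * N2 w

noncomputable def kM (M : ℝ) (x : VV) : ℝ := min (gv x) M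

lemma kM_meas (M : ℝ) : Measurable (kM M) := gv_measurable.min measurable_const

lemma kM_nonneg {M : ℝ} (hM : 0 ≤ M) (x : VV) : 0 ≤ kM M x := le_min (gv_nonneg x) hM

lemma kM_le (M : ℝ) (x : VV) : kM M x ≤ M := min_le_right _ _

lemma kM_le_gv (M : ℝ) (x : VV) : kM M x ≤ gv x := min_le_left _ _

lemma kM_neg (M : ℝ) (x : VV) : kM M (-x) = kM M x := by simp [kM, gv_neg]

lemma kM_integrable {M : ℝ} (hM : 0 ≤ M) : Integrable (kM M) := by
  refine gv_integrable.mono' (kM_meas M).aestronglyMeasurable (Eventually.of_forall fun x => ?_)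
  rw [Real.norm_of_nonneg (kM_nonneg hM x)]; exact kM_le_gv M x

lemma kM_memLp {M : ℝ} (hM : 0 ≤ M) : MemLp (kM M) 2 := by
  rw [memLp_two_iff_integrable_sq (kM_meas M).aestronglyMeasurable]
  refine ((kM_integrable hM).const_mul M).mono' ((kM_meas M).pow_const 2).aestronglyMeasurable
    (Eventually.of_forall fun x => ?_)
  rw [Real.norm_of_nonneg (sq_nonneg _), sq]
  exact mul_le_mul_of_nonneg_right (kM_le M x) (kM_nonneg hM x)

lemma rM_integrable {M : ℝ} (hM : 0 ≤ M) : Integrable (fun x => gv x - kM M x) :=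
  gv_integrable.sub (kM_integrable hM)

lemma rM_nonneg (M : ℝ) (x : VV) : 0 ≤ gv x - kM M x := sub_nonneg.2 (kM_le_gv M x)

lemma rM_small {ε : ℝ} (hε : 0 < ε) : ∃ M : ℝ, 0 < M ∧ ∫ x, |gv x - kM M x| ≤ ε := by
  have h : Tendsto (fun n : ℕ => ∫ x, |gv x - kM n x|) atTop (𝓝 (∫ x : VV, (0:ℝ))) := by
    apply tendsto_integral_of_dominated_convergence gv
    · intro n
      exact ((gv_measurable.sub (kM_meas n)).abs).aestronglyMeasurable
    · exact gv_integrable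
    · intro n
      refine Eventually.of_forall fun x => ?_
      rw [Real.norm_eq_abs, abs_abs, abs_of_nonneg (rM_nonneg _ x)]
      linarith [kM_nonneg (Nat.cast_nonneg (α := ℝ) n) x]
    · refine Eventually.of_forall fun x => ?_
      apply tendsto_const_nhds.congr'
      obtain ⟨N, hN⟩ := exists_nat_ge (gv x)
      filter_upwards [eventually_ge_atTop N] with n hn
      have : gv x ≤ n := hN.trans (by exact_mod_cast hn)
      simp [kM, min_eq_left this]
  simp only [integral_zero] at h
  obtain ⟨n, hn, hn1⟩ := ((h.eventually (gt_mem_nhds hε)).and (eventually_ge_atTop 1)).exists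
  exact ⟨n, by exact_mod_cast hn1, hn.le⟩

lemma Bf_split (M : ℝ) (hM : 0 ≤ M) {v w : VV → ℝ} (hv : MemLp v 2) (hw : MemLp w 2) :
    Bf gv v w = Bf (kM M) v w + Bf (fun x => gv x - kM M x) v w := by
  rw [← Bf_add_ker (kM_integrable hM) (rM_integrable hM) hv hw]
  congr 1; ext x; ring

lemma Bf_eps {ε : ℝ} (hε : 0 < ε) : ∃ C : ℝ, 0 < C ∧ ∀ w : VV → ℝ, MemLp w 2 → Integrable w →
    (∀ x, 0 ≤ w x) → Bf gv w w ≤ ε * N2 w + C * (∫ x, w x) ^ 2 := by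
  obtain ⟨M, hM, h⟩ := rM_small hε
  refine ⟨M, hM, fun w h2 h1 h0 => ?_⟩
  rw [Bf_split M hM.le h2 h2]
  have a := Bf_le_sup (kM_integrable hM.le) (kM_le M) h2 h2 h1 h1 h0 h0
  have b := (abs_le.1 (Bf_bound_self (rM_integrable hM.le) h2)).2
  have c := mul_le_mul_of_nonneg_right h (N2_nonneg w)
  rw [sq]; linarith

/-- admissible functions -/
structure Adm (w : VV → ℝ) : Prop where
  l2 : MemLp w 2
  l1 : Integrable w
  nn : ∀ x, 0 ≤ w x

/-- the sup constant -/
noncomputable def Cst (lam : ℝ) : ℝ := sSup {d | ∃ w, Adm w ∧ ∫ x, w x = 1 ∧ d = Df lam w}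

lemma Cst_bdd {lam : ℝ} (hl : 1 < lam) :
    BddAbove {d | ∃ w, Adm w ∧ ∫ x, w x = 1 ∧ d = Df lam w} := by
  obtain ⟨C, hC, h⟩ := Bf_eps (ε := lam⁻¹) (by positivity)
  refine ⟨C, ?_⟩
  rintro d ⟨w, hw, h1, rfl⟩
  have := h w hw.l2 hw.l1 hw.nn
  rw [h1] at this
  unfold Df; linarith

lemma N2_smul (c : ℝ) (w : VV → ℝ) : N2 (fun x => c * w x) = c ^ 2 * N2 w := by
  unfold N2; rw [← integral_const_mul]; congr 1; ext x; ring

lemma Df_smul (lam c : ℝ) (w : VV → ℝ) : Df lam (fun x => c * w x) = c ^ 2 * Df lam w := by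
  unfold Df
  rw [Bf_smul_left, Bf_smul_right, N2_smul]; ring

lemma Adm.smul {w : VV → ℝ} (hw : Adm w) {c : ℝ} (hc : 0 ≤ c) : Adm (fun x => c * w x) :=
  ⟨hw.l2.const_mul c, hw.l1.const_mul c, fun x => mul_nonneg hc (hw.nn x)⟩

lemma Adm.int_nonneg {w : VV → ℝ} (hw : Adm w) : 0 ≤ ∫ x, w x := integral_nonneg hw.nn

lemma Df_le {lam : ℝ} (hl : 1 < lam) {w : VV → ℝ} (hw : Adm w) :
    Df lam w ≤ Cst lam * (∫ x, w x) ^ 2 := by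
  rcases hw.int_nonneg.eq_or_lt with h | h
  · have h0 : w =ᵐ[volume] (fun _ => (0:ℝ)) := (integral_eq_zero_iff_of_nonneg hw.nn hw.l1).1 h.symm
    have : Df lam w = 0 := by
      have e1 : Bf gv w w = 0 := by rw [Bf_congr h0 h0]; simp [Bf]
      have e2 : N2 w = 0 := by
        unfold N2
        rw [integral_congr_ae (g := fun _ => (0:ℝ)) (h0.mono fun x hx => by simp [hx])]; simp
      simp [Df, e1, e2]
    rw [this, ← h]; simp
  · have h2 := le_csSup (Cst_bdd hl) ⟨_, hw.smul (c := (∫ x, w x)⁻¹) (by positivity), by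
      rw [integral_const_mul]; field_simp, rfl⟩
    rw [Df_smul] at h2
    change _ ≤ Cst lam at h2
    have h3 := mul_le_mul_of_nonneg_right h2 (sq_nonneg (∫ x, w x))
    calc Df lam w = ((∫ x, w x)⁻¹) ^ 2 * Df lam w * (∫ x, w x) ^ 2 := by field_simp
      _ ≤ _ := h3

end LambPart2

section LambPart3
open Set Topology

lemma L2mul {f g : VV → ℝ} (hf : MemLp f 2) (hg : MemLp g 2) : Integrable (fun x => f x * g x) :=
  hf.integrable_mul hg

lemma L2young {f g : VV → ℝ} (hf : MemLp f 2) (hg : MemLp g 2) {s : ℝ} (hs : 0 < s) :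
    |∫ x, f x * g x| ≤ 2⁻¹ * (s * N2 f + s⁻¹ * N2 g) := by
  have h := (((L2sq hf).const_mul s).add ((L2sq hg).const_mul s⁻¹)).const_mul 2⁻¹
  have := norm_integral_le_of_norm_le (f := fun x => f x * g x) h (Eventually.of_forall fun x => by
    have := young_pt s (f x) (g x) 1 hs
    simpa using this)
  rw [Real.norm_eq_abs] at this
  refine this.trans (le_of_eq ?_)
  simp only [Pi.add_apply]
  rw [integral_const_mul, integral_add ((L2sq hf).const_mul s) ((L2sq hg).const_mul s⁻¹),
    integral_const_mul, integral_const_mul]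
  rfl

/-- weak convergence in L2 -/
def WkTo (v : ℕ → VV → ℝ) (l : VV → ℝ) : Prop :=
  ∀ f : VV → ℝ, MemLp f 2 → Tendsto (fun n => ∫ x, v n x * f x) atTop (𝓝 (∫ x, l x * f x))

lemma wk_subseq {v : ℕ → VV → ℝ} {K : ℝ} (hv : ∀ n, MemLp (v n) 2) (hK : ∀ n, N2 (v n) ≤ K) :
    ∃ φ : ℕ → ℕ, StrictMono φ ∧ ∃ l : VV → ℝ, MemLp l 2 ∧ WkTo (fun n => v (φ n)) l := by
  haveI : Fact ((2:ENNReal) ≠ ⊤) := ⟨by simp⟩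
  haveI : TopologicalSpace.SeparableSpace (Lp ℝ 2 (volume : Measure VV)) := inferInstance
  let H := Lp ℝ 2 (volume : Measure VV)
  let V : ℕ → H := fun n => (hv n).toLp (v n)
  have inn : ∀ (n) (f : VV → ℝ) (hf : MemLp f 2), inner ℝ (V n) (hf.toLp f) = ∫ x, v n x * f x := by
    intro n f hf
    rw [L2.inner_def]
    apply integral_congr_ae
    filter_upwards [(hv n).coeFn_toLp, hf.coeFn_toLp] with x h1 h2
    simp only [V]
    rw [h1, h2]; simp [mul_comm]
  have hnorm : ∀ n, ‖V n‖ ≤ Real.sqrt K := by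
    intro n
    apply Real.le_sqrt_of_sq_le
    rw [← real_inner_self_eq_norm_sq]
    have := inn n (v n) (hv n)
    change inner ℝ (V n) (V n) = _ at this
    rw [this]
    refine le_trans (le_of_eq ?_) (hK n)
    unfold N2; congr 1; ext x; ring
  have hc := WeakDual.isSeqCompact_closedBall ℝ H 0 (Real.sqrt K)
  let F : ℕ → WeakDual ℝ H := fun n => StrongDual.toWeakDual (InnerProductSpace.toDual ℝ H (V n))
  have hF : ∀ n, F n ∈ (WeakDual.toStrongDual ⁻¹' Metric.closedBall (0 : StrongDual ℝ H) (Real.sqrt K)) := by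
    intro n
    simp only [mem_preimage, Metric.mem_closedBall, dist_zero_right]
    change ‖InnerProductSpace.toDual ℝ H (V n)‖ ≤ _
    rw [LinearIsometryEquiv.norm_map]
    exact hnorm n
  obtain ⟨G, hG, φ, hφ, hlim⟩ := hc hF
  let l : H := (InnerProductSpace.toDual ℝ H).symm (WeakDual.toStrongDual G)
  refine ⟨φ, hφ, l, Lp.memLp l, fun f hf => ?_⟩
  have h1 := ((WeakDual.eval_continuous (𝕜 := ℝ) (E := H) (hf.toLp f)).tendsto G).comp hlim
  have e1 : ∀ n, ((F ∘ φ) n) (hf.toLp f) = ∫ x, v (φ n) x * f x := by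
    intro n
    rw [← inn (φ n) f hf]
    rfl
  have e2 : G (hf.toLp f) = ∫ x, l x * f x := by
    have : G (hf.toLp f) = inner ℝ l (hf.toLp f) := by
      have := InnerProductSpace.toDual_symm_apply (𝕜 := ℝ) (x := hf.toLp f) (y := WeakDual.toStrongDual G)
      exact this.symm
    rw [this, L2.inner_def]
    apply integral_congr_ae
    filter_upwards [hf.coeFn_toLp] with x h2
    rw [h2]; simp [mul_comm]
  rw [e2] at h1
  refine h1.congr fun n => ?_
  exact e1 n

lemma WkTo.indicator {v : ℕ → VV → ℝ} {l : VV → ℝ} (h : WkTo v l) {S : Set VV} (hS : MeasurableSet S) :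
    WkTo (fun n => S.indicator (v n)) (S.indicator l) := by
  intro f hf
  have := h (S.indicator f) (hf.indicator hS)
  have e : ∀ u : VV → ℝ, (fun x => S.indicator u x * f x) = fun x => u x * S.indicator f x := by
    intro u; ext x; by_cases hx : x ∈ S <;> simp [hx]
  simp only [e]; exact this

lemma N2_indicator {v : VV → ℝ} (hv : MemLp v 2) {S : Set VV} (hS : MeasurableSet S) :
    N2 (S.indicator v) + N2 (Sᶜ.indicator v) = N2 v := by
  unfold N2
  rw [← integral_add (L2sq (hv.indicator hS)) (L2sq (hv.indicator hS.compl))]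
  congr 1; ext x; by_cases hx : x ∈ S <;> simp [hx]

lemma N2_indicator_le {v : VV → ℝ} (hv : MemLp v 2) {S : Set VV} (hS : MeasurableSet S) :
    N2 (S.indicator v) ≤ N2 v := by
  have := N2_indicator hv hS
  linarith [N2_nonneg (Sᶜ.indicator v)]

lemma memLp_translate_neg {f : VV → ℝ} (hf : MemLp f 2) (x : VV) : MemLp (fun y => f (x - y)) 2 := by
  exact hf.comp_measurePreserving (Measure.measurePreserving_sub_left volume x)

lemma N2_translate_neg (f : VV → ℝ) (x : VV) : N2 (fun y => f (x - y)) = N2 f := by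
  unfold N2
  exact integral_sub_left_eq_self (fun y => f y ^ 2) volume x

lemma cv_bound {k c : VV → ℝ} (hk : MemLp k 2) (hc : MemLp c 2) (x : VV) :
    |cv k c x| ≤ 2⁻¹ * (N2 k + N2 c) := by
  have := L2young (memLp_translate_neg hk x) hc one_pos
  rw [N2_translate_neg] at this
  simpa [cv] using this

lemma cv_tendsto {k : VV → ℝ} (hk : MemLp k 2) {c : ℕ → VV → ℝ} {l : VV → ℝ} (h : WkTo c l) (x : VV) :
    Tendsto (fun n => cv k (c n) x) atTop (𝓝 (cv k l x)) := by
  have := h _ (memLp_translate_neg hk x)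
  simp only [cv]
  simpa [mul_comm] using this

lemma cv_aesm {k c : VV → ℝ} (hk : Integrable k) (hc : AEStronglyMeasurable c) :
    AEStronglyMeasurable (cv k c) := by
  have := Bf_meas hk (aestronglyMeasurable_const (b := (1:ℝ))) hc
  have h2 := this.integral_prod_right'
  simp only [one_mul] at h2
  exact h2

lemma Bf_tendsto_M {M K : ℝ} (hM : 0 ≤ M) {a c : ℕ → VV → ℝ} {a0 c0 : VV → ℝ} {r : ℝ}
    (ha : ∀ n, MemLp (a n) 2) (hc : ∀ n, MemLp (c n) 2) (hKa : ∀ n, N2 (a n) ≤ K)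
    (hKc : ∀ n, N2 (c n) ≤ K) (ha0 : MemLp a0 2) (hc0 : MemLp c0 2) (hwa : WkTo a a0)
    (hwc : WkTo c c0) (hs : ∀ n x, x ∉ Metric.ball (0:VV) r → a n x = 0)
    (hs0 : ∀ x, x ∉ Metric.ball (0:VV) r → a0 x = 0) :
    Tendsto (fun n => Bf (kM M) (a n) (c n)) atTop (𝓝 (Bf (kM M) a0 c0)) := by
  set S := Metric.ball (0:VV) r
  have hS : MeasurableSet S := measurableSet_ball
  have hSf : volume S ≠ ⊤ := measure_ball_lt_top.ne
  have hk1 := kM_integrable hM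
  have hk2 := kM_memLp hM
  set C : ℝ := 2⁻¹ * (N2 (kM M) + max K (N2 c0))
  have hb : ∀ n x, |cv (kM M) (c n) x| ≤ C := fun n x =>
    (cv_bound hk2 (hc n) x).trans (by
      have := (hKc n).trans (le_max_left K (N2 c0)); simp only [C]; linarith)
  have hb0 : ∀ x, |cv (kM M) c0 x| ≤ C := fun x =>
    (cv_bound hk2 hc0 x).trans (by
      have := (le_max_right K (N2 c0)); simp only [C]; linarith)
  have hCi : Integrable (S.indicator fun _ => C) := (integrable_indicator_iff hS).2 (integrableOn_const hSf)
  have memF : ∀ c' : VV → ℝ, MemLp c' 2 → (∀ x, |cv (kM M) c' x| ≤ C) →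
      MemLp (S.indicator (cv (kM M) c')) 2 := by
    intro c' hc' hb'
    have hd : MemLp (S.indicator fun _ => C) 2 := memLp_indicator_const 2 hS C (Or.inr hSf)
    refine hd.mono ((cv_aesm hk1 hc'.1).indicator hS) (Eventually.of_forall fun x => ?_)
    by_cases hx : x ∈ S
    · simp only [indicator_of_mem hx, Real.norm_eq_abs]; exact (hb' x).trans (le_abs_self _)
    · simp [hx]
  let d : ℕ → VV → ℝ := fun n x => S.indicator (cv (kM M) (c n)) x - S.indicator (cv (kM M) c0) x
  have hd : ∀ n, MemLp (d n) 2 := fun n => (memF _ (hc n) (hb n)).sub (memF _ hc0 hb0)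
  have hd0 : Tendsto (fun n => N2 (d n)) atTop (𝓝 0) := by
    have : Tendsto (fun n => N2 (d n)) atTop (𝓝 (∫ x : VV, (0:ℝ))) := by
      apply tendsto_integral_of_dominated_convergence (S.indicator fun _ => (2 * C) ^ 2)
      · intro n; exact (L2sq (hd n)).1
      · exact (integrable_indicator_iff hS).2 (integrableOn_const hSf)
      · intro n
        refine Eventually.of_forall fun x => ?_
        by_cases hx : x ∈ S
        · simp only [d, indicator_of_mem hx, Real.norm_eq_abs]
          rw [abs_of_nonneg (sq_nonneg _)]
          apply sq_le_sq'
          · have := abs_le.1 (hb n x); have := abs_le.1 (hb0 x); linarith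
          · have := abs_le.1 (hb n x); have := abs_le.1 (hb0 x); linarith
        · simp [d, hx]
      · refine Eventually.of_forall fun x => ?_
        by_cases hx : x ∈ S
        · simp only [d, indicator_of_mem hx]
          have := ((cv_tendsto hk2 hwc x).sub_const (cv (kM M) c0 x)).pow 2
          simpa using this
        · simp [d, hx]
    simpa using this
  have e : ∀ n, Bf (kM M) (a n) (c n) = (∫ x, a n x * d n x) + ∫ x, a n x * S.indicator (cv (kM M) c0) x := by
    intro n
    rw [Bf_eq_cv hk1 (ha n) (hc n), ← integral_add (L2mul (ha n) (hd n)) (L2mul (ha n) (memF _ hc0 hb0))]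
    congr 1; ext x
    by_cases hx : x ∈ S
    · simp [d, hx]; ring
    · simp [hs n x hx]
  have e0 : Bf (kM M) a0 c0 = ∫ x, a0 x * S.indicator (cv (kM M) c0) x := by
    rw [Bf_eq_cv hk1 ha0 hc0]
    congr 1; ext x
    by_cases hx : x ∈ S
    · simp [hx]
    · simp [hs0 x hx]
  have t1 : Tendsto (fun n => ∫ x, a n x * d n x) atTop (𝓝 0) := by
    rw [Metric.tendsto_atTop]
    intro ε hε
    set s : ℝ := ε / (2 * (|K| + 1))
    have hs' : 0 < s := by positivity
    obtain ⟨N, hN⟩ := Metric.tendsto_atTop.1 hd0 (s * ε) (by positivity)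
    refine ⟨N, fun n hn => ?_⟩
    rw [dist_zero_right, Real.norm_eq_abs]
    have h1 := L2young (ha n) (hd n) hs'
    have h2 := hN n hn
    rw [dist_zero_right, Real.norm_eq_abs] at h2
    have h3 : N2 (d n) < s * ε := (le_abs_self _).trans_lt h2
    have h4 : s⁻¹ * N2 (d n) < ε := by
      rw [inv_mul_lt_iff₀ hs']; exact h3
    have h5 : s * N2 (a n) ≤ ε / 2 := by
      have : N2 (a n) ≤ |K| + 1 := (hKa n).trans (by linarith [le_abs_self K])
      calc s * N2 (a n) ≤ s * (|K| + 1) := by gcongr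
        _ = ε / 2 := by simp only [s]; field_simp
    linarith
  have t2 := hwa _ (memF _ hc0 hb0)
  simp only [e, e0]
  simpa using t1.add t2

lemma Bf_tendsto {K : ℝ} {a c : ℕ → VV → ℝ} {a0 c0 : VV → ℝ} {r : ℝ}
    (ha : ∀ n, MemLp (a n) 2) (hc : ∀ n, MemLp (c n) 2) (hKa : ∀ n, N2 (a n) ≤ K)
    (hKc : ∀ n, N2 (c n) ≤ K) (ha0 : MemLp a0 2) (hc0 : MemLp c0 2) (hwa : WkTo a a0)
    (hwc : WkTo c c0) (hs : ∀ n x, x ∉ Metric.ball (0:VV) r → a n x = 0)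
    (hs0 : ∀ x, x ∉ Metric.ball (0:VV) r → a0 x = 0) :
    Tendsto (fun n => Bf gv (a n) (c n)) atTop (𝓝 (Bf gv a0 c0)) := by
  rw [Metric.tendsto_atTop]
  intro ε hε
  set K' := |K| + N2 a0 + N2 c0 + 1
  have hK' : 0 < K' := by have := N2_nonneg a0; have := N2_nonneg c0; positivity
  obtain ⟨M, hM, hMs⟩ := rM_small (ε := ε / (4 * K')) (by positivity)
  obtain ⟨N, hN⟩ := Metric.tendsto_atTop.1
    (Bf_tendsto_M hM.le ha hc hKa hKc ha0 hc0 hwa hwc hs hs0) (ε / 2) (by positivity)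
  refine ⟨N, fun n hn => ?_⟩
  have h1 := hN n hn
  rw [Real.dist_eq] at h1 ⊢
  rw [Bf_split M hM.le (ha n) (hc n), Bf_split M hM.le ha0 hc0]
  have small : ∀ v w : VV → ℝ, MemLp v 2 → MemLp w 2 → N2 v ≤ K' → N2 w ≤ K' →
      |Bf (fun x => gv x - kM M x) v w| ≤ ε / 4 := by
    intro v w hv hw hv' hw'
    have := Bf_bound (rM_integrable hM.le) hv hw one_pos
    refine this.trans ?_
    have h0 : 0 ≤ ∫ x, |gv x - kM M x| := integral_nonneg fun _ => abs_nonneg _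
    calc 2⁻¹ * (∫ x, |gv x - kM M x|) * (1 * N2 v + 1⁻¹ * N2 w)
        ≤ 2⁻¹ * (ε / (4 * K')) * (1 * K' + 1⁻¹ * K') := by
          have := N2_nonneg v; have := N2_nonneg w
          gcongr
      _ = ε / 4 := by field_simp; norm_num
  have hn1 : N2 (a n) ≤ K' := by
    have := hKa n; have := le_abs_self K; have := N2_nonneg a0; have := N2_nonneg c0
    simp only [K']; linarith
  have hn2 : N2 (c n) ≤ K' := by
    have := hKc n; have := le_abs_self K; have := N2_nonneg a0; have := N2_nonneg c0
    simp only [K']; linarith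
  have hn3 : N2 a0 ≤ K' := by
    have := abs_nonneg K; have := N2_nonneg c0
    simp only [K']; linarith
  have hn4 : N2 c0 ≤ K' := by
    have := abs_nonneg K; have := N2_nonneg a0
    simp only [K']; linarith
  have s1 := abs_le.1 (small _ _ (ha n) (hc n) hn1 hn2)
  have s2 := abs_le.1 (small _ _ ha0 hc0 hn3 hn4)
  rw [abs_lt] at h1 ⊢
  constructor <;> linarith [h1.1, h1.2, s1.1, s1.2, s2.1, s2.2]

end LambPart3

section LambPart4
open Set Topology

noncomputable def trE (p : VV) : VV ≃ᵐ VV := MeasurableEquiv.addRight p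

lemma trE_apply (p x : VV) : trE p x = x + p := rfl

lemma trE_mp (p : VV) : MeasurePreserving (trE p) := measurePreserving_add_right volume p

lemma Bf_translate (k v w : VV → ℝ) (p : VV) :
    Bf k (fun x => v (x + p)) (fun x => w (x + p)) = Bf k v w :=
  Bf_comp (trE p) (trE_mp p) (by intro x y; simp [trE_apply])

lemma N2_translate (w : VV → ℝ) (p : VV) : N2 (fun x => w (x + p)) = N2 w :=
  N2_comp (trE p) (trE_mp p)

lemma Df_translate (lam : ℝ) (w : VV → ℝ) (p : VV) : Df lam (fun x => w (x + p)) = Df lam w := by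
  unfold Df; rw [Bf_translate, N2_translate]

lemma Adm.translate {w : VV → ℝ} (hw : Adm w) (p : VV) : Adm (fun x => w (x + p)) :=
  ⟨hw.l2.comp_measurePreserving (trE_mp p), hw.l1.comp_add_right p, fun x => hw.nn _⟩

lemma vol_ball_real {r : ℝ} (hr : 0 ≤ r) :
    (volume (Metric.ball (0:VV) r)).toReal = r ^ 4 * (volume (Metric.ball (0:VV) 1)).toReal := by
  rw [Measure.addHaar_ball volume (0:VV) hr, ENNReal.toReal_mul, ENNReal.toReal_ofReal (by positivity)]
  simp

lemma Adm.ind_one (r : ℝ) : Adm ((Metric.ball (0:VV) r).indicator fun _ => (1:ℝ)) := by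
  have hf : volume (Metric.ball (0:VV) r) ≠ ⊤ := measure_ball_lt_top.ne
  refine ⟨memLp_indicator_const 2 measurableSet_ball 1 (Or.inr hf),
    (integrable_indicator_iff measurableSet_ball).2 (integrableOn_const hf), fun x => ?_⟩
  exact indicator_nonneg (fun _ _ => zero_le_one) x

lemma exists_Df_pos {lam : ℝ} (hl : 1 < lam) : ∃ w, Adm w ∧ 0 < Df lam w := by
  have h1 : Tendsto (fun n : ℕ => ∫ x in Metric.ball (0:VV) n, gv x) atTop (𝓝 1) := by
    have := (aecover_ball (μ := volume) (x := (0:VV)) (tendsto_natCast_atTop_atTop (R := ℝ))).integral_tendsto_of_countably_generated gv_integrable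
    rwa [gv_integral] at this
  have hl' : lam⁻¹ < 1 := inv_lt_one_of_one_lt₀ hl
  obtain ⟨n, hn, hn1⟩ := ((h1.eventually (lt_mem_nhds hl')).and (eventually_ge_atTop 1)).exists
  set r : ℝ := (n : ℝ)
  set ρ := ∫ x in Metric.ball (0:VV) r, gv x
  have hr : 0 < r := by simp only [r]; exact_mod_cast hn1
  have h2 : Tendsto (fun m : ℕ => (1 - 1 / ((m:ℝ) + 1)) ^ 4 * ρ) atTop (𝓝 ((1 - 0) ^ 4 * ρ)) :=
    ((tendsto_const_nhds.sub tendsto_one_div_add_atTop_nhds_zero_nat).pow 4).mul_const _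
  obtain ⟨m, hm⟩ := (h2.eventually (lt_mem_nhds (by simpa using hn))).exists
  set R : ℝ := r * (m + 1)
  have hR : 0 < R := by positivity
  have hRr : R - r = (1 - 1 / ((m:ℝ) + 1)) * R := by simp only [R]; field_simp
  have hRr0 : 0 ≤ R - r := by simp only [R]; have : (0:ℝ) ≤ r * m := by positivity
                              linarith
  refine ⟨_, Adm.ind_one R, ?_⟩
  set w := (Metric.ball (0:VV) R).indicator fun _ => (1:ℝ)
  have hw : Adm w := Adm.ind_one R
  set c := (volume (Metric.ball (0:VV) 1)).toReal
  have hc : 0 < c := ENNReal.toReal_pos (Metric.measure_ball_pos _ _ one_pos).ne' measure_ball_lt_top.ne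
  have hN : N2 w = R ^ 4 * c := by
    unfold N2
    have : (fun x => w x ^ 2) = w := by
      ext x; simp only [w]; by_cases hx : x ∈ Metric.ball (0:VV) R <;> simp [hx]
    rw [this, integral_indicator measurableSet_ball, setIntegral_const, ← vol_ball_real hR.le]
    simp [Measure.real]
  have hB : (R - r) ^ 4 * c * ρ ≤ Bf gv w w := by
    set w' := (Metric.ball (0:VV) (R - r)).indicator fun _ => (1:ℝ)
    set k := (Metric.ball (0:VV) r).indicator gv
    have hk : Integrable k := gv_integrable.indicator measurableSet_ball
    have hw' : Integrable w' := (Adm.ind_one (R - r)).l1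
    have e1 := sh_integral1 hk hw'
    have e2 : ∫ x, w' x = (R - r) ^ 4 * c := by
      rw [integral_indicator measurableSet_ball, setIntegral_const, ← vol_ball_real hRr0]
      simp [Measure.real]
    have e3 : ∫ x, k x = ρ := integral_indicator measurableSet_ball
    rw [e2, e3] at e1
    rw [mul_comm, ← e1]
    apply integral_mono (sh_int1 hk hw') (Bf_integrable gv_integrable hw.l2 hw.l2)
    intro p
    dsimp only
    by_cases hx : p.1 ∈ Metric.ball (0:VV) (R - r)
    · by_cases hy : p.1 - p.2 ∈ Metric.ball (0:VV) r
      · have hx' : p.1 ∈ Metric.ball (0:VV) R := by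
          rw [mem_ball_zero_iff] at hx ⊢; linarith
        have hy' : p.2 ∈ Metric.ball (0:VV) R := by
          rw [mem_ball_zero_iff] at hx hy ⊢
          have : ‖p.2‖ ≤ ‖p.1‖ + ‖p.1 - p.2‖ := by
            have := norm_sub_le p.1 (p.1 - p.2)
            simpa using this
          linarith
        simp only [w, w', k, indicator_of_mem hx, indicator_of_mem hy, indicator_of_mem hx', indicator_of_mem hy']
        linarith
      · simp only [k, indicator_of_notMem hy, zero_mul]
        exact mul_nonneg (hw.nn _) (mul_nonneg (gv_nonneg _) (hw.nn _))
    · simp only [w', indicator_of_notMem hx, mul_zero]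
      exact mul_nonneg (hw.nn _) (mul_nonneg (gv_nonneg _) (hw.nn _))
  unfold Df
  rw [hN]
  rw [hRr] at hB
  have : 0 < R ^ 4 * c * ((1 - 1 / ((m:ℝ) + 1)) ^ 4 * ρ - lam⁻¹) :=
    mul_pos (by positivity) (sub_pos.2 hm)
  nlinarith

lemma Cst_pos {lam : ℝ} (hl : 1 < lam) : 0 < Cst lam := by
  obtain ⟨w, hw, h⟩ := exists_Df_pos hl
  have := Df_le hl hw
  by_contra hc
  have : Cst lam * (∫ x, w x) ^ 2 ≤ 0 := mul_nonpos_of_nonpos_of_nonneg (not_lt.1 hc) (sq_nonneg _)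
  linarith

lemma gv_tail {R : ℝ} (hR : 0 < R) {x : VV} (hx : x ∉ Metric.ball (0:VV) R) : gv x ≤ gq (R ^ 2) := by
  rw [mem_ball_zero_iff, not_lt] at hx
  apply gq_strictAnti.antitoneOn (by simp; positivity) (pow_pos (lt_of_lt_of_le hR hx) 2)
  gcongr

lemma nonvanish {K m c : ℝ} (hK : 0 ≤ K) (hm : 0 < m) (hc : 0 < c) :
    ∃ η R : ℝ, 0 < η ∧ 0 < R ∧ ∀ w, Adm w → N2 w ≤ K → ∫ x, w x ≤ m → c ≤ Bf gv w w →
      ∃ x, η ≤ ∫ y in Metric.ball x R, w y := by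
  obtain ⟨M, hM, hMs⟩ := rM_small (ε := c / (8 * (K + 1))) (by positivity)
  have ht : Tendsto (fun R : ℝ => gq (R ^ 2)) atTop (𝓝 0) :=
    gq_tendsto.comp (tendsto_pow_atTop (by norm_num))
  obtain ⟨R, hR1, hR⟩ := ((ht.eventually (gt_mem_nhds (show 0 < c / (8 * m ^ 2) by positivity))).and
    (eventually_gt_atTop 0)).exists
  refine ⟨c / (8 * M * m), R, by positivity, hR, fun w hw hN hI hB => ?_⟩
  by_contra hcon
  push Not at hcon
  have hI0 := hw.int_nonneg
  set S := Metric.ball (0:VV) R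
  have hS : MeasurableSet S := measurableSet_ball
  have i1 : Integrable (S.indicator (kM M)) := (kM_integrable hM.le).indicator hS
  have i2 : Integrable (Sᶜ.indicator (kM M)) := (kM_integrable hM.le).indicator hS.compl
  have split : Bf (kM M) w w = Bf (S.indicator (kM M)) w w + Bf (Sᶜ.indicator (kM M)) w w := by
    rw [← Bf_add_ker i1 i2 hw.l2 hw.l2]
    congr 1; ext x; by_cases hx : x ∈ S <;> simp [hx]
  have b1 : Bf (fun x => gv x - kM M x) w w ≤ c / 8 := by
    have := (abs_le.1 (Bf_bound_self (rM_integrable hM.le) hw.l2)).2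
    refine this.trans ?_
    calc (∫ x, |gv x - kM M x|) * N2 w ≤ c / (8 * (K + 1)) * (K + 1) := by
          have := N2_nonneg w
          gcongr; linarith
      _ = c / 8 := by field_simp
  have b2 : Bf (Sᶜ.indicator (kM M)) w w ≤ c / 8 := by
    have := Bf_le_sup i2 (M := gq (R ^ 2)) (fun x => by
      by_cases hx : x ∈ S
      · simp [hx, gq_nonneg]
      · simp only [indicator_of_mem (mem_compl hx)]
        exact (kM_le_gv M x).trans (gv_tail hR hx)) hw.l2 hw.l2 hw.l1 hw.l1 hw.nn hw.nn
    refine this.trans ?_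
    calc gq (R ^ 2) * ((∫ x, w x) * ∫ x, w x) ≤ c / (8 * m ^ 2) * (m * m) := by
          have := gq_nonneg (R ^ 2)
          gcongr
      _ = c / 8 := by field_simp
  have b3 : Bf (S.indicator (kM M)) w w ≤ c / 8 := by
    rw [Bf_eq_cv i1 hw.l2 hw.l2]
    have hcv : ∀ x, cv (S.indicator (kM M)) w x ≤ c / (8 * m) := by
      intro x
      have h1 : cv (S.indicator (kM M)) w x ≤ ∫ y, M * (Metric.ball x R).indicator w y := by
        apply integral_mono_of_nonneg
        · refine Eventually.of_forall fun y => mul_nonneg ?_ (hw.nn y)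
          exact indicator_nonneg (fun z _ => kM_nonneg hM.le z) _
        · exact (hw.l1.indicator measurableSet_ball).const_mul M
        · refine Eventually.of_forall fun y => ?_
          dsimp only
          have hiff : x - y ∈ S ↔ y ∈ Metric.ball x R := by
            simp only [S, Metric.mem_ball, dist_zero_right, dist_eq_norm, sub_zero]; rw [norm_sub_rev]
          by_cases hy : y ∈ Metric.ball x R
          · rw [indicator_of_mem hy, indicator_of_mem (hiff.2 hy)]
            exact mul_le_mul_of_nonneg_right (kM_le M _) (hw.nn y)
          · rw [indicator_of_notMem hy, indicator_of_notMem (fun h => hy (hiff.1 h))]; simp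
      rw [integral_const_mul, integral_indicator measurableSet_ball] at h1
      refine h1.trans ?_
      calc M * ∫ y in Metric.ball x R, w y ≤ M * (c / (8 * M * m)) := by gcongr; exact (hcon x).le
        _ = c / (8 * m) := by field_simp
    calc ∫ x, w x * cv (S.indicator (kM M)) w x ≤ ∫ x, w x * (c / (8 * m)) :=
          integral_mono (Bf_eq_cv_integrable i1 hw.l2 hw.l2) (hw.l1.mul_const _) fun x =>
            mul_le_mul_of_nonneg_left (hcv x) (hw.nn x)
      _ = (∫ x, w x) * (c / (8 * m)) := integral_mul_const _ _
      _ ≤ m * (c / (8 * m)) := by gcongr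
      _ = c / 8 := by field_simp
  have := Bf_split M hM.le hw.l2 hw.l2
  linarith

lemma WkTo.setIntegral {v : ℕ → VV → ℝ} {l : VV → ℝ} (h : WkTo v l) {S : Set VV}
    (hS : MeasurableSet S) (hf : volume S ≠ ⊤) :
    Tendsto (fun n => ∫ x in S, v n x) atTop (𝓝 (∫ x in S, l x)) := by
  have := h (S.indicator fun _ => (1:ℝ)) (memLp_indicator_const 2 hS 1 (Or.inr hf))
  have e : ∀ u : VV → ℝ, ∫ x, u x * S.indicator (fun _ => (1:ℝ)) x = ∫ x in S, u x := by
    intro u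
    rw [← integral_indicator hS]
    congr 1; ext x; by_cases hx : x ∈ S <;> simp [hx]
  simpa only [e] using this

lemma WkTo.nonneg {v : ℕ → VV → ℝ} {l : VV → ℝ} (h : WkTo v l) (hl : MemLp l 2)
    (hv : ∀ n x, 0 ≤ v n x) : ∀ᵐ x, 0 ≤ l x := by
  have hIntg : ∀ S : Set VV, volume S < ⊤ → IntegrableOn l S := by
    intro S hS
    haveI : IsFiniteMeasure (volume.restrict S) := ⟨by simpa using hS⟩
    exact (hl.restrict S).integrable (by norm_num)
  refine ae_nonneg_of_forall_setIntegral_nonneg_of_sigmaFinite (f := l) (fun s hs hs' => hIntg s hs') ?_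
  intro s hs hs'
  exact ge_of_tendsto' (h.setIntegral hs hs'.ne) fun n => setIntegral_nonneg hs fun x _ => hv n x

lemma WkTo.congr_right {v : ℕ → VV → ℝ} {l l' : VV → ℝ} (h : WkTo v l) (e : l =ᵐ[volume] l') :
    WkTo v l' := by
  intro f hf
  have := h f hf
  rwa [integral_congr_ae (g := fun x => l' x * f x) (e.mono fun x hx => by simp [hx])] at this

lemma Adm.ind {w : VV → ℝ} (hw : Adm w) {S : Set VV} (hS : MeasurableSet S) : Adm (S.indicator w) :=
  ⟨hw.l2.indicator hS, hw.l1.indicator hS, fun x => indicator_nonneg (fun y _ => hw.nn y) x⟩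

/-- expansion of Df over a split -/
lemma Df_split (lam : ℝ) {w : VV → ℝ} (hw : MemLp w 2) {S : Set VV} (hS : MeasurableSet S) :
    Df lam w = Df lam (S.indicator w) + 2 * Bf gv (S.indicator w) (Sᶜ.indicator w) +
      Df lam (Sᶜ.indicator w) := by
  have e : w = fun x => S.indicator w x + Sᶜ.indicator w x := by
    ext x; by_cases hx : x ∈ S <;> simp [hx]
  have h1 := hw.indicator hS
  have h2 := hw.indicator hS.compl
  have hB : Bf gv w w = Bf gv (S.indicator w) (S.indicator w) +
      2 * Bf gv (S.indicator w) (Sᶜ.indicator w) + Bf gv (Sᶜ.indicator w) (Sᶜ.indicator w) := by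
    have : Bf gv w w = Bf gv (fun x => S.indicator w x + Sᶜ.indicator w x)
      (fun x => S.indicator w x + Sᶜ.indicator w x) := by rw [← e]
    rw [this, Bf_add_left gv_integrable h1 h2 (show MemLp (fun x => S.indicator w x + Sᶜ.indicator w x) 2 from h1.add h2), Bf_add_right gv_integrable h1 h2 h1,
      Bf_add_right gv_integrable h1 h2 h2, Bf_symm gv_neg (Sᶜ.indicator w) (S.indicator w)]
    ring
  unfold Df
  rw [hB, ← N2_indicator hw hS]; ring

theorem concentration {lam : ℝ} (hl : 1 < lam) {w : ℕ → VV → ℝ} {μ K : ℝ} (hμ : 0 < μ)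
    (hw : ∀ n, Adm (w n)) (hK : ∀ n, N2 (w n) ≤ K)
    (hI : Tendsto (fun n => ∫ x, w n x) atTop (𝓝 μ))
    (hD : Tendsto (fun n => Df lam (w n)) atTop (𝓝 (Cst lam * μ ^ 2))) :
    ∃ φ : ℕ → ℕ, StrictMono φ ∧ ∃ p : ℕ → VV, ∃ v, Adm v ∧ ∫ x, v x = μ ∧
      Df lam v = Cst lam * μ ^ 2 ∧ WkTo (fun n x => w (φ n) (x + p n)) v := by
  have hC := Cst_pos hl
  have hK0 : 0 ≤ K := (N2_nonneg _).trans (hK 0)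
  set c := Cst lam * μ ^ 2
  have hc : 0 < c := by positivity
  obtain ⟨η, R, hη, hR, hnv⟩ := nonvanish hK0 (show 0 < μ + 1 by linarith) (half_pos hc)
  have hev : ∀ᶠ n in atTop, ∃ x, η ≤ ∫ y in Metric.ball x R, w n y := by
    filter_upwards [hI.eventually (gt_mem_nhds (show μ < μ + 1 by linarith)),
      hD.eventually (lt_mem_nhds (show c / 2 < c by linarith))] with n h1 h2
    refine hnv (w n) (hw n) (hK n) h1.le ?_
    unfold Df at h2
    have : 0 ≤ lam⁻¹ * N2 (w n) := mul_nonneg (by positivity) (N2_nonneg _)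
    linarith
  obtain ⟨N, hN⟩ := eventually_atTop.1 hev
  choose! q hq using hN
  -- translated sequence
  set v : ℕ → VV → ℝ := fun n x => w (n + N) (x + q (n + N))
  have hv : ∀ n, Adm (v n) := fun n => (hw _).translate _
  have hvK : ∀ n, N2 (v n) ≤ K := fun n => by simp only [v]; rw [N2_translate]; exact hK _
  have hvI : Tendsto (fun n => ∫ x, v n x) atTop (𝓝 μ) := by
    have : ∀ n, ∫ x, v n x = ∫ x, w (n + N) x := fun n =>
      integral_add_right_eq_self (w (n + N)) (q (n + N))
    simp only [this]; exact hI.comp (tendsto_add_atTop_nat N)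
  have hvD : Tendsto (fun n => Df lam (v n)) atTop (𝓝 c) := by
    have : ∀ n, Df lam (v n) = Df lam (w (n + N)) := fun n => Df_translate _ _ _
    simp only [this]; exact hD.comp (tendsto_add_atTop_nat N)
  have hvη : ∀ n, η ≤ ∫ y in Metric.ball (0:VV) R, v n y := by
    intro n
    have h := hq (n + N) (by omega)
    refine h.trans (le_of_eq ?_)
    rw [← integral_indicator measurableSet_ball, ← integral_indicator measurableSet_ball,
      ← integral_add_right_eq_self _ (q (n + N))]
    congr 1; ext x
    simp only [v, indicator, Metric.mem_ball, dist_eq_norm, add_sub_cancel_right, sub_zero]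
  obtain ⟨φ, hφ, l, hl2, hwk⟩ := wk_subseq (fun n => (hv n).l2) hvK
  have hl0 := hwk.nonneg hl2 (fun n x => (hv _).nn x)
  set u : VV → ℝ := fun x => max (l x) 0
  have hul : l =ᵐ[volume] u := hl0.mono fun x hx => by simp [u, hx]
  have hu2 : MemLp u 2 := hl2.ae_eq hul
  have hwk : WkTo (fun n => v (φ n)) u := hwk.congr_right hul
  have hu0 : ∀ x, 0 ≤ u x := fun x => le_max_right _ _
  have hvI' := hvI.comp hφ.tendsto_atTop
  have hvD' := hvD.comp hφ.tendsto_atTop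
  have hball : ∀ r : ℝ, Tendsto (fun n => ∫ x in Metric.ball (0:VV) r, v (φ n) x) atTop
      (𝓝 (∫ x in Metric.ball (0:VV) r, u x)) := fun r =>
    hwk.setIntegral measurableSet_ball measure_ball_lt_top.ne
  have hmle : ∀ r : ℝ, ∫ x in Metric.ball (0:VV) r, u x ≤ μ := fun r =>
    le_of_tendsto_of_tendsto' (hball r) hvI' fun n =>
      setIntegral_le_integral (hv _).l1 (Eventually.of_forall (hv _).nn)
  have cover := aecover_ball (μ := volume) (x := (0:VV)) (tendsto_natCast_atTop_atTop (R := ℝ))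
  have hu1 : Integrable u := by
    refine cover.integrable_of_integral_bounded_of_nonneg_ae μ (fun n => ?_)
      (Eventually.of_forall hu0) (Eventually.of_forall fun n => hmle n)
    haveI : IsFiniteMeasure (volume.restrict (Metric.ball (0:VV) n)) :=
      ⟨by simpa using measure_ball_lt_top⟩
    exact (hu2.restrict _).integrable (by norm_num)
  have hu : Adm u := ⟨hu2, hu1, hu0⟩
  set m := ∫ x, u x
  have hm : m ≤ μ := le_of_tendsto' (cover.integral_tendsto_of_countably_generated hu1) fun n => hmle n
  have hmη : η ≤ m := (ge_of_tendsto' (hball R) fun n => hvη _).trans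
    (setIntegral_le_integral hu1 (Eventually.of_forall hu0))
  -- key inequality for each ball
  have key : ∀ r : ℝ, c ≤ Df lam u + lam⁻¹ * N2 ((Metric.ball (0:VV) r)ᶜ.indicator u) +
      Cst lam * (μ - ∫ x in Metric.ball (0:VV) r, u x) ^ 2 := by
    intro r
    set S := Metric.ball (0:VV) r
    have hS : MeasurableSet S := measurableSet_ball
    set a : ℕ → VV → ℝ := fun n => S.indicator (v (φ n))
    set b : ℕ → VV → ℝ := fun n => Sᶜ.indicator (v (φ n))
    have ha : ∀ n, Adm (a n) := fun n => (hv _).ind hS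
    have hb : ∀ n, Adm (b n) := fun n => (hv _).ind hS.compl
    have haK : ∀ n, N2 (a n) ≤ K := fun n => (N2_indicator_le (hv _).l2 hS).trans (hvK _)
    have hbK : ∀ n, N2 (b n) ≤ K := fun n => (N2_indicator_le (hv _).l2 hS.compl).trans (hvK _)
    have hwa : WkTo a (S.indicator u) := hwk.indicator hS
    have hwb : WkTo b (Sᶜ.indicator u) := hwk.indicator hS.compl
    have s1 : ∀ n x, x ∉ S → a n x = 0 := fun n x hx => indicator_of_notMem hx _
    have s0 : ∀ x, x ∉ S → S.indicator u x = 0 := fun x hx => indicator_of_notMem hx _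
    have t1 := Bf_tendsto (fun n => (ha n).l2) (fun n => (ha n).l2) haK haK (hu.ind hS).l2
      (hu.ind hS).l2 hwa hwa s1 s0
    have t2 := Bf_tendsto (fun n => (ha n).l2) (fun n => (hb n).l2) haK hbK (hu.ind hS).l2
      (hu.ind hS.compl).l2 hwa hwb s1 s0
    have t3 := hwa _ (hu.ind hS).l2
    have t4 : Tendsto (fun n => ∫ x, b n x) atTop (𝓝 (μ - ∫ x in S, u x)) := by
      refine (hvI'.sub (hball r)).congr fun n => ?_
      simp only [Function.comp, b]
      rw [integral_indicator hS.compl, ← integral_add_compl hS (hv (φ n)).l1]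
      ring
    have lim := ((t1.sub (((t3.const_mul 2).sub_const (N2 (S.indicator u))).const_mul lam⁻¹)).add
      (t2.const_mul 2)).add ((t4.pow 2).const_mul (Cst lam))
    have := le_of_tendsto_of_tendsto' hvD' lim fun n => by
      simp only [Function.comp]
      rw [Df_split lam (hv _).l2 hS]
      have h1 := Df_le hl (hb n)
      have h2 : 2 * (∫ x, a n x * S.indicator u x) - N2 (S.indicator u) ≤ N2 (a n) := by
        have := L2young (ha n).l2 (hu.ind hS).l2 one_pos
        have := (abs_le.1 this).2
        simp at this
        linarith
      have h3 := mul_le_mul_of_nonneg_left h2 (show 0 ≤ lam⁻¹ by positivity)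
      change Df lam (a n) + 2 * Bf gv (a n) (b n) + Df lam (b n) ≤ _
      unfold Df at h1 ⊢
      linarith
    have e1 : ∫ x, S.indicator u x * S.indicator u x = N2 (S.indicator u) := by
      unfold N2; congr 1; ext x; ring
    rw [e1] at this
    have e2 := Df_split lam hu.l2 hS
    have e3 : 0 ≤ Bf gv (Sᶜ.indicator u) (Sᶜ.indicator u) :=
      Bf_nonneg gv_nonneg (hu.ind hS.compl).nn (hu.ind hS.compl).nn
    unfold Df at e2 ⊢
    linarith
  have key2 : c ≤ Df lam u + lam⁻¹ * 0 + Cst lam * (μ - m) ^ 2 := by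
    have t1 : Tendsto (fun n : ℕ => N2 ((Metric.ball (0:VV) n)ᶜ.indicator u)) atTop (𝓝 0) := by
      have h := cover.integral_tendsto_of_countably_generated (L2sq hu2)
      have h2 := h.const_sub (N2 u)
      change Tendsto _ _ (𝓝 (N2 u - N2 u)) at h2
      rw [sub_self] at h2
      refine h2.congr fun n => ?_
      have e := N2_indicator hu2 (S := Metric.ball (0:VV) n) measurableSet_ball
      have : N2 ((Metric.ball (0:VV) n).indicator u) = ∫ x in Metric.ball (0:VV) n, u x ^ 2 := by
        unfold N2
        rw [← integral_indicator measurableSet_ball]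
        congr 1; ext x; by_cases hx : x ∈ Metric.ball (0:VV) n <;> simp [hx]
      linarith
    have t2 := cover.integral_tendsto_of_countably_generated hu1
    exact ge_of_tendsto' (((t1.const_mul lam⁻¹).const_add (Df lam u)).add
      (((t2.const_sub μ).pow 2).const_mul (Cst lam))) fun n => key n
  have hDu := Df_le hl hu
  have hmm : m = μ := by
    have h1 : Cst lam * (m * (μ - m)) ≤ 0 := by
      have : c = Cst lam * μ ^ 2 := rfl
      change Df lam u ≤ Cst lam * m ^ 2 at hDu
      nlinarith
    have h2 : 0 ≤ m * (μ - m) := mul_nonneg (hη.le.trans hmη) (by linarith)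
    have h3 : m * (μ - m) ≤ 0 := by
      by_contra h; push Not at h
      have := mul_pos hC h; linarith
    have h4 : m * (μ - m) = 0 := le_antisymm h3 h2
    rcases mul_eq_zero.1 h4 with h | h
    · linarith
    · linarith
  refine ⟨fun n => φ n + N, fun a b h => by simpa using hφ h, fun n => q (φ n + N), u, hu, hmm, ?_, hwk⟩
  apply le_antisymm
  · change Df lam u ≤ Cst lam * m ^ 2 at hDu
    rw [hmm] at hDu; exact hDu
  · rw [hmm] at key2; simpa using key2

theorem exists_max {lam : ℝ} (hl : 1 < lam) : ∃ v, Adm v ∧ ∫ x, v x = 1 ∧ Df lam v = Cst lam := by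
  have hne : {d | ∃ w, Adm w ∧ ∫ x, w x = 1 ∧ d = Df lam w}.Nonempty := by
    obtain ⟨w, hw, h⟩ := exists_Df_pos hl
    have hi : 0 < ∫ x, w x := by
      rcases hw.int_nonneg.eq_or_lt with h' | h'
      · have := Df_le hl hw; rw [← h'] at this; simp at this; linarith
      · exact h'
    exact ⟨_, _, hw.smul (c := (∫ x, w x)⁻¹) (by positivity), by
      rw [integral_const_mul]; field_simp, rfl⟩
  obtain ⟨d, hd1, hd2, hd3⟩ := exists_seq_tendsto_sSup hne (Cst_bdd hl)
  choose w hw hwi hwd using hd3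
  obtain ⟨C, hC, hB⟩ := Bf_eps (ε := lam⁻¹ / 2) (by positivity)
  have hC0 := Cst_pos hl
  have hd0 : BddBelow (range d) := hd2.bddBelow_range
  obtain ⟨β, hβ⟩ := hd0
  have hK : ∀ n, N2 (w n) ≤ 2 * lam * (C - β) := by
    intro n
    have h1 := hB (w n) (hw n).l2 (hw n).l1 (hw n).nn
    have h2 : β ≤ d n := hβ ⟨n, rfl⟩
    rw [hwd n] at h2
    rw [hwi n] at h1
    unfold Df at h2
    have h3 : lam⁻¹ * N2 (w n) ≤ 2 * (C - β) := by linarith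
    rw [inv_mul_le_iff₀ (by positivity)] at h3
    linarith
  obtain ⟨φ, -, p, v, hv, hv1, hv2, -⟩ := concentration hl one_pos hw hK
    (by simp only [hwi]; exact tendsto_const_nhds) (by
      simp only [← hwd, one_pow, mul_one]; exact hd2)
  exact ⟨v, hv, hv1, by simpa using hv2⟩

end LambPart4

section LambPart5
open Set Topology

/-- affine reflection across `⟪e,x⟫ = d` -/
noncomputable def sg (e : VV) (d : ℝ) : VV ≃ᵐ VV :=
  (LinearIsometryEquiv.toMeasurableEquiv ((Submodule.span ℝ {e})ᗮ.reflection)).trans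
    (trE ((2 * d) • e))

lemma sg_mp (e : VV) (d : ℝ) : MeasurePreserving (sg e d) :=
  (trE_mp _).comp (LinearIsometryEquiv.measurePreserving _)

lemma sg_apply' (e : VV) (d : ℝ) (x : VV) :
    sg e d x = (Submodule.span ℝ {e})ᗮ.reflection x + (2 * d) • e := rfl

lemma sg_apply {e : VV} (he : ‖e‖ = 1) (d : ℝ) (x : VV) :
    sg e d x = x - (2 * (inner ℝ e x - d)) • e := by
  rw [sg_apply', Submodule.reflection_orthogonal_apply, Submodule.reflection_singleton_apply, he]
  simp only [RCLike.ofReal_one, one_pow, div_one, two_smul]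
  module

lemma sg_dist (e : VV) (d : ℝ) (x y : VV) : ‖sg e d x - sg e d y‖ = ‖x - y‖ := by
  rw [sg_apply', sg_apply', add_sub_add_right_eq_sub, ← map_sub, LinearIsometryEquiv.norm_map]

lemma inner_sg {e : VV} (he : ‖e‖ = 1) (d : ℝ) (x : VV) :
    inner ℝ e (sg e d x) = 2 * d - inner ℝ e x := by
  rw [sg_apply he, inner_sub_right, inner_smul_right, real_inner_self_eq_norm_sq, he]; ring

lemma sg_sg {e : VV} (he : ‖e‖ = 1) (d : ℝ) (x : VV) : sg e d (sg e d x) = x := by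
  rw [sg_apply he d (sg e d x), inner_sg he, sg_apply he]; module

lemma gv_sg (e : VV) (d : ℝ) (x y : VV) : gv (sg e d x - sg e d y) = gv (x - y) := by
  unfold gv; rw [sg_dist]

lemma gv_sg' {e : VV} (he : ‖e‖ = 1) (d : ℝ) (x y : VV) : gv (sg e d x - y) = gv (x - sg e d y) := by
  rw [← gv_sg e d (sg e d x) y, sg_sg he]

lemma norm_sub_sg {e : VV} (he : ‖e‖ = 1) (d : ℝ) (x y : VV) :
    ‖x - sg e d y‖ ^ 2 = ‖x - y‖ ^ 2 + 4 * ((inner ℝ e x - d) * (inner ℝ e y - d)) := by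
  rw [sg_apply he]
  have : x - (y - (2 * (inner ℝ e y - d)) • e) = (x - y) + (2 * (inner ℝ e y - d)) • e := by abel
  rw [this, norm_add_sq_real, inner_smul_right, norm_smul, he, real_inner_comm e (x - y), inner_sub_right]
  rw [Real.norm_eq_abs, mul_one, sq_abs]; ring

lemma gv_gap {e : VV} (he : ‖e‖ = 1) {d : ℝ} {x y : VV} (hx : d < inner ℝ e x)
    (hy : d < inner ℝ e y) (hxy : x ≠ y) : gv (x - sg e d y) < gv (x - y) := by
  have h1 : 0 < ‖x - y‖ := norm_pos_iff.2 (sub_ne_zero.2 hxy)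
  have h2 := norm_sub_sg he d x y
  have h3 : 0 < (inner ℝ e x - d) * (inner ℝ e y - d) := mul_pos (by linarith) (by linarith)
  unfold gv
  apply gq_strictAnti
  · simp only [mem_Ioi]; positivity
  · simp only [mem_Ioi]; rw [h2]; positivity
  · rw [h2]; linarith

def Hs (e : VV) (d : ℝ) : Set VV := {x | d < inner ℝ e x}

lemma Hs_meas (e : VV) (d : ℝ) : MeasurableSet (Hs e d) :=
  (isOpen_lt continuous_const (by fun_prop)).measurableSet

lemma hyper_null {e : VV} (he : ‖e‖ = 1) (d : ℝ) : ∀ᵐ x : VV, inner ℝ e x ≠ d := by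
  have h0 : ∀ᵐ x : VV, inner ℝ e x ≠ (0:ℝ) := by
    have : volume ((LinearMap.ker (innerSL ℝ e : VV →ₗ[ℝ] ℝ) : Submodule ℝ VV) : Set VV) = 0 := by
      apply Measure.addHaar_submodule
      intro h
      have h2 : e ∈ (LinearMap.ker (innerSL ℝ e : VV →ₗ[ℝ] ℝ)) := by rw [h]; trivial
      rw [LinearMap.mem_ker] at h2
      change inner ℝ e e = (0:ℝ) at h2
      rw [real_inner_self_eq_norm_sq, he] at h2; norm_num at h2
    rw [ae_iff]
    convert this using 2
    ext x; simp
  have h1 := (trE_mp ((-d) • e)).quasiMeasurePreserving.ae h0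
  filter_upwards [h1] with x hx h
  apply hx
  rw [trE_apply, inner_add_right, inner_smul_right, real_inner_self_eq_norm_sq, he, h]; ring

lemma Bf_sub_left {k u v w : VV → ℝ} (hk : Integrable k) (hu : MemLp u 2) (hv : MemLp v 2)
    (hw : MemLp w 2) : Bf k (fun x => u x - v x) w = Bf k u w - Bf k v w := by
  unfold Bf
  rw [← integral_sub (Bf_integrable hk hu hw) (Bf_integrable hk hv hw)]
  congr 1; ext p; ring

lemma Bf_sub_right {k u v w : VV → ℝ} (hk : Integrable k) (hu : MemLp u 2) (hv : MemLp v 2)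
    (hw : MemLp w 2) : Bf k w (fun x => u x - v x) = Bf k w u - Bf k w v := by
  unfold Bf
  rw [← integral_sub (Bf_integrable hk hw hu) (Bf_integrable hk hw hv)]
  congr 1; ext p; ring

lemma memLp_sg {f : VV → ℝ} (hf : MemLp f 2) (e : VV) (d : ℝ) : MemLp (fun x => f (sg e d x)) 2 :=
  hf.comp_measurePreserving (sg_mp e d)

lemma int_sg (f : VV → ℝ) (e : VV) (d : ℝ) : ∫ x, f (sg e d x) = ∫ x, f x :=
  (sg_mp e d).integral_comp (sg e d).measurableEmbedding f

/-- antisymmetrised form -/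
lemma pol_B {e : VV} (he : ‖e‖ = 1) (d : ℝ) {s t : VV → ℝ} (hs : MemLp s 2) (ht : MemLp t 2)
    (hsym : ∀ x, s (sg e d x) = s x) :
    Bf gv (fun x => 2⁻¹ * (s x + (t x - t (sg e d x)))) (fun x => 2⁻¹ * (s x + (t x - t (sg e d x)))) =
      4⁻¹ * Bf gv s s + 2⁻¹ * (Bf gv t t - Bf gv t (fun x => t (sg e d x))) := by
  set t' : VV → ℝ := fun x => t (sg e d x)
  have ht' : MemLp t' 2 := memLp_sg ht e d
  have hu : MemLp (fun x => t x - t' x) 2 := ht.sub ht'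
  have hsu : MemLp (fun x => s x + (t x - t' x)) 2 := hs.add hu
  have g1 := gv_integrable
  have c1 : Bf gv s t' = Bf gv s t := by
    have := Bf_comp (k := gv) (v := s) (w := t) (sg e d) (sg_mp e d) (gv_sg e d)
    rw [← this]; simp only [hsym]; rfl
  have c2 : Bf gv t' t' = Bf gv t t := Bf_comp (sg e d) (sg_mp e d) (gv_sg e d)
  have c3 : Bf gv t' t = Bf gv t t' := Bf_symm gv_neg _ _
  rw [Bf_smul_left, Bf_smul_right]
  change 2⁻¹ * (2⁻¹ * Bf gv (fun x => s x + (t x - t' x)) (fun x => s x + (t x - t' x))) = _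
  rw [Bf_add_left g1 hs hu hsu, Bf_add_right g1 hs hu hs, Bf_add_right g1 hs hu hu,
    Bf_symm gv_neg (fun x => t x - t' x) s, Bf_sub_right g1 ht ht' hs, Bf_sub_left g1 ht ht' hu,
    Bf_sub_right g1 ht ht' ht, Bf_sub_right g1 ht ht' ht', c1, c2, c3]
  ring

lemma pol_N {e : VV} (he : ‖e‖ = 1) (d : ℝ) {s t : VV → ℝ} (hs : MemLp s 2) (ht : MemLp t 2)
    (hsym : ∀ x, s (sg e d x) = s x) (hsupp : ∀ x, x ∉ Hs e d → t x = 0) :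
    N2 (fun x => 2⁻¹ * (s x + (t x - t (sg e d x)))) = 4⁻¹ * N2 s + 2⁻¹ * N2 t := by
  have ht' := memLp_sg ht e d
  have h0 : ∀ x, t x * t (sg e d x) = 0 := by
    intro x
    by_cases hx : x ∈ Hs e d
    · rw [hsupp (sg e d x), mul_zero]
      simp only [Hs, mem_ofPred_eq] at hx ⊢
      rw [inner_sg he]; linarith
    · rw [hsupp x hx, zero_mul]
  have e1 : (fun x => (2⁻¹ * (s x + (t x - t (sg e d x)))) ^ 2) = fun x =>
      (4⁻¹ * s x ^ 2 + (2⁻¹ * (s x * t x) - 2⁻¹ * (s x * t (sg e d x)))) + (4⁻¹ * t x ^ 2 + 4⁻¹ * t (sg e d x) ^ 2) := by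
    ext x
    have := h0 x
    linear_combination (-(1/2)) * this
  have i1 := (L2sq hs).const_mul 4⁻¹
  have i2 := (L2mul hs ht).const_mul 2⁻¹
  have i3 := (L2mul hs ht').const_mul 2⁻¹
  have i4 := (L2sq ht).const_mul 4⁻¹
  have i5 := (L2sq ht').const_mul 4⁻¹
  unfold N2
  have i23 : Integrable (fun x => 2⁻¹ * (s x * t x) - 2⁻¹ * (s x * t (sg e d x))) := i2.sub i3
  have i123 : Integrable (fun x => 4⁻¹ * s x ^ 2 + (2⁻¹ * (s x * t x) - 2⁻¹ * (s x * t (sg e d x)))) := i1.add i23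
  have i45 : Integrable (fun x => 4⁻¹ * t x ^ 2 + 4⁻¹ * t (sg e d x) ^ 2) := i4.add i5
  rw [e1, integral_add i123 i45, integral_add i1 i23,
    integral_sub i2 i3, integral_add i4 i5]
  simp only [integral_const_mul]
  have e2 : ∫ x, s x * t (sg e d x) = ∫ x, s x * t x := by
    rw [← int_sg (fun x => s x * t x) e d]; simp only [hsym]
  have e3 : ∫ x, t (sg e d x) ^ 2 = ∫ x, t x ^ 2 := int_sg (fun x => t x ^ 2) e d
  rw [e2, e3]; ring

lemma Bf_sg_right {e : VV} (he : ‖e‖ = 1) (d : ℝ) (v w : VV → ℝ) :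
    Bf gv v (fun x => w (sg e d x)) =
      ∫ p : VV × VV, v p.1 * (gv (p.1 - sg e d p.2) * w p.2) ∂(volume.prod volume) := by
  unfold Bf
  have h := ((MeasurePreserving.id (volume : Measure VV)).prod (sg_mp e d)).integral_comp
    (MeasurableEquiv.prodCongr (MeasurableEquiv.refl VV) (sg e d)).measurableEmbedding
    (fun p : VV × VV => v p.1 * (gv (p.1 - sg e d p.2) * w p.2))
  rw [← h]
  congr 1; ext p
  simp [sg_sg he]

lemma Bf_sg_right_integrable {e : VV} (he : ‖e‖ = 1) (d : ℝ) {v w : VV → ℝ} (hv : MemLp v 2) (hw : MemLp w 2) :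
    Integrable (fun p : VV × VV => v p.1 * (gv (p.1 - sg e d p.2) * w p.2)) (volume.prod volume) := by
  have h := ((MeasurePreserving.id (volume : Measure VV)).prod (sg_mp e d)).integrable_comp_of_integrable
    (Bf_integrable gv_integrable hv (memLp_sg hw e d))
  refine h.congr (Eventually.of_forall fun p => ?_)
  simp [Function.comp, sg_sg he]

/-- maximizer -/
def IsMx (lam : ℝ) (w : VV → ℝ) : Prop := Adm w ∧ Df lam w = Cst lam * (∫ x, w x) ^ 2

lemma sign_of_int {h : VV → ℝ} (hh : Integrable h)
    (hp : ∀ᵐ p : VV × VV ∂(volume.prod volume), |h p.1 * h p.2| = h p.1 * h p.2) :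
    (∀ᵐ x, 0 ≤ h x) ∨ (∀ᵐ x, h x ≤ 0) := by
  have e1 : (∫ x, |h x|) * (∫ x, |h x|) = (∫ x, h x) * ∫ x, h x := by
    rw [← integral_prod_mul, ← integral_prod_mul]
    apply integral_congr_ae
    filter_upwards [hp] with p hp
    rw [← abs_mul, hp]
  rcases mul_self_eq_mul_self_iff.1 e1 with h1 | h1
  · left
    have : ∫ x, (|h x| - h x) = 0 := by rw [integral_sub hh.abs hh, h1, sub_self]
    have := (integral_eq_zero_iff_of_nonneg (fun x => sub_nonneg.2 (le_abs_self (h x))) (hh.abs.sub hh)).1 this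
    filter_upwards [this] with x hx
    simp only [Pi.zero_apply] at hx
    have := abs_nonneg (h x); linarith
  · right
    have : ∫ x, (|h x| + h x) = 0 := by rw [integral_add hh.abs hh, h1]; ring
    have := (integral_eq_zero_iff_of_nonneg (fun x => by
      have := neg_abs_le (h x); simp only [Pi.zero_apply, Pi.add_apply]; linarith) (hh.abs.add hh)).1 this
    filter_upwards [this] with x hx
    simp only [Pi.zero_apply, Pi.add_apply] at hx
    have := abs_nonneg (h x); linarith

lemma diag_null : ∀ᵐ p : VV × VV ∂(volume.prod volume), p.1 ≠ p.2 := by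
  have : (volume.prod volume) (diagonal VV) = 0 := by
    rw [Measure.measure_prod_null measurableSet_diagonal]
    refine Eventually.of_forall fun x => ?_
    have : Prod.mk x ⁻¹' diagonal VV = {x} := by ext y; simp [eq_comm]
    change volume (Prod.mk x ⁻¹' diagonal VV) = 0
    rw [this]; simp
  rw [ae_iff]; convert this using 2
  ext p; simp [diagonal]

theorem pol_alt {lam : ℝ} (hl : 1 < lam) {w : VV → ℝ} (hw : IsMx lam w) {e : VV} (he : ‖e‖ = 1) (d : ℝ) :
    (∀ᵐ x, x ∈ Hs e d → w (sg e d x) ≤ w x) ∨ (∀ᵐ x, x ∈ Hs e d → w x ≤ w (sg e d x)) := by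
  obtain ⟨ha, hD⟩ := hw
  set w' : VV → ℝ := fun x => w (sg e d x)
  have hw'2 : MemLp w' 2 := memLp_sg ha.l2 e d
  have hw'1 : Integrable w' := (sg_mp e d).integrable_comp_of_integrable ha.l1
  set s : VV → ℝ := fun x => w x + w' x
  have hs : MemLp s 2 := ha.l2.add hw'2
  have hsym : ∀ x, s (sg e d x) = s x := by intro x; simp only [s, w', sg_sg he]; ring
  set h : VV → ℝ := (Hs e d).indicator fun x => w x - w' x
  have hh2 : MemLp h 2 := (ha.l2.sub hw'2).indicator (Hs_meas e d)
  have hh1 : Integrable h := (ha.l1.sub hw'1).indicator (Hs_meas e d)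
  have hsupp : ∀ x, x ∉ Hs e d → h x = 0 := fun x hx => indicator_of_notMem hx _
  have hsupp' : ∀ x, x ∉ Hs e d → |h x| = 0 := fun x hx => by rw [hsupp x hx, abs_zero]
  have hbd : ∀ x, |h x| ≤ w x + w' x := by
    intro x
    by_cases hx : x ∈ Hs e d
    · simp only [h, indicator_of_mem hx]
      have := ha.nn x; have : 0 ≤ w' x := ha.nn _
      rw [abs_le]; constructor <;> linarith
    · rw [hsupp' x hx]; exact add_nonneg (ha.nn _) (ha.nn _)
  -- w as P h
  have ew : w =ᵐ[volume] fun x => 2⁻¹ * (s x + (h x - h (sg e d x))) := by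
    filter_upwards [hyper_null he d] with x hx
    rcases lt_or_gt_of_ne hx with hx | hx
    · have h1 : x ∉ Hs e d := by simp only [Hs, mem_ofPred_eq]; linarith
      have h2 : sg e d x ∈ Hs e d := by simp only [Hs, mem_ofPred_eq]; rw [inner_sg he]; linarith
      rw [hsupp x h1]
      simp only [h, indicator_of_mem h2, w', s, sg_sg he]; ring
    · have h1 : x ∈ Hs e d := hx
      have h2 : sg e d x ∉ Hs e d := by simp only [Hs, mem_ofPred_eq]; rw [inner_sg he]; linarith
      rw [hsupp _ h2]
      simp only [h, indicator_of_mem h1, s]; ring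
  have hah2 : MemLp (fun x => |h x|) 2 := hh2.norm
  set P : VV → ℝ := fun x => 2⁻¹ * (s x + (|h x| - |h (sg e d x)|))
  have hP2 : MemLp P 2 := (hs.add (hah2.sub (memLp_sg hah2 e d))).const_mul 2⁻¹
  have hah1' : Integrable (fun x => |h (sg e d x)|) :=
    (sg_mp e d).integrable_comp_of_integrable hh1.abs
  have hP1 : Integrable P := ((ha.l1.add hw'1).add (hh1.abs.sub hah1')).const_mul 2⁻¹
  have hPa : Adm P := by
    refine ⟨hP2, hP1, fun x => ?_⟩
    have h1 := hbd (sg e d x)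
    have h2 : w (sg e d x) + w' (sg e d x) = s x := hsym x
    have := abs_nonneg (h x)
    simp only [P]; linarith
  have hPI : ∫ x, P x = ∫ x, w x := by
    simp only [P]
    rw [integral_const_mul]
    have : ∫ x, (s x + (|h x| - |h (sg e d x)|)) = (∫ x, s x) + ((∫ x, |h x|) - ∫ x, |h (sg e d x)|) := by
      have i1 : Integrable s := ha.l1.add hw'1
      have i2 : Integrable (fun x => |h x| - |h (sg e d x)|) := hh1.abs.sub hah1'
      rw [integral_add i1 i2, integral_sub hh1.abs hah1']
    rw [this, int_sg (fun x => |h x|)]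
    have : ∫ x, s x = (∫ x, w x) + ∫ x, w x := by
      simp only [s]
      rw [integral_add ha.l1 hw'1]
      simp only [w', int_sg]
    rw [this]; ring
  have hN : N2 P = N2 w := by
    have e1 : N2 w = N2 (fun x => 2⁻¹ * (s x + (h x - h (sg e d x)))) := by
      unfold N2; exact integral_congr_ae (ew.mono fun x hx => by simp only [hx])
    rw [e1, pol_N he d hs hh2 hsym hsupp]
    have := pol_N he d (t := fun x => |h x|) hs hah2 hsym hsupp'
    simp only [P]
    rw [this]
    have : N2 (fun x => |h x|) = N2 h := by unfold N2; simp only [sq_abs]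
    rw [this]
  have hBP : Bf gv P P ≤ Bf gv w w := by
    have := Df_le hl hPa
    rw [hPI, ← hD] at this
    unfold Df at this
    rw [hN] at this; linarith
  rw [Bf_congr ew ew, pol_B he d hs hh2 hsym] at hBP
  have e2 := pol_B he d (t := fun x => |h x|) hs hah2 hsym
  change Bf gv P P = _ at e2
  rw [e2, Bf_sg_right he, Bf_sg_right he d (fun x => |h x|) (fun x => |h x|)] at hBP
  have j1 := Bf_integrable gv_integrable hh2 hh2
  have j2 := Bf_sg_right_integrable he d hh2 hh2
  have j3 := Bf_integrable gv_integrable hah2 hah2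
  have j4 := Bf_sg_right_integrable he d hah2 hah2
  unfold Bf at hBP
  rw [← integral_sub j1 j2, ← integral_sub j3 j4] at hBP
  have j5 := (j3.sub j4).sub (j1.sub j2)
  have hnn : ∀ p : VV × VV, 0 ≤ (|h p.1| * (gv (p.1 - p.2) * |h p.2|) - |h p.1| * (gv (p.1 - sg e d p.2) * |h p.2|))
      - (h p.1 * (gv (p.1 - p.2) * h p.2) - h p.1 * (gv (p.1 - sg e d p.2) * h p.2)) ∨ p.1 = p.2 := by
    intro p
    by_cases hp : p.1 = p.2
    · right; exact hp
    left
    by_cases h1 : p.1 ∈ Hs e d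
    · by_cases h2 : p.2 ∈ Hs e d
      · have := gv_gap he h1 h2 hp
        have h3 : 0 ≤ |h p.1| * |h p.2| - h p.1 * h p.2 := by
          rw [← abs_mul]; linarith [le_abs_self (h p.1 * h p.2)]
        nlinarith [mul_nonneg (sub_nonneg.2 this.le) h3]
      · simp [hsupp _ h2]
    · simp [hsupp _ h1]
  have hnn' : 0 ≤ᵐ[volume.prod volume] fun p : VV × VV => (|h p.1| * (gv (p.1 - p.2) * |h p.2|) - |h p.1| * (gv (p.1 - sg e d p.2) * |h p.2|))
      - (h p.1 * (gv (p.1 - p.2) * h p.2) - h p.1 * (gv (p.1 - sg e d p.2) * h p.2)) := by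
    filter_upwards [diag_null] with p hp
    exact (hnn p).resolve_right hp
  have hz : ∫ p : VV × VV, ((|h p.1| * (gv (p.1 - p.2) * |h p.2|) - |h p.1| * (gv (p.1 - sg e d p.2) * |h p.2|))
      - (h p.1 * (gv (p.1 - p.2) * h p.2) - h p.1 * (gv (p.1 - sg e d p.2) * h p.2))) ∂(volume.prod volume) = 0 := by
    apply le_antisymm
    · have j34 : Integrable (fun p : VV × VV => |h p.1| * (gv (p.1 - p.2) * |h p.2|) - |h p.1| * (gv (p.1 - sg e d p.2) * |h p.2|)) (volume.prod volume) := j3.sub j4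
      have j12 : Integrable (fun p : VV × VV => h p.1 * (gv (p.1 - p.2) * h p.2) - h p.1 * (gv (p.1 - sg e d p.2) * h p.2)) (volume.prod volume) := j1.sub j2
      rw [integral_sub j34 j12]
      linarith
    · exact integral_nonneg_of_ae hnn'
  have hz2 := (integral_eq_zero_iff_of_nonneg_ae hnn' j5).1 hz
  have hsign : ∀ᵐ p : VV × VV ∂(volume.prod volume), |h p.1 * h p.2| = h p.1 * h p.2 := by
    filter_upwards [hz2, diag_null] with p hp hpd
    by_cases h1 : p.1 ∈ Hs e d
    · by_cases h2 : p.2 ∈ Hs e d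
      · have := gv_gap he h1 h2 hpd
        simp only [Pi.zero_apply] at hp
        have h3 : (gv (p.1 - p.2) - gv (p.1 - sg e d p.2)) * (|h p.1| * |h p.2| - h p.1 * h p.2) = 0 := by
          linarith
        rcases mul_eq_zero.1 h3 with h3 | h3
        · linarith
        · rw [abs_mul]; linarith
      · simp [hsupp _ h2]
    · simp [hsupp _ h1]
  rcases sign_of_int hh1 hsign with h1 | h1
  · left
    filter_upwards [h1] with x hx hxH
    simp only [h, indicator_of_mem hxH] at hx
    simp only [w'] at hx; linarith
  · right
    filter_upwards [h1] with x hx hxH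
    simp only [h, indicator_of_mem hxH] at hx
    simp only [w'] at hx; linarith

end LambPart5

section LambPart6
open Set Topology

lemma sg_neg {e : VV} (he : ‖e‖ = 1) (d : ℝ) (x : VV) : sg (-e) (-d) x = sg e d x := by
  rw [sg_apply (by rw [norm_neg, he]), sg_apply he, inner_neg_left]; module

lemma int_Hs_sg {e : VV} (he : ‖e‖ = 1) (d : ℝ) {w : VV → ℝ} (hw : Integrable w) :
    ∫ x in Hs e d, w (sg e d x) = (∫ x, w x) - ∫ x in Hs e d, w x := by
  have h1 : ∫ x in Hs e d, w (sg e d x) = ∫ x in (Hs e d)ᶜ, w x := by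
    rw [← integral_indicator (Hs_meas e d), ← integral_indicator (Hs_meas e d).compl,
      ← int_sg ((Hs e d)ᶜ.indicator w) e d]
    apply integral_congr_ae
    filter_upwards [hyper_null he d] with x hx
    simp only [indicator]
    have : x ∈ Hs e d ↔ sg e d x ∈ (Hs e d)ᶜ := by
      simp only [Hs, mem_compl_iff, mem_ofPred_eq, inner_sg he]
      constructor
      · intro h; linarith
      · intro h; push Not at h
        exact lt_of_le_of_ne (by linarith) (Ne.symm hx)
    by_cases h : x ∈ Hs e d
    · rw [if_pos h, if_pos (this.1 h)]
    · rw [if_neg h, if_neg (fun h' => h (this.2 h'))]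
  rw [h1, ← integral_add_compl (Hs_meas e d) hw]; ring

lemma eq_of_int_eq {S : Set VV} (hS : MeasurableSet S) {f g : VV → ℝ} (hf : IntegrableOn f S) (hg : IntegrableOn g S)
    (hle : ∀ᵐ x, x ∈ S → f x ≤ g x) (hi : ∫ x in S, g x ≤ ∫ x in S, f x) : ∀ᵐ x, x ∈ S → f x = g x := by
  have h1 : 0 ≤ᵐ[volume.restrict S] fun x => g x - f x := by
    rw [EventuallyLE, ae_restrict_iff' hS]
    filter_upwards [hle] with x hx hxS
    simp only [Pi.zero_apply]; linarith [hx hxS]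
  have h2 : ∫ x in S, (g x - f x) = 0 := by
    apply le_antisymm _ (integral_nonneg_of_ae h1)
    rw [integral_sub hg hf]; linarith
  have h3 := (integral_eq_zero_iff_of_nonneg_ae h1 (hg.sub hf)).1 h2
  rw [EventuallyEq, ae_restrict_iff' hS] at h3
  filter_upwards [h3] with x hx hxS
  have := hx hxS
  simp only [Pi.zero_apply] at this; linarith

lemma pol_mass {lam : ℝ} (hl : 1 < lam) {w : VV → ℝ} (hw : IsMx lam w) {e : VV} (he : ‖e‖ = 1) (d : ℝ)
    (hm : ∫ x, w x ≤ 2 * ∫ x in Hs e d, w x) : ∀ᵐ x, x ∈ Hs e d → w (sg e d x) ≤ w x := by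
  rcases pol_alt hl hw he d with h | h
  · exact h
  have i1 := hw.1.l1.integrableOn (s := Hs e d)
  have i2 : IntegrableOn (fun x => w (sg e d x)) (Hs e d) :=
    ((sg_mp e d).integrable_comp_of_integrable hw.1.l1).integrableOn
  have := eq_of_int_eq (Hs_meas e d) i1 i2 h (by rw [int_Hs_sg he d hw.1.l1]; linarith)
  filter_upwards [this] with x hx hxH
  rw [hx hxH]

lemma sym_of_bisect {lam : ℝ} (hl : 1 < lam) {w : VV → ℝ} (hw : IsMx lam w) {e : VV} (he : ‖e‖ = 1) (d : ℝ)
    (hm : ∫ x, w x = 2 * ∫ x in Hs e d, w x) : ∀ᵐ x, w (sg e d x) = w x := by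
  have h := pol_mass hl hw he d hm.le
  have i1 := hw.1.l1.integrableOn (s := Hs e d)
  have i2 : IntegrableOn (fun x => w (sg e d x)) (Hs e d) :=
    ((sg_mp e d).integrable_comp_of_integrable hw.1.l1).integrableOn
  have h2 := eq_of_int_eq (Hs_meas e d) i2 i1 h (by rw [int_Hs_sg he d hw.1.l1]; linarith)
  have h3 := (sg_mp e d).quasiMeasurePreserving.ae h2
  filter_upwards [h2, h3, hyper_null he d] with x hx hx3 hd
  rcases lt_or_gt_of_ne hd with hd | hd
  · rw [sg_sg he] at hx3
    exact (hx3 (by simp only [Hs, mem_ofPred_eq, inner_sg he]; linarith)).symm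
  · exact hx hd

lemma Hs_cont {e : VV} (he : ‖e‖ = 1) {w : VV → ℝ} (hw : Integrable w) :
    Continuous fun d => ∫ x in Hs e d, w x := by
  rw [continuous_iff_continuousAt]
  intro d0
  have : (fun d => ∫ x in Hs e d, w x) = fun d => ∫ x, (Hs e d).indicator w x := by
    ext d; rw [integral_indicator (Hs_meas e d)]
  rw [this]
  apply continuousAt_of_dominated (bound := fun x => |w x|)
  · exact Eventually.of_forall fun d => (hw.indicator (Hs_meas e d)).aestronglyMeasurable
  · exact Eventually.of_forall fun d => Eventually.of_forall fun x => norm_indicator_le_norm_self _ _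
  · exact hw.abs
  · filter_upwards [hyper_null he d0] with x hx
    apply ContinuousAt.congr (f := fun _ => (Hs e d0).indicator w x) continuousAt_const
    rcases lt_or_gt_of_ne hx with hx | hx
    · filter_upwards [lt_mem_nhds hx] with d hd
      rw [indicator_of_notMem, indicator_of_notMem] <;> simp only [Hs, mem_ofPred_eq] <;> linarith
    · filter_upwards [gt_mem_nhds hx] with d hd
      rw [indicator_of_mem, indicator_of_mem] <;> simp only [Hs, mem_ofPred_eq] <;> linarith

lemma Hs_lim_top (e : VV) {w : VV → ℝ} (hw : Integrable w) :
    Tendsto (fun n : ℕ => ∫ x in Hs e n, w x) atTop (𝓝 0) := by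
  have : (fun n : ℕ => ∫ x in Hs e n, w x) = fun n : ℕ => ∫ x, (Hs e n).indicator w x := by
    ext d; rw [integral_indicator (Hs_meas e d)]
  rw [this, show (0:ℝ) = ∫ x : VV, (0:ℝ) by simp]
  apply tendsto_integral_of_dominated_convergence (fun x => |w x|)
  · exact fun d => (hw.indicator (Hs_meas e d)).aestronglyMeasurable
  · exact hw.abs
  · exact fun d => Eventually.of_forall fun x => norm_indicator_le_norm_self _ _
  · refine Eventually.of_forall fun x => ?_
    apply tendsto_const_nhds.congr'
    obtain ⟨N, hN⟩ := exists_nat_ge (inner ℝ e x)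
    filter_upwards [eventually_ge_atTop N] with n hn
    rw [indicator_of_notMem]
    simp only [Hs, mem_ofPred_eq, not_lt]
    exact hN.trans (by exact_mod_cast hn)

lemma Hs_lim_bot (e : VV) {w : VV → ℝ} (hw : Integrable w) :
    Tendsto (fun n : ℕ => ∫ x in Hs e (-(n:ℝ)), w x) atTop (𝓝 (∫ x, w x)) := by
  have : (fun n : ℕ => ∫ x in Hs e (-(n:ℝ)), w x) = fun n : ℕ => ∫ x, (Hs e (-(n:ℝ))).indicator w x := by
    ext d; rw [integral_indicator (Hs_meas e _)]
  rw [this]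
  apply tendsto_integral_of_dominated_convergence (fun x => |w x|)
  · exact fun d => (hw.indicator (Hs_meas e _)).aestronglyMeasurable
  · exact hw.abs
  · exact fun d => Eventually.of_forall fun x => norm_indicator_le_norm_self _ _
  · refine Eventually.of_forall fun x => ?_
    apply tendsto_const_nhds.congr'
    obtain ⟨N, hN⟩ := exists_nat_gt (-inner ℝ e x)
    filter_upwards [eventually_ge_atTop N] with n hn
    rw [indicator_of_mem]
    simp only [Hs, mem_ofPred_eq]
    have : (N:ℝ) ≤ n := by exact_mod_cast hn
    linarith

lemma exists_bisect {e : VV} (he : ‖e‖ = 1) {w : VV → ℝ} (hw : Integrable w) (hpos : 0 < ∫ x, w x) :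
    ∃ d, ∫ x, w x = 2 * ∫ x in Hs e d, w x := by
  obtain ⟨n, hn⟩ := ((Hs_lim_top e hw).eventually_lt_const (half_pos hpos)).exists
  obtain ⟨m, hm⟩ := ((Hs_lim_bot e hw).eventually_const_lt (half_lt_self hpos)).exists
  obtain ⟨d, hd⟩ := mem_range_of_exists_le_of_exists_ge (Hs_cont he hw) ⟨_, hn.le⟩ ⟨_, hm.le⟩
  exact ⟨d, by simp only at hd; rw [hd]; ring⟩

lemma Hs_mono (e : VV) {w : VV → ℝ} (hw : Integrable w) (hn : ∀ x, 0 ≤ w x) {d d' : ℝ} (h : d ≤ d') :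
    ∫ x in Hs e d', w x ≤ ∫ x in Hs e d, w x := by
  apply setIntegral_mono_set hw.integrableOn (Eventually.of_forall fun x => hn x)
  exact HasSubset.Subset.eventuallyLE fun x hx => lt_of_le_of_lt h hx

noncomputable def ei (i : Fin 4) : VV := EuclideanSpace.single i 1

lemma ei_norm (i : Fin 4) : ‖ei i‖ = 1 := by simp [ei]

lemma ei_inner (i : Fin 4) (x : VV) : inner ℝ (ei i) x = x i := by
  simp [ei, EuclideanSpace.inner_single_left]

/-- centred maximizer -/
def IsCx (lam : ℝ) (w : VV → ℝ) : Prop :=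
  IsMx lam w ∧ ∀ e : VV, ‖e‖ = 1 → ∀ᵐ x, w (sg e 0 x) = w x

lemma IsMx.translate {lam : ℝ} {w : VV → ℝ} (hw : IsMx lam w) (p : VV) : IsMx lam fun x => w (x + p) := by
  refine ⟨hw.1.translate p, ?_⟩
  rw [Df_translate, hw.2, integral_add_right_eq_self]

lemma neg_mp : MeasurePreserving (fun x : VV => -x) := Measure.measurePreserving_neg _

theorem exists_center {lam : ℝ} (hl : 1 < lam) {w : VV → ℝ} (hw : IsMx lam w) (hpos : 0 < ∫ x, w x) :
    ∃ p : VV, IsCx lam fun x => w (x + p) := by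
  choose d hd using fun i : Fin 4 => exists_bisect (ei_norm i) hw.1.l1 hpos
  set p : VV := WithLp.toLp 2 d with hp
  have hpi : ∀ i, p i = d i := fun i => rfl
  refine ⟨p, hw.translate p, ?_⟩
  set w' : VV → ℝ := fun x => w (x + p)
  have hw' : IsMx lam w' := hw.translate p
  have hs : ∀ i, ∀ᵐ x, w' (sg (ei i) 0 x) = w' x := by
    intro i
    have h1 := sym_of_bisect hl hw (ei_norm i) (d i) (hd i)
    have h2 := (trE_mp p).quasiMeasurePreserving.ae h1
    filter_upwards [h2] with x hx
    simp only [trE_apply] at hx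
    simp only [w']
    rw [← hx, sg_apply (ei_norm i), sg_apply (ei_norm i), inner_add_right, ei_inner, ei_inner, hpi]
    congr 1; module
  have hneg : ∀ᵐ x, w' (-x) = w' x := by
    have k : ∀ (i : Fin 4) (T : VV → VV), MeasurePreserving T → (∀ᵐ x, w' (T x) = w' x) →
        MeasurePreserving (fun x => sg (ei i) 0 (T x)) ∧ (∀ᵐ x, w' (sg (ei i) 0 (T x)) = w' x) := by
      intro i T hT h
      refine ⟨(sg_mp _ _).comp hT, ?_⟩
      filter_upwards [h, hT.quasiMeasurePreserving.ae (hs i)] with x hx hx2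
      rw [hx2, hx]
    obtain ⟨a0, b0⟩ := k 0 id (MeasurePreserving.id _) (Eventually.of_forall fun x => rfl)
    obtain ⟨a1, b1⟩ := k 1 _ a0 b0
    obtain ⟨a2, b2⟩ := k 2 _ a1 b1
    obtain ⟨a3, b3⟩ := k 3 _ a2 b2
    filter_upwards [b3] with x hx
    rw [← hx]
    congr 1
    simp only [sg_apply (ei_norm _), ei_inner]
    ext j
    fin_cases j <;> simp [ei] <;> ring
  intro e he
  apply sym_of_bisect hl hw' he 0
  have h1 := integral_add_compl (Hs_meas e 0) hw'.1.l1
  have h2 : ∫ x in (Hs e 0)ᶜ, w' x = ∫ x in Hs e 0, w' x := by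
    rw [← integral_indicator (Hs_meas e 0), ← integral_indicator (Hs_meas e 0).compl,
      ← neg_mp.integral_comp (MeasurableEquiv.neg VV).measurableEmbedding ((Hs e 0).indicator w')]
    apply integral_congr_ae
    filter_upwards [hneg, hyper_null he 0] with x hx hx0
    simp only [indicator]
    have : x ∈ (Hs e 0)ᶜ ↔ -x ∈ Hs e 0 := by
      simp only [Hs, mem_compl_iff, mem_ofPred_eq, inner_neg_right, not_lt]
      constructor
      · intro h; have := lt_of_le_of_ne h hx0; linarith
      · intro h; linarith
    by_cases h : x ∈ (Hs e 0)ᶜ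
    · rw [if_pos h, if_pos (this.1 h), hx]
    · rw [if_neg h, if_neg (fun h' => h (this.2 h'))]
  linarith

lemma IsCx.half {lam : ℝ} {w : VV → ℝ} (hw : IsCx lam w) {e : VV} (he : ‖e‖ = 1) :
    ∫ x, w x = 2 * ∫ x in Hs e 0, w x := by
  have h1 := int_Hs_sg he 0 hw.1.1.l1
  have h2 : ∫ x in Hs e 0, w (sg e 0 x) = ∫ x in Hs e 0, w x :=
    integral_congr_ae (ae_restrict_of_ae (hw.2 e he))
  linarith

lemma IsCx.mono {lam : ℝ} (hl : 1 < lam) {w : VV → ℝ} (hw : IsCx lam w) {e : VV} (he : ‖e‖ = 1) {d : ℝ}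
    (hd : 0 ≤ d) : ∀ᵐ x, inner ℝ e x < d → w (sg e d x) ≤ w x := by
  have h1 := hw.half he
  have h2 := Hs_mono e hw.1.1.l1 hw.1.1.nn hd
  have h3 := int_Hs_sg he d hw.1.1.l1
  have he' : ‖-e‖ = 1 := by rw [norm_neg, he]
  have h4 : ∫ x in Hs (-e) (-d), w x = (∫ x, w x) - ∫ x in Hs e d, w x := by
    have := integral_add_compl (Hs_meas e d) hw.1.1.l1
    rw [← this, add_sub_cancel_left, ]
    apply setIntegral_congr_set
    filter_upwards [hyper_null he d] with x hx
    apply propext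
    change -d < inner ℝ (-e) x ↔ ¬ (d < inner ℝ e x)
    rw [inner_neg_left, not_lt, neg_lt_neg_iff]
    exact ⟨le_of_lt, fun h => lt_of_le_of_ne h hx⟩
  have h5 := pol_mass hl hw.1 he' (-d) (by rw [h4]; linarith)
  filter_upwards [h5] with x hx hxd
  rw [← sg_neg he]
  apply hx
  change -d < inner ℝ (-e) x
  rw [inner_neg_left]; linarith

end LambPart6

section LambPart7
open Set Topology

lemma EL_var {lam : ℝ} (hl : 1 < lam) {w : VV → ℝ} (hw : IsMx lam w) {f : VV → ℝ} (hf : Adm f) :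
    Bf gv f w - lam⁻¹ * ∫ x, f x * w x ≤ (Cst lam * ∫ x, w x) * ∫ x, f x := by
  set b := Bf gv f w
  set m := ∫ x, f x * w x
  set μ := ∫ x, w x
  have key : ∀ t : ℝ, 0 < t → 2 * (b - lam⁻¹ * m - Cst lam * μ * ∫ x, f x) ≤
      t * (Cst lam * (∫ x, f x) ^ 2 - Df lam f) := by
    intro t ht
    have htf := hf.smul ht.le
    have hA : Adm (fun x => w x + t * f x) :=
      ⟨hw.1.l2.add htf.l2, hw.1.l1.add htf.l1, fun x => add_nonneg (hw.1.nn x) (htf.nn x)⟩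
    have h1 := Df_le hl hA
    have h2 : ∫ x, (w x + t * f x) = μ + t * ∫ x, f x := by
      rw [integral_add hw.1.l1 htf.l1, integral_const_mul]
    have h3 : Bf gv (fun x => w x + t * f x) (fun x => w x + t * f x) =
        Bf gv w w + 2 * t * b + t ^ 2 * Bf gv f f := by
      rw [Bf_add_left gv_integrable hw.1.l2 htf.l2 hA.l2, Bf_add_right gv_integrable hw.1.l2 htf.l2 hw.1.l2,
        Bf_add_right gv_integrable hw.1.l2 htf.l2 htf.l2, Bf_smul_left, Bf_smul_left, Bf_smul_right, Bf_smul_right,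
        Bf_symm gv_neg w f]; ring
    have h4 : N2 (fun x => w x + t * f x) = N2 w + 2 * t * m + t ^ 2 * N2 f := by
      unfold N2
      have i1 := L2sq hw.1.l2
      have i2 := (L2mul hf.l2 hw.1.l2).const_mul (2 * t)
      have i3 := (L2sq hf.l2).const_mul (t ^ 2)
      have i12 : Integrable (fun x => w x ^ 2 + 2 * t * (f x * w x)) := i1.add i2
      rw [show (fun x => (w x + t * f x) ^ 2) = fun x => (w x ^ 2 + 2 * t * (f x * w x)) + t ^ 2 * f x ^ 2 by
        ext x; ring, integral_add i12 i3, integral_add i1 i2, integral_const_mul, integral_const_mul]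
    have h5 : Bf gv w w - lam⁻¹ * N2 w = Cst lam * μ ^ 2 := hw.2
    unfold Df at h1 ⊢
    rw [h2, h3, h4] at h1
    have : t * (2 * (b - lam⁻¹ * m - Cst lam * μ * ∫ x, f x)) ≤
      t * (t * (Cst lam * (∫ x, f x) ^ 2 - (Bf gv f f - lam⁻¹ * N2 f))) := by
      nlinarith
    exact le_of_mul_le_mul_left this ht
  have h0 : 2 * (b - lam⁻¹ * m - Cst lam * μ * ∫ x, f x) ≤ 0 := by
    have : Tendsto (fun t : ℝ => t * (Cst lam * (∫ x, f x) ^ 2 - Df lam f)) (𝓝[>] 0) (𝓝 0) := by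
      have : Tendsto (fun t : ℝ => t * (Cst lam * (∫ x, f x) ^ 2 - Df lam f)) (𝓝 0)
        (𝓝 (0 * (Cst lam * (∫ x, f x) ^ 2 - Df lam f))) := by
        apply Tendsto.mul_const; exact tendsto_id
      rw [zero_mul] at this
      exact this.mono_left nhdsWithin_le_nhds
    exact ge_of_tendsto this (eventually_mem_nhdsWithin.mono fun t ht => key t ht)
  linarith

theorem EL {lam : ℝ} (hl : 1 < lam) {w : VV → ℝ} (hw : IsMx lam w) :
    ∀ᵐ x, w x = lam * max (cv gv w x - Cst lam * ∫ x, w x) 0 := by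
  set W := Cst lam * ∫ x, w x
  have hl0 : 0 < lam := by linarith
  have h1 : ∀ᵐ x, 0 ≤ W + lam⁻¹ * w x - cv gv w x := by
    have hIntg : ∀ s : Set VV, MeasurableSet s → volume s < ⊤ →
        Adm (s.indicator fun _ => (1:ℝ)) ∧ IntegrableOn (cv gv w) s ∧ Bf gv (s.indicator fun _ => (1:ℝ)) w = ∫ x in s, cv gv w x := by
      intro s hs hfin
      have a : Adm (s.indicator fun _ => (1:ℝ)) :=
        ⟨memLp_indicator_const _ hs _ (Or.inr hfin.ne), (integrable_indicator_iff hs).2 (integrableOn_const hfin.ne),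
          fun x => indicator_nonneg (fun _ _ => zero_le_one) x⟩
      have e : (fun x => s.indicator (fun _ => (1:ℝ)) x * cv gv w x) = s.indicator (cv gv w) := by
        ext x; by_cases hx : x ∈ s <;> simp [hx]
      have b := Bf_eq_cv_integrable gv_integrable a.l2 hw.1.l2
      rw [e, integrable_indicator_iff hs] at b
      refine ⟨a, b, ?_⟩
      rw [Bf_eq_cv gv_integrable a.l2 hw.1.l2, e, integral_indicator hs]
    have hI : ∀ s : Set VV, MeasurableSet s → volume s < ⊤ → IntegrableOn (fun x => W + lam⁻¹ * w x) s := by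
      intro s hs hfin
      exact (integrableOn_const hfin.ne).add (hw.1.l1.const_mul _).integrableOn
    apply ae_nonneg_of_forall_setIntegral_nonneg_of_sigmaFinite
    · intro s hs hfin
      exact (hI s hs hfin).sub (hIntg s hs hfin).2.1
    · intro s hs hfin
      obtain ⟨a, b, c⟩ := hIntg s hs hfin
      have := EL_var hl hw a
      rw [c, integral_indicator hs] at this
      have e : (fun x => s.indicator (fun _ => (1:ℝ)) x * w x) = s.indicator w := by
        ext x; by_cases hx : x ∈ s <;> simp [hx]
      rw [e, integral_indicator hs] at this
      have ic : IntegrableOn (fun _ : VV => W) s := integrableOn_const hfin.ne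
      have iw : IntegrableOn (fun x : VV => lam⁻¹ * w x) s := (hw.1.l1.const_mul _).integrableOn
      rw [integral_sub (hI s hs hfin) b, integral_add ic iw]
      have e2 : ∫ x in s, W = W * ∫ x in s, (1:ℝ) := by rw [← integral_const_mul, mul_one]
      have e3 : ∫ x in s, lam⁻¹ * w x = lam⁻¹ * ∫ x in s, w x := integral_const_mul _ _
      rw [e2, e3]
      linarith
  have h2 : ∀ᵐ x, w x * (W + lam⁻¹ * w x - cv gv w x) = 0 := by
    have i1 := hw.1.l1.const_mul W
    have i2 := (L2sq hw.1.l2).const_mul lam⁻¹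
    have i3 := Bf_eq_cv_integrable gv_integrable hw.1.l2 hw.1.l2
    have i12 : Integrable (fun x => W * w x + lam⁻¹ * w x ^ 2) := i1.add i2
    have e : (fun x => w x * (W + lam⁻¹ * w x - cv gv w x)) =
        fun x => (W * w x + lam⁻¹ * w x ^ 2) - w x * cv gv w x := by ext x; ring
    have i4 : Integrable (fun x => w x * (W + lam⁻¹ * w x - cv gv w x)) := by rw [e]; exact i12.sub i3
    have hz : ∫ x, w x * (W + lam⁻¹ * w x - cv gv w x) = 0 := by
      rw [e, integral_sub i12 i3, integral_add i1 i2, integral_const_mul, integral_const_mul,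
        ← Bf_eq_cv gv_integrable hw.1.l2 hw.1.l2]
      have := hw.2
      unfold Df N2 at this
      simp only [W]; linarith
    have := (integral_eq_zero_iff_of_nonneg_ae (h1.mono fun x hx => mul_nonneg (hw.1.nn x) hx) i4).1 hz
    exact this
  filter_upwards [h1, h2] with x hx1 hx2
  rcases mul_eq_zero.1 hx2 with h | h
  · rw [h] at hx1 ⊢
    rw [max_eq_right (by linarith), mul_zero]
  · have : lam⁻¹ * w x = cv gv w x - W := by linarith
    have h3 : 0 ≤ lam⁻¹ * w x := mul_nonneg (by positivity) (hw.1.nn x)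
    rw [max_eq_left (by linarith), ← this]; field_simp

lemma cv_nonneg {k w : VV → ℝ} (hk : ∀ x, 0 ≤ k x) (hw : ∀ x, 0 ≤ w x) (x : VV) : 0 ≤ cv k w x :=
  integral_nonneg fun _ => mul_nonneg (hk _) (hw _)

theorem bdd_Mx {lam : ℝ} (hl : 1 < lam) {w : VV → ℝ} (hw : IsMx lam w) :
    ∃ c, 0 ≤ c ∧ ∀ᵐ x, w x ≤ c := by
  have hl0 : 0 < lam := by linarith
  obtain ⟨M, hM, hr⟩ := rM_small (ε := (2 * lam)⁻¹) (by positivity)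
  set r : VV → ℝ := fun x => gv x - kM M x with hrdef
  have hri : Integrable r := rM_integrable hM.le
  have hrn : ∀ x, 0 ≤ r x := rM_nonneg M
  have hrI : ∫ x, r x ≤ (2 * lam)⁻¹ := by
    refine le_trans (le_of_eq ?_) hr
    congr 1; ext x; rw [abs_of_nonneg (rM_nonneg M x)]
  have hμ : 0 ≤ ∫ x, w x := integral_nonneg hw.1.nn
  set c := lam * (2⁻¹ * (N2 (kM M) + N2 w)) with hc
  have hc0 : 0 ≤ c := by
    have : 0 ≤ N2 (kM M) := integral_nonneg fun x => sq_nonneg _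
    have : 0 ≤ N2 w := integral_nonneg fun x => sq_nonneg _
    positivity
  refine ⟨2 * c, by positivity, ?_⟩
  set z : VV → ℝ := fun x => max (w x - 2 * c) 0 with hz
  have hz0 : ∀ x, 0 ≤ z x := fun x => le_max_right _ _
  have hzw : ∀ x, z x ≤ w x := fun x => max_le (by linarith) (hw.1.nn x)
  have hzm : AEStronglyMeasurable z := by
    have := hw.1.l2.aestronglyMeasurable
    exact (this.aemeasurable.sub_const _ |>.max aemeasurable_const).aestronglyMeasurable
  have hz2 : MemLp z 2 := hw.1.l2.of_le hzm (Eventually.of_forall fun x => by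
    rw [Real.norm_of_nonneg (hz0 x), Real.norm_of_nonneg (hw.1.nn x)]; exact hzw x)
  have hz1 : Integrable z := hw.1.l1.mono hzm (Eventually.of_forall fun x => by
    rw [Real.norm_of_nonneg (hz0 x), Real.norm_of_nonneg (hw.1.nn x)]; exact hzw x)
  have a1 := (sh_int2 hri hw.1.l1).prod_right_ae
  have a2 := (sh_int2 hri hz1).prod_right_ae
  have a3 := (sh_int2 (kM_integrable hM.le) hw.1.l1).prod_right_ae
  have hCp := Cst_pos hl
  have key : ∀ᵐ x, z x ^ 2 ≤ lam * (z x * cv r z x) := by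
    filter_upwards [EL hl hw, a1, a2, a3] with x hx b1 b2 b3
    by_cases hzx : z x = 0
    · rw [hzx]; simp
    have hzp : 0 < z x := lt_of_le_of_ne (hz0 x) (Ne.symm hzx)
    have hzx' : z x = w x - 2 * c := by
      simp only [z] at hzp ⊢
      rcases lt_max_iff.1 hzp with h | h
      · exact max_eq_left h.le
      · exact absurd h (lt_irrefl _)
    have e1 : cv gv w x = cv r w x + cv (kM M) w x := by
      unfold cv
      rw [← integral_add b1 b3]; congr 1; ext y; simp only [r]; ring
    have e2 : w x ≤ lam * cv gv w x := by
      rw [hx]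
      apply mul_le_mul_of_nonneg_left _ hl0.le
      apply max_le
      · have := mul_nonneg hCp.le hμ; linarith
      · exact cv_nonneg gv_nonneg hw.1.nn x
    have e3 : lam * cv (kM M) w x ≤ c := by
      have := cv_bound (kM_memLp hM.le) hw.1.l2 x
      have := (le_abs_self _).trans this
      rw [hc]; exact mul_le_mul_of_nonneg_left this hl0.le
    have e4 : cv r w x ≤ cv r z x + 2 * c * ∫ y, r y := by
      have i3 : Integrable (fun y => r (x - y)) := hri.comp_sub_left x
      have i4 : ∫ y, r (x - y) = ∫ y, r y := integral_sub_left_eq_self r volume x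
      rw [← i4]
      unfold cv
      rw [← integral_const_mul, ← integral_add b2 (i3.const_mul _)]
      apply integral_mono b1 (b2.add (i3.const_mul _))
      intro y
      simp only [Pi.add_apply]
      have h1 : w y ≤ z y + 2 * c := by
        have := le_max_left (w y - 2 * c) 0
        simp only [z]; linarith
      have := mul_le_mul_of_nonneg_left h1 (hrn (x - y))
      linarith
    have e5 : lam * (2 * c * ∫ y, r y) ≤ c := by
      have := mul_le_mul_of_nonneg_left hrI (show 0 ≤ lam * (2 * c) by positivity)
      calc _ = lam * (2 * c) * ∫ y, r y := by ring
        _ ≤ _ := this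
        _ = c := by field_simp
    have e6 : z x ≤ lam * cv r z x := by
      have := mul_le_mul_of_nonneg_left e4 hl0.le
      rw [e1] at e2; rw [hzx']; linarith
    nlinarith
  have hN : N2 z ≤ lam * Bf r z z := by
    rw [Bf_eq_cv hri hz2 hz2, ← integral_const_mul]
    exact integral_mono_ae (L2sq hz2) ((Bf_eq_cv_integrable hri hz2 hz2).const_mul _) key
  have hB := (le_abs_self _).trans (Bf_bound_self hri hz2)
  have hN0 : 0 ≤ N2 z := integral_nonneg fun x => sq_nonneg _
  have hN1 : N2 z ≤ 2⁻¹ * N2 z := by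
    calc N2 z ≤ lam * Bf r z z := hN
      _ ≤ lam * ((2 * lam)⁻¹ * N2 z) := mul_le_mul_of_nonneg_left (hB.trans (mul_le_mul_of_nonneg_right hr hN0)) hl0.le
      _ = 2⁻¹ * N2 z := by field_simp
  have hN2 : N2 z = 0 := by linarith
  have := (integral_eq_zero_iff_of_nonneg (fun x => sq_nonneg _) (L2sq hz2)).1 hN2
  filter_upwards [this] with x hx
  have h0 : z x = 0 := by simpa using hx
  have := le_max_left (w x - 2 * c) 0
  simp only [z] at h0; linarith

lemma cv_int {w : VV → ℝ} (hw : AEStronglyMeasurable w) (hn : ∀ x, 0 ≤ w x) {c : ℝ} (hc : ∀ᵐ x, w x ≤ c) (x : VV) :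
    Integrable fun y => gv (x - y) * w y := by
  have i1 : Integrable (fun y => gv (x - y)) := gv_integrable.comp_sub_left x
  refine (i1.mul_const c).mono (i1.aestronglyMeasurable.mul hw) ?_
  filter_upwards [hc] with y hy
  have h1 := gv_nonneg (x - y)
  rw [norm_mul, Real.norm_of_nonneg h1, Real.norm_of_nonneg (hn y), Real.norm_of_nonneg]
  · exact mul_le_mul_of_nonneg_left hy h1
  · exact mul_nonneg h1 ((hn y).trans hy)

lemma cv_sym {e : VV} (he : ‖e‖ = 1) {w : VV → ℝ} (hs : ∀ᵐ x, w (sg e 0 x) = w x) (x : VV) :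
    cv gv w (sg e 0 x) = cv gv w x := by
  unfold cv
  rw [← int_sg (fun y => gv (sg e 0 x - y) * w y) e 0]
  apply integral_congr_ae
  filter_upwards [hs] with y hy
  simp only [hy, gv_sg]

lemma cv_radial {lam : ℝ} {w : VV → ℝ} (hw : IsCx lam w) {x y : VV} (h : ‖x‖ = ‖y‖) :
    cv gv w x = cv gv w y := by
  by_cases hxy : x = y
  · rw [hxy]
  have h1 : x - y ≠ 0 := sub_ne_zero.2 hxy
  set e : VV := ‖x - y‖⁻¹ • (x - y)
  have he : ‖e‖ = 1 := by simp [e, norm_smul, h1]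
  have : sg e 0 x = y := by
    rw [sg_apply he]
    simp only [e, inner_smul_left, sub_zero, inner_sub_left, real_inner_self_eq_norm_sq, smul_smul]
    have h2 : ‖x - y‖ ^ 2 = 2 * (‖x‖ ^ 2 - inner ℝ y x) := by
      rw [norm_sub_sq_real, h, real_inner_comm]; ring
    have h3 : 2 * ((starRingEnd ℝ) ‖x - y‖⁻¹ * (‖x‖ ^ 2 - inner ℝ y x)) * ‖x - y‖⁻¹ = 1 := by
      have : ‖x - y‖ ≠ 0 := norm_ne_zero_iff.2 h1
      simp only [conj_trivial]
      field_simp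
      linarith
    rw [h3]; simp
  rw [← this, cv_sym he (hw.2 e he)]

lemma cv_antitone {lam : ℝ} (hl : 1 < lam) {w : VV → ℝ} (hw : IsCx lam w) {r s : ℝ} (hr : 0 ≤ r) (hrs : r < s) :
    cv gv w (s • ei 0) ≤ cv gv w (r • ei 0) := by
  obtain ⟨c, hc0, hc⟩ := bdd_Mx hl hw.1
  set e := ei 0
  have he : ‖e‖ = 1 := ei_norm 0
  have hIntg := cv_int hw.1.1.l1.aestronglyMeasurable hw.1.1.nn hc
  set d := (r + s) / 2
  set x : VV := r • e
  have hee : inner ℝ e e = (1:ℝ) := by rw [real_inner_self_eq_norm_sq, he]; norm_num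
  have hx : sg e d x = s • e := by
    rw [sg_apply he]; simp only [x, inner_smul_right, hee, d]; module
  rw [← hx]
  have hex : inner ℝ e x = r := by simp only [x, inner_smul_right, hee, mul_one]
  set D : VV → ℝ := fun y => gv (x - y) - gv (sg e d x - y) with hD
  have hDs : ∀ y, D (sg e d y) = - D y := by
    intro y; simp only [D, gv_sg]; rw [← gv_sg' he]; ring
  have hDw : Integrable (fun y => D y * w y) := by
    have := (hIntg x).sub (hIntg (sg e d x))
    refine this.congr (Eventually.of_forall fun y => ?_)
    simp only [Pi.sub_apply, D]; ring
  have e1 : cv gv w x - cv gv w (sg e d x) = ∫ y, D y * w y := by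
    unfold cv
    rw [← integral_sub (hIntg _) (hIntg _)]
    congr 1; ext y; simp only [D]; ring
  have e2 : ∫ y, D y * w y = ∫ y, - (D y * w (sg e d y)) := by
    rw [← int_sg (fun y => D y * w y) e d]; congr 1; ext y; rw [hDs]; ring
  have i2 : Integrable (fun y => - (D y * w (sg e d y))) := by
    have := (sg_mp e d).integrable_comp_of_integrable hDw
    refine this.congr (Eventually.of_forall fun y => ?_)
    simp only [Function.comp, hDs]; ring
  have hDpos : ∀ y, x ≠ y → inner ℝ e y < d → 0 ≤ D y := by
    intro y hxy hy
    have h2 := norm_sub_sg he d x y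
    have hd : r < d := by simp only [d]; linarith
    rw [hex] at h2
    have h3 : 0 < (r - d) * (inner ℝ e y - d) := mul_pos_of_neg_of_neg (by linarith) (by linarith)
    simp only [D]
    rw [gv_sg' he]
    have h1 : 0 < ‖x - y‖ := norm_pos_iff.2 (sub_ne_zero.2 hxy)
    unfold gv
    apply sub_nonneg.2
    apply gq_strictAnti.antitoneOn
    · simp only [mem_Ioi]; positivity
    · simp only [mem_Ioi]; rw [h2]; positivity
    · rw [h2]; linarith
  have hm := hw.mono hl he (d := d) (by simp only [d]; linarith)
  have hne : ∀ᵐ y : VV, x ≠ y := by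
    have : volume ({x} : Set VV) = 0 := by simp
    filter_upwards [compl_mem_ae_iff.2 this] with y hy h
    exact hy h.symm
  have hpos : 0 ≤ᵐ[volume] fun y => D y * w y + -(D y * w (sg e d y)) := by
    filter_upwards [hm, (sg_mp e d).quasiMeasurePreserving.ae hm, hne, (sg_mp e d).quasiMeasurePreserving.ae hne,
      hyper_null he d] with y h1 h2 h3 h4 h5
    simp only [Pi.zero_apply]
    rcases lt_or_gt_of_ne h5 with h5 | h5
    · nlinarith [hDpos y h3 h5, h1 h5]
    · have h6 : inner ℝ e (sg e d y) < d := by rw [inner_sg he]; linarith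
      have h7 := h2 h6
      rw [sg_sg he] at h7
      have h8 := hDpos _ h4 h6
      rw [hDs] at h8
      nlinarith
  have := integral_nonneg_of_ae hpos
  rw [integral_add hDw i2, ← e2] at this
  linarith

/-- radial profile of a centred maximizer -/
theorem profile {lam : ℝ} (hl : 1 < lam) {w : VV → ℝ} (hw : IsCx lam w) :
    ∃ U : ℝ → ℝ, AntitoneOn U (Ici 0) ∧ (∀ q, 0 ≤ U q) ∧ (∃ c, ∀ q, U q ≤ c) ∧ (∀ x, cv gv w x = U (‖x‖ ^ 2)) ∧
      (∀ᵐ x, w x = lam * max (U (‖x‖ ^ 2) - Cst lam * ∫ x, w x) 0) := by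
  have hU : ∀ x, cv gv w x = cv gv w (√(‖x‖ ^ 2) • ei 0) := by
    intro x
    apply cv_radial hw
    rw [norm_smul, ei_norm, mul_one, Real.sqrt_sq (norm_nonneg _), norm_norm]
  obtain ⟨c, hc0, hc⟩ := bdd_Mx hl hw.1
  refine ⟨fun q => cv gv w (√q • ei 0), ?_, ?_, ⟨c, ?_⟩, hU, ?_⟩
  · intro q hq q' hq' h
    rcases eq_or_lt_of_le h with h | h
    · rw [h]
    · exact cv_antitone hl hw (Real.sqrt_nonneg _) (Real.sqrt_lt_sqrt hq h)
  · intro q; exact cv_nonneg gv_nonneg hw.1.1.nn _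
  · intro q
    set x := √q • ei 0
    have i1 : Integrable (fun y => gv (x - y)) := gv_integrable.comp_sub_left x
    calc cv gv w x ≤ ∫ y, gv (x - y) * c := by
          apply integral_mono_ae (cv_int hw.1.1.l1.aestronglyMeasurable hw.1.1.nn hc x) (i1.mul_const c)
          filter_upwards [hc] with y hy
          exact mul_le_mul_of_nonneg_left hy (gv_nonneg _)
      _ = c := by
          rw [integral_mul_const, integral_sub_left_eq_self gv volume x, gv_integral, one_mul]
  · filter_upwards [EL hl hw.1] with x hx
    rw [← hU x]; exact hx

end LambPart7

section LambPart8
open Set Topology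
open scoped FourierTransform SchwartzMap Laplacian ContDiff LineDeriv

lemma F_lap (f : 𝓢(VV, ℂ)) (ξ : VV) :
    𝓕 (Δ f) ξ = -(((2 * π) ^ 2 * ‖ξ‖ ^ 2 : ℝ) : ℂ) * 𝓕 f ξ := by
  have hT : (fun x : VV => ‖x‖ ^ 2).HasTemperateGrowth := by fun_prop
  rw [SchwartzMap.laplacian_eq_fourierMultiplierCLM, SchwartzMap.fourierMultiplierCLM_apply,
    FourierTransform.fourier_smul, FourierTransform.fourier_fourierInv_eq]
  have hT' : Function.HasTemperateGrowth ((‖·‖ ^ 2) : VV → ℝ) := hT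
  simp only [smul_apply]
  rw [SchwartzMap.smulLeftCLM_apply_apply hT']
  simp only [Complex.real_smul]
  push_cast; ring

lemma ghat_t {t : ℝ} (ht : 0 < t) (ξ : VV) :
    ∫ z : VV, Complex.exp (((2 * π * inner ℝ z ξ : ℝ) : ℂ) * Complex.I) * ((hk t (‖z‖ ^ 2) : ℝ) : ℂ) =
      ((Real.exp (-((2 * π) ^ 2 * ‖ξ‖ ^ 2 * t)) : ℝ) : ℂ) := by
  have hb : 0 < (((1 / (4 * t) : ℝ)) : ℂ).re := by rw [Complex.ofReal_re]; positivity
  have h := fourier_gaussian_innerProductSpace (V := VV) hb (-ξ)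
  rw [Real.fourier_eq'] at h
  have e1 : ∀ z : VV, Complex.exp (((2 * π * inner ℝ z ξ : ℝ) : ℂ) * Complex.I) * ((hk t (‖z‖ ^ 2) : ℝ) : ℂ) =
      ((((4 * π * t) ^ 2)⁻¹ : ℝ) : ℂ) * (Complex.exp (((-2 * π * inner ℝ z (-ξ) : ℝ) : ℂ) * Complex.I) •
        Complex.exp (-((1 / (4 * t) : ℝ) : ℂ) * ((‖z‖ : ℝ) : ℂ) ^ 2)) := by
    intro z
    unfold hk
    rw [inner_neg_right, smul_eq_mul]
    have : -(‖z‖ ^ 2 / (4 * t)) = -(1 / (4 * t)) * ‖z‖ ^ 2 := by ring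
    rw [this]
    push_cast
    ring_nf
  simp_rw [e1]
  rw [integral_const_mul, h]
  simp only [finrank_euclideanSpace, Fintype.card_fin]
  have e2 : ((4 : ℕ) : ℂ) / 2 = ((2 : ℕ) : ℂ) := by norm_num
  rw [e2, Complex.cpow_natCast, norm_neg]
  have e3 : Complex.exp (-(π:ℂ) ^ 2 * (‖ξ‖ : ℂ) ^ 2 / ((1 / (4 * t) : ℝ) : ℂ)) =
      ((Real.exp (-((2 * π) ^ 2 * ‖ξ‖ ^ 2 * t)) : ℝ) : ℂ) := by
    push_cast
    congr 1
    have : (t:ℂ) ≠ 0 := by exact_mod_cast ht.ne'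
    field_simp
    ring
  rw [e3, ← mul_assoc]
  have e4 : ((((4 * π * t) ^ 2)⁻¹ : ℝ) : ℂ) * ((π:ℂ) / ((1 / (4 * t) : ℝ) : ℂ)) ^ 2 = 1 := by
    have : (t:ℂ) ≠ 0 := by exact_mod_cast ht.ne'
    have : (π:ℂ) ≠ 0 := by exact_mod_cast Real.pi_ne_zero
    push_cast
    field_simp
  rw [e4, one_mul]

lemma ghat (ξ : VV) :
    ∫ z : VV, Complex.exp (((2 * π * inner ℝ z ξ : ℝ) : ℂ) * Complex.I) * ((gv z : ℝ) : ℂ) =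
      (((1 + (2 * π) ^ 2 * ‖ξ‖ ^ 2)⁻¹ : ℝ) : ℂ) := by
  have e1 : ∀ z : VV, Complex.exp (((2 * π * inner ℝ z ξ : ℝ) : ℂ) * Complex.I) * ((gv z : ℝ) : ℂ) =
      ∫ t in Ioi (0:ℝ), Complex.exp (((2 * π * inner ℝ z ξ : ℝ) : ℂ) * Complex.I) *
        ((Real.exp (-t) * hk t (‖z‖ ^ 2) : ℝ) : ℂ) := by
    intro z
    rw [integral_const_mul, integral_complex_ofReal]; rfl
  simp_rw [e1]
  rw [integral_integral_swap]
  · have e2 : ∀ t ∈ Ioi (0:ℝ), ∫ z : VV, Complex.exp (((2 * π * inner ℝ z ξ : ℝ) : ℂ) * Complex.I) *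
        ((Real.exp (-t) * hk t (‖z‖ ^ 2) : ℝ) : ℂ) =
        ((Real.exp (-(1 + (2 * π) ^ 2 * ‖ξ‖ ^ 2) * t) : ℝ) : ℂ) := by
      intro t ht
      have : ∀ z : VV, Complex.exp (((2 * π * inner ℝ z ξ : ℝ) : ℂ) * Complex.I) *
        ((Real.exp (-t) * hk t (‖z‖ ^ 2) : ℝ) : ℂ) = ((Real.exp (-t) : ℝ) : ℂ) * (Complex.exp (((2 * π * inner ℝ z ξ : ℝ) : ℂ) * Complex.I) *
        ((hk t (‖z‖ ^ 2) : ℝ) : ℂ)) := by intro z; push_cast; ring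
      simp_rw [this]
      rw [integral_const_mul, ghat_t ht, ← Complex.ofReal_mul, ← Real.exp_add]
      congr 2; ring
    rw [setIntegral_congr_fun measurableSet_Ioi e2, integral_complex_ofReal]
    congr 1
    have hp : 0 < 1 + (2 * π) ^ 2 * ‖ξ‖ ^ 2 := by positivity
    have := integral_exp_mul_Ioi (a := -(1 + (2 * π) ^ 2 * ‖ξ‖ ^ 2)) (by linarith) 0
    rw [this, mul_zero, Real.exp_zero, neg_div_neg_eq, one_div]
  · have h := integrable_gprod.ofReal (𝕜 := ℂ)
    refine h.bdd_mul (c := 1) (f := fun p : VV × ℝ => Complex.exp (((2 * π * inner ℝ p.1 ξ : ℝ) : ℂ) * Complex.I)) ?_ ?_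
    · exact (by fun_prop : Continuous fun p : VV × ℝ => Complex.exp (((2 * π * inner ℝ p.1 ξ : ℝ) : ℂ) * Complex.I)).aestronglyMeasurable
    · exact Eventually.of_forall fun p => (Complex.norm_exp_ofReal_mul_I _).le

lemma schwartz_inv (f : 𝓢(VV, ℂ)) (x : VV) :
    f x = ∫ ξ : VV, Complex.exp (((2 * π * inner ℝ ξ x : ℝ) : ℂ) * Complex.I) * 𝓕 f ξ := by
  have : 𝓕⁻ (𝓕 f) x = f x := by rw [FourierTransform.fourierInv_fourier_eq]
  rw [← this, SchwartzMap.fourierInv_coe, Real.fourierInv_eq']; rfl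

theorem gv_resolvent (f : 𝓢(VV, ℂ)) (y : VV) :
    ∫ z : VV, ((gv z : ℝ) : ℂ) * (f (y + z) - (Δ f) (y + z)) = f y := by
  set h : 𝓢(VV, ℂ) := f - Δ f with hh
  have hF : ∀ ξ, 𝓕 h ξ = ((1 + (2 * π) ^ 2 * ‖ξ‖ ^ 2 : ℝ) : ℂ) * 𝓕 f ξ := by
    intro ξ
    have : 𝓕 h = 𝓕 f - 𝓕 (Δ f) := by rw [hh, sub_eq_add_neg, sub_eq_add_neg, FourierTransform.fourier_add, ← neg_one_smul ℂ (Δ f), FourierTransform.fourier_smul, neg_one_smul]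
    rw [this, sub_apply, F_lap]
    push_cast; ring
  have e1 : ∀ z : VV, ((gv z : ℝ) : ℂ) * (f (y + z) - (Δ f) (y + z)) =
      ∫ ξ : VV, ((gv z : ℝ) : ℂ) * (Complex.exp (((2 * π * inner ℝ ξ (y + z) : ℝ) : ℂ) * Complex.I) * 𝓕 h ξ) := by
    intro z
    rw [integral_const_mul, ← schwartz_inv h (y + z)]; rfl
  simp_rw [e1]
  rw [integral_integral_swap]
  · rw [schwartz_inv f y]
    congr 1; ext ξ
    have e2 : ∀ z : VV, ((gv z : ℝ) : ℂ) * (Complex.exp (((2 * π * inner ℝ ξ (y + z) : ℝ) : ℂ) * Complex.I) * 𝓕 h ξ) =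
        (Complex.exp (((2 * π * inner ℝ ξ y : ℝ) : ℂ) * Complex.I) * 𝓕 h ξ) *
        (Complex.exp (((2 * π * inner ℝ z ξ : ℝ) : ℂ) * Complex.I) * ((gv z : ℝ) : ℂ)) := by
      intro z
      rw [inner_add_right, real_inner_comm ξ z, mul_add, Complex.ofReal_add, add_mul, Complex.exp_add]; ring
    simp_rw [e2]
    rw [integral_const_mul, ghat, hF]
    have hp : (1 + (2 * π) ^ 2 * ‖ξ‖ ^ 2 : ℝ) ≠ 0 := by positivity
    have hp' : ((1 + (2 * π) ^ 2 * ‖ξ‖ ^ 2 : ℝ) : ℂ) ≠ 0 := by exact_mod_cast hp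
    rw [Complex.ofReal_inv]
    generalize ((1 + (2 * π) ^ 2 * ‖ξ‖ ^ 2 : ℝ) : ℂ) = c at hp' ⊢
    field_simp
  · have h1 : Integrable (fun p : VV × VV => ((gv p.1 : ℝ) : ℂ) * 𝓕 h p.2) (volume.prod volume) :=
      (gv_integrable.ofReal (𝕜 := ℂ)).mul_prod (SchwartzMap.integrable (𝓕 h))
    have := h1.bdd_mul (c := 1) (f := fun p : VV × VV => Complex.exp (((2 * π * inner ℝ p.2 (y + p.1) : ℝ) : ℂ) * Complex.I)) 
      (by fun_prop : Continuous fun p : VV × VV => Complex.exp (((2 * π * inner ℝ p.2 (y + p.1) : ℝ) : ℂ) * Complex.I)).aestronglyMeasurable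
      (Eventually.of_forall fun p => (Complex.norm_exp_ofReal_mul_I _).le)
    refine this.congr (Eventually.of_forall fun p => ?_)
    simp only [Function.uncurry]; ring

end LambPart8

section LambPart9
open Set Topology
open scoped FourierTransform SchwartzMap Laplacian ContDiff LineDeriv

lemma gq_contAt {q : ℝ} (hq : 0 < q) : ContinuousAt gq q := by
  unfold gq
  have hm : ∀ q : ℝ, AEStronglyMeasurable (fun t => Real.exp (-t) * hk t q) (volume.restrict (Ioi 0)) := fun q =>
    (hk_measurable.comp (measurable_const.prodMk measurable_id : Measurable fun t : ℝ => (q, t))).aestronglyMeasurable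
  refine continuousAt_of_dominated (bound := fun t => Real.exp (-t) * (2 / (π ^ 2 * (q / 2) ^ 2)))
    (Eventually.of_forall hm) ?_ ?_ ?_
  · filter_upwards [lt_mem_nhds (half_lt_self hq)] with s hs
    rw [ae_restrict_iff' measurableSet_Ioi]
    refine Eventually.of_forall fun t (ht : 0 < t) => ?_
    have hs0 : 0 < s := lt_trans (by positivity) hs
    rw [Real.norm_of_nonneg (mul_nonneg (Real.exp_pos _).le (hk_pos ht _).le)]
    refine mul_le_mul_of_nonneg_left ((hk_le ht hs0).trans ?_) (Real.exp_pos _).le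
    gcongr
  · exact (integrableOn_exp_neg_Ioi 0).mul_const _
  · refine Eventually.of_forall fun t => ?_
    unfold hk
    fun_prop

lemma gv_contAt {x : VV} (hx : x ≠ 0) : ContinuousAt gv x := by
  have h : 0 < ‖x‖ ^ 2 := by positivity
  exact ContinuousAt.comp (f := fun x : VV => ‖x‖ ^ 2) (g := gq) (gq_contAt h) (by fun_prop)

lemma cv_kM_cont {w : VV → ℝ} (hw : Integrable w) {M : ℝ} (hM : 0 ≤ M) : Continuous (cv (kM M) w) := by
  rw [continuous_iff_continuousAt]
  intro x
  unfold cv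
  refine continuousAt_of_dominated (bound := fun y => M * |w y|) ?_ ?_ ?_ ?_
  · refine Eventually.of_forall fun z => ?_
    exact ((kM_meas M).comp (measurable_const.sub measurable_id)).aestronglyMeasurable.mul hw.aestronglyMeasurable
  · refine Eventually.of_forall fun z => Eventually.of_forall fun y => ?_
    rw [norm_mul, Real.norm_of_nonneg (kM_nonneg hM _)]
    exact mul_le_mul_of_nonneg_right (kM_le _ _) (abs_nonneg _)
  · exact hw.abs.const_mul M
  · have : ∀ᵐ y : VV, y ≠ x := by
      rw [ae_iff]; simp
    filter_upwards [this] with y hy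
    have h : ContinuousAt (kM M) (x - y) := (gv_contAt (sub_ne_zero.2 hy.symm)).min continuousAt_const
    exact (ContinuousAt.comp (f := fun x => x - y) (g := kM M) h (by fun_prop)).mul continuousAt_const

lemma cv_gv_cont {w : VV → ℝ} (hw : Integrable w) (hn : ∀ x, 0 ≤ w x) {c : ℝ} (hc0 : 0 ≤ c) (hc : ∀ᵐ x, w x ≤ c) :
    Continuous (cv gv w) := by
  have hIntg := cv_int hw.aestronglyMeasurable hn hc
  rw [Metric.continuous_iff']
  intro x ε hε
  obtain ⟨M, hM, hr⟩ := rM_small (ε := ε / (3 * (c + 1))) (by positivity)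
  have hk : ∀ x, |cv gv w x - cv (kM M) w x| ≤ ε / 3 := by
    intro x
    have hik : Integrable (fun y => kM M (x - y) * w y) := by
      refine (hIntg x).mono' (((kM_meas M).comp (measurable_const.sub measurable_id)).aestronglyMeasurable.mul hw.aestronglyMeasurable) ?_
      refine Eventually.of_forall fun y => ?_
      rw [norm_mul, Real.norm_of_nonneg (kM_nonneg hM.le _), Real.norm_of_nonneg (hn y)]
      exact mul_le_mul_of_nonneg_right (kM_le_gv _ _) (hn y)
    have : cv gv w x - cv (kM M) w x = ∫ y, (gv (x - y) * w y - kM M (x - y) * w y) := by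
      rw [integral_sub (hIntg x) hik]; rfl
    rw [this]
    have hb : Integrable (fun y => |gv (x - y) - kM M (x - y)| * c) :=
      ((rM_integrable hM.le).abs.comp_sub_left x).mul_const c
    calc |∫ y, (gv (x - y) * w y - kM M (x - y) * w y)| ≤ ∫ y, |gv (x - y) - kM M (x - y)| * c := by
          rw [← Real.norm_eq_abs]
          refine norm_integral_le_of_norm_le hb ?_
          filter_upwards [hc] with y hy
          rw [← sub_mul, norm_mul, Real.norm_eq_abs, Real.norm_of_nonneg (hn y)]
          exact mul_le_mul_of_nonneg_left hy (abs_nonneg _)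
      _ = (∫ y, |gv y - kM M y|) * c := by
          rw [integral_mul_const, integral_sub_left_eq_self (fun z => |gv z - kM M z|)]
      _ ≤ ε / (3 * (c + 1)) * c := mul_le_mul_of_nonneg_right hr hc0
      _ ≤ ε / (3 * (c + 1)) * (c + 1) := by gcongr; linarith
      _ = ε / 3 := by field_simp
  have hcont := (Metric.continuous_iff'.1 (cv_kM_cont hw hM.le)) x (ε / 3) (by positivity)
  filter_upwards [hcont] with y hy
  rw [Real.dist_eq] at hy ⊢
  have h1 := hk x; have h2 := hk y
  rw [abs_le] at h1 h2
  rw [abs_lt] at hy ⊢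
  constructor <;> linarith [hy.1, hy.2]

/-- real weak form -/
lemma lap_rad {T T1 T2 : ℝ → ℝ} (h1 : ∀ q, HasDerivAt T (T1 q) q) (h2 : ∀ q, HasDerivAt T1 (T2 q) q)
    (f : 𝓢(VV, ℂ)) (hf : ∀ x, f x = (T (‖x‖ ^ 2) : ℂ)) (x : VV) :
    (Δ f) x = ((8 * T1 (‖x‖ ^ 2) + 4 * ‖x‖ ^ 2 * T2 (‖x‖ ^ 2) : ℝ) : ℂ) := by
  set b := EuclideanSpace.basisFun (Fin 4) ℝ
  rw [SchwartzMap.laplacian_eq_sum b, sum_apply]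
  have hq : ∀ (x : VV) (i : Fin 4), HasDerivAt (fun t : ℝ => ‖x + t • b i‖ ^ 2) (2 * x i) 0 := by
    intro x i
    have e : ∀ t : ℝ, ‖x + t • b i‖ ^ 2 = ‖x‖ ^ 2 + t * (2 * x i) + t ^ 2 := by
      intro t
      rw [norm_add_sq_real, norm_smul, b.norm_eq_one, inner_smul_right, real_inner_comm, EuclideanSpace.basisFun_inner]
      simp; ring
    simp_rw [e]
    have := ((hasDerivAt_const (0:ℝ) (‖x‖ ^ 2)).add ((hasDerivAt_id (0:ℝ)).mul_const (2 * x i))).add ((hasDerivAt_id (0:ℝ)).pow 2)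
    refine this.congr_deriv ?_
    simp
  have d1 : ∀ (x : VV) (i : Fin 4), (∂_{b i} f) x = ((T1 (‖x‖ ^ 2) * (2 * x i) : ℝ) : ℂ) := by
    intro x i
    rw [SchwartzMap.lineDerivOp_apply]
    have h := (h1 (‖x + (0:ℝ) • b i‖ ^ 2)).comp (0:ℝ) (hq x i)
    have h' := h.ofReal_comp
    rw [lineDeriv]
    have e : (fun t : ℝ => f (x + t • b i)) = fun t : ℝ => (((T ∘ fun t : ℝ => ‖x + t • b i‖ ^ 2) t : ℝ) : ℂ) := by
      ext t; rw [hf]; rfl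
    rw [e, h'.deriv]; simp
  have d2 : ∀ (i : Fin 4), (∂_{b i} (∂_{b i} f)) x = ((T2 (‖x‖ ^ 2) * (2 * x i) * (2 * x i) + T1 (‖x‖ ^ 2) * 2 : ℝ) : ℂ) := by
    intro i
    rw [SchwartzMap.lineDerivOp_apply]
    have h := (h2 (‖x + (0:ℝ) • b i‖ ^ 2)).comp (0:ℝ) (hq x i)
    have hc : HasDerivAt (fun t : ℝ => 2 * (x + t • b i) i) 2 0 := by
      have e : ∀ t : ℝ, 2 * (x + t • b i) i = 2 * x i + t * 2 := by
        intro t; simp [b]; ring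
      simp_rw [e]
      simpa using ((hasDerivAt_id (0:ℝ)).mul_const (2:ℝ)).const_add (2 * x i)
    have h' := (h.mul hc).ofReal_comp
    rw [lineDeriv]
    have e : (fun t : ℝ => (∂_{b i} f) (x + t • b i)) = fun t : ℝ => ((((T1 ∘ fun t : ℝ => ‖x + t • b i‖ ^ 2) * fun t : ℝ => 2 * (x + t • b i) i) t : ℝ) : ℂ) := by
      ext t; rw [d1]; rfl
    rw [e, h'.deriv]; simp
  simp_rw [d2]
  rw [← Complex.ofReal_sum]
  congr 1
  have hn : ‖x‖ ^ 2 = ∑ i, x i ^ 2 := by rw [EuclideanSpace.norm_sq_eq]; simp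
  have : ∑ i : Fin 4, (T2 (‖x‖ ^ 2) * (2 * x i) * (2 * x i) + T1 (‖x‖ ^ 2) * 2) = 4 * (∑ i, x i ^ 2) * T2 (‖x‖ ^ 2) + 8 * T1 (‖x‖ ^ 2) := by
    simp only [Fin.sum_univ_four]; ring
  rw [this, ← hn]; ring

lemma weak_pde {w : VV → ℝ} (hw : MemLp w 2) {T T1 T2 : ℝ → ℝ} (hT : ContDiff ℝ ∞ T)
    (h1 : ∀ q, HasDerivAt T (T1 q) q) (h2 : ∀ q, HasDerivAt T1 (T2 q) q) {b : ℝ} (hb : ∀ q, b ≤ q → T q = 0) :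
    ∫ x, (T (‖x‖ ^ 2) - (8 * T1 (‖x‖ ^ 2) + 4 * ‖x‖ ^ 2 * T2 (‖x‖ ^ 2))) * cv gv w x = ∫ x, w x * T (‖x‖ ^ 2) := by
  have hcs : HasCompactSupport (fun x : VV => (T (‖x‖ ^ 2) : ℂ)) := by
    apply HasCompactSupport.of_support_subset_isCompact (K := Metric.closedBall 0 (|b| + 1)) (isCompact_closedBall _ _)
    intro x hx
    rw [mem_closedBall_zero_iff]
    by_contra h
    push Not at h
    apply hx
    have : b ≤ ‖x‖ ^ 2 := by nlinarith [abs_nonneg b, le_abs_self b]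
    simp [hb _ this]
  have hsm : ContDiff ℝ ∞ (fun x : VV => (T (‖x‖ ^ 2) : ℂ)) :=
    Complex.ofRealCLM.contDiff.comp (hT.comp (contDiff_id.norm_sq ℝ))
  set f : 𝓢(VV, ℂ) := hcs.toSchwartzMap hsm with hfd
  have hf : ∀ x, f x = (T (‖x‖ ^ 2) : ℂ) := fun x => rfl
  set ψ : VV → ℝ := fun x => T (‖x‖ ^ 2) - (8 * T1 (‖x‖ ^ 2) + 4 * ‖x‖ ^ 2 * T2 (‖x‖ ^ 2)) with hψd
  have hψ : ∀ x, ((ψ x : ℝ) : ℂ) = (f - Δ f) x := by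
    intro x
    rw [sub_apply, hf, lap_rad h1 h2 f hf]
    push_cast [hψd]; ring
  have hψ2 : MemLp ψ 2 := by
    have := (f - Δ f).memLp 2 (μ := volume)
    have h3 := this.re
    refine h3.congr_norm ?_ ?_
    · have : ψ = fun x => ((f - Δ f) x).re := by ext x; rw [← hψ, Complex.ofReal_re]
      rw [this]
      exact h3.1
    · refine Eventually.of_forall fun x => ?_
      simp only [← hψ]; simp
  have hcv : ∀ y, cv gv ψ y = T (‖y‖ ^ 2) := by
    intro y
    have h := gv_resolvent f y
    have e : ∀ z : VV, ((gv z : ℝ) : ℂ) * (f (y + z) - (Δ f) (y + z)) = ((gv z * ψ (y + z) : ℝ) : ℂ) := by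
      intro z; rw [Complex.ofReal_mul, hψ]; rfl
    simp_rw [e] at h
    rw [integral_complex_ofReal, hf] at h
    have h' : ∫ z, gv z * ψ (y + z) = T (‖y‖ ^ 2) := by exact_mod_cast h
    rw [← h']
    unfold cv
    rw [← integral_add_left_eq_self _ y]
    congr 1; ext z
    rw [sub_add_cancel_left, gv_neg]
  have h := Bf_eq_cv gv_integrable hψ2 hw
  rw [Bf_symm gv_neg, Bf_eq_cv gv_integrable hw hψ2] at h
  rw [← h]
  simp_rw [hcv]

end LambPart9

section LambPart10
open Set Topology
open scoped ContDiff

structure Tst (g : ℝ → ℝ) (a b : ℝ) : Prop where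
  sm : ContDiff ℝ ∞ g
  pos : 0 < a
  lt : a < b
  lo : ∀ q, q ≤ a → g q = 0
  hi : ∀ q, b ≤ q → g q = 0

lemma Tst.zero_of {g : ℝ → ℝ} {a b : ℝ} (h : Tst g a b) {q : ℝ} (hq : q ∉ Ioc a b) : g q = 0 := by
  by_cases h1 : q ≤ a
  · exact h.lo q h1
  · push Not at h1
    by_cases h2 : q ≤ b
    · exact absurd ⟨h1, h2⟩ hq
    · exact h.hi q (not_le.1 h2).le

lemma Tst.widen {g : ℝ → ℝ} {a b a' b' : ℝ} (h : Tst g a b) (ha' : 0 < a') (ha : a' ≤ a) (hb : b ≤ b') : Tst g a' b' :=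
  ⟨h.sm, ha', by linarith [h.lt], fun q hq => h.lo q (hq.trans ha), fun q hq => h.hi q (hb.trans hq)⟩

lemma Tst.integral_eq {g : ℝ → ℝ} {a b : ℝ} (h : Tst g a b) (f : ℝ → ℝ) : ∫ q, f q * g q = ∫ q in a..b, f q * g q := by
  rw [intervalIntegral.integral_of_le h.lt.le, setIntegral_eq_integral_of_forall_compl_eq_zero]
  intro q hq
  rw [h.zero_of hq, mul_zero]

lemma Tst.integrable {g : ℝ → ℝ} {a b : ℝ} (h : Tst g a b) {f : ℝ → ℝ} (hf : ContinuousOn f (Ioi 0)) :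
    Integrable (fun q => f q * g q) := by
  have h1 : IntegrableOn (fun q => f q * g q) (Ioc a b) := by
    refine IntegrableOn.mono_set (t := Icc a b) ?_ Ioc_subset_Icc_self
    apply ContinuousOn.integrableOn_Icc
    exact (hf.mono fun x hx => lt_of_lt_of_le h.pos hx.1).mul h.sm.continuous.continuousOn
  rw [← integrableOn_univ]
  exact h1.of_forall_sdiff_eq_zero MeasurableSet.univ (fun q hq => by rw [h.zero_of hq.2, mul_zero])

lemma Tst.prim {g : ℝ → ℝ} {a b : ℝ} (h : Tst g a b) (h0 : ∫ q, g q = 0) :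
    ∃ η, Tst η a b ∧ ∀ q, HasDerivAt η (g q) q := by
  have hd : ∀ q, HasDerivAt (fun q => ∫ x in (a)..q, g x) (g q) q := fun q =>
    intervalIntegral.integral_hasDerivAt_right (h.sm.continuous.intervalIntegrable _ _)
      (h.sm.continuous.stronglyMeasurableAtFilter _ _) h.sm.continuous.continuousAt
  refine ⟨fun q => ∫ x in (a)..q, g x, ⟨?_, h.pos, h.lt, ?_, ?_⟩, hd⟩
  · rw [contDiff_infty_iff_deriv]
    refine ⟨fun q => (hd q).differentiableAt, ?_⟩
    have : deriv (fun q => ∫ x in (a)..q, g x) = g := by ext q; exact (hd q).deriv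
    rw [this]; exact h.sm
  · intro q hq
    show ∫ x in (a)..q, g x = 0
    rw [intervalIntegral.integral_congr (g := fun _ => 0)]
    · simp
    · intro x hx
      rw [uIcc_of_ge hq] at hx
      exact h.lo x hx.2
  · intro q hq
    show ∫ x in (a)..q, g x = 0
    rw [← intervalIntegral.integral_add_adjacent_intervals (b := b) (h.sm.continuous.intervalIntegrable _ _) (h.sm.continuous.intervalIntegrable _ _)]
    have e := h.integral_eq (fun _ => 1)
    simp only [one_mul] at e
    rw [← e, h0, zero_add, intervalIntegral.integral_congr (g := fun _ => 0)]
    · simp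
    · intro x hx
      rw [uIcc_of_le hq] at hx
      exact h.hi x hx.1

lemma dBR {f : ℝ → ℝ} (hf : ContinuousOn f (Ioi 0))
    (h : ∀ (η : ℝ → ℝ) (a b : ℝ) (η1 : ℝ → ℝ), Tst η a b → (∀ q, HasDerivAt η (η1 q) q) → ∫ q, f q * η1 q = 0) : ∃ c, ∀ q, 0 < q → f q = c := by
  let B : ContDiffBump (2:ℝ) := ⟨1/2, 1, by norm_num, by norm_num⟩
  set n0 : ℝ → ℝ := B.normed volume
  have hn0 : Tst n0 1 3 := by
    refine ⟨B.contDiff_normed, one_pos, by norm_num, ?_, ?_⟩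
    · intro q hq
      have : q ∉ Function.support n0 := by
        rw [B.support_normed_eq, Real.ball_eq_Ioo]
        intro hh; have := hh.1; simp only [B] at this; linarith
      simpa using this
    · intro q hq
      have : q ∉ Function.support n0 := by
        rw [B.support_normed_eq, Real.ball_eq_Ioo]
        intro hh; have := hh.2; simp only [B] at this; linarith
      simpa using this
  have hn1 : ∫ q, n0 q = 1 := B.integral_normed
  set c := ∫ q, f q * n0 q with hc
  refine ⟨c, ?_⟩
  have key : ∀ᵐ q : ℝ, q ∈ Ioi (0:ℝ) → f q - c = 0 := by
    apply isOpen_Ioi.ae_eq_zero_of_integral_contDiff_smul_eq_zero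
    · exact (hf.sub continuousOn_const).locallyIntegrableOn measurableSet_Ioi
    · intro g hg hgc hgs
      obtain ⟨a, b, hab⟩ : ∃ a b, Tst g a b := by
        have hK : IsCompact (tsupport g) := hgc
        obtain ⟨b, hb⟩ := hK.bddAbove
        have hx0 : ∃ a, 0 < a ∧ ∀ x ∈ tsupport g, a ≤ x := by
          rcases (tsupport g).eq_empty_or_nonempty with he | hne
          · exact ⟨1, one_pos, by simp [he]⟩
          · obtain ⟨x, hx, hm⟩ := hK.exists_isLeast hne
            exact ⟨x, hgs hx, fun y hy => hm hy⟩
        obtain ⟨a, ha, hal⟩ := hx0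
        refine ⟨a / 2, max b a + 1, hg, by positivity, by linarith [le_max_right b a], ?_, ?_⟩
        · intro q hq
          by_contra hne
          have := hal q (subset_tsupport g hne)
          linarith
        · intro q hq
          by_contra hne
          have := hb (subset_tsupport g hne)
          linarith [le_max_left b a]
      set a' := min a 1
      set b' := max b 3
      have ha' : 0 < a' := lt_min hab.pos one_pos
      have t1 := hab.widen ha' (min_le_left a 1) (le_max_left b 3)
      have t2 := hn0.widen ha' (min_le_right a 1) (le_max_right b 3)
      set m := ∫ q, g q
      have ht : Tst (fun q => g q - m * n0 q) a' b' := by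
        refine ⟨t1.sm.sub (contDiff_const.mul t2.sm), t1.pos, t1.lt, ?_, ?_⟩
        · intro q hq; rw [t1.lo q hq, t2.lo q hq]; ring
        · intro q hq; rw [t1.hi q hq, t2.hi q hq]; ring
      have i1 : Integrable g := by simpa using t1.integrable (f := fun _ => 1) continuousOn_const
      have i2 : Integrable n0 := by simpa using t2.integrable (f := fun _ => 1) continuousOn_const
      have h0 : ∫ q, (g q - m * n0 q) = 0 := by
        rw [integral_sub i1 (i2.const_mul m), integral_const_mul, hn1]; simp [m]
      obtain ⟨η, hη, hηd⟩ := ht.prim h0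
      have hz := h η a' b' _ hη hηd
      have e : ∀ q, f q * (g q - m * n0 q) = f q * g q - m * (f q * n0 q) := fun q => by ring
      simp_rw [e] at hz
      rw [integral_sub (t1.integrable hf) ((t2.integrable hf).const_mul m), integral_const_mul] at hz
      have e2 : ∀ q, g q • (f q - c) = f q * g q - c * g q := fun q => by rw [smul_eq_mul]; ring
      simp_rw [e2]
      rw [integral_sub (t1.integrable hf) (i1.const_mul c), integral_const_mul]
      rw [← hc] at hz
      linarith
  have key2 : f =ᵐ[volume.restrict (Ioi 0)] fun _ => c := by
    rw [EventuallyEq, ae_restrict_iff' measurableSet_Ioi]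
    filter_upwards [key] with q hq h; linarith [hq h]
  intro q hq
  exact Measure.eqOn_open_of_ae_eq key2 isOpen_Ioi hf continuousOn_const hq

/-- polar coordinates in the variable `q = r^2` -/
noncomputable def c4 : ℝ := 2 * (volume : Measure VV).real (Metric.ball 0 1)

lemma c4_pos : 0 < c4 := by
  unfold c4
  have : 0 < (volume : Measure VV).real (Metric.ball 0 1) := by
    rw [Measure.real, ENNReal.toReal_pos_iff]
    exact ⟨Metric.measure_ball_pos _ _ one_pos, measure_ball_lt_top⟩
  linarith

lemma polar (F : ℝ → ℝ) : ∫ x : VV, F (‖x‖ ^ 2) = c4 * ∫ q in Ioi (0:ℝ), q * F q := by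
  rw [integral_fun_norm_addHaar volume (fun r => F (r ^ 2))]
  rw [← integral_comp_rpow_Ioi_of_pos (g := fun q => q * F q) (p := 2) two_pos]
  rw [c4, finrank_euclideanSpace, Fintype.card_fin]
  have : ∫ x in Ioi (0:ℝ), (2 * x ^ ((2:ℝ) - 1)) • (x ^ (2:ℝ) * F (x ^ (2:ℝ))) = 2 * ∫ y in Ioi (0:ℝ), y ^ (4 - 1) • F (y ^ 2) := by
    rw [← integral_const_mul]
    apply setIntegral_congr_fun measurableSet_Ioi
    intro x hx
    have e1 : x ^ ((2:ℝ) - 1) = x := by norm_num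
    simp only [e1, rpow_two, smul_eq_mul]; ring
  rw [this]; simp only [nsmul_eq_mul, smul_eq_mul]; push_cast; ring

lemma polar_int (F : ℝ → ℝ) : Integrable (fun x : VV => F (‖x‖ ^ 2)) ↔ IntegrableOn (fun q => q * F q) (Ioi (0:ℝ)) := by
  rw [integrable_fun_norm_addHaar volume (f := fun r => F (r ^ 2))]
  rw [← integrableOn_Ioi_comp_rpow_iff (f := fun q => q * F q) (p := 2) two_ne_zero]
  rw [finrank_euclideanSpace, Fintype.card_fin]
  have e : ∀ x ∈ Ioi (0:ℝ), (|2| * x ^ ((2:ℝ) - 1)) • (x ^ (2:ℝ) * F (x ^ (2:ℝ))) = 2 * (x ^ (4 - 1) • F (x ^ 2)) := by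
    intro x hx
    have e1 : x ^ ((2:ℝ) - 1) = x := by norm_num
    simp only [e1, rpow_two, smul_eq_mul]; norm_num; ring
  rw [integrableOn_congr_fun e measurableSet_Ioi]
  exact (integrable_const_mul_iff (c := (2:ℝ)) (by norm_num) _).symm

end LambPart10

section LambPart11
open Set Topology
open scoped ContDiff

theorem ode_of_Cx {lam : ℝ} (hl : 1 < lam) {w : VV → ℝ} (hw : IsCx lam w) :
    ∃ U : ℝ → ℝ, Continuous U ∧ Antitone U ∧ (∀ q, 0 ≤ U q) ∧ (∀ x, cv gv w x = U (‖x‖ ^ 2)) ∧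
      (∀ᵐ x, w x = lam * max (U (‖x‖ ^ 2) - Cst lam * ∫ x, w x) 0) ∧
      ∀ q, 0 < q → HasDerivAt U ((∫ s in (0:ℝ)..q, s * (U s - lam * max (U s - Cst lam * ∫ x, w x) 0)) / (4 * q ^ 2)) q := by
  obtain ⟨U0, hanti, hnn, ⟨c, hc⟩, hcv, hae⟩ := profile hl hw
  obtain ⟨cw, hcw0, hcw⟩ := bdd_Mx hl hw.1
  have hcont : Continuous (cv gv w) := cv_gv_cont hw.1.1.l1 hw.1.1.nn hcw0 hcw
  set U : ℝ → ℝ := fun q => U0 (max q 0) with hU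
  have hUn : ∀ x : VV, U (‖x‖ ^ 2) = U0 (‖x‖ ^ 2) := by
    intro x; simp only [hU]; rw [max_eq_left (sq_nonneg _)]
  have hUe : U = fun q => cv gv w (√q • ei 0) := by
    ext q
    rw [hcv, norm_smul, ei_norm, mul_one, norm_of_nonneg (Real.sqrt_nonneg q), hU]
    show U0 (max q 0) = U0 (√q ^ 2)
    congr 1
    rcases le_total 0 q with h | h
    · rw [max_eq_left h, Real.sq_sqrt h]
    · rw [max_eq_right h, Real.sqrt_eq_zero_of_nonpos h]; simp
  have hUc : Continuous U := by
    rw [hUe]; exact hcont.comp (Real.continuous_sqrt.smul continuous_const)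
  have hUa : Antitone U := fun q q' h => hanti (le_max_right q 0) (le_max_right q' 0) (max_le_max_right 0 h)
  set W := Cst lam * ∫ x, w x with hW
  simp_rw [← hUn] at hcv hae
  refine ⟨U, hUc, hUa, fun q => hnn _, hcv, hae, ?_⟩
  set wt : ℝ → ℝ := fun q => lam * max (U q - W) 0 with hwt
  have hwtc : Continuous wt := continuous_const.mul ((hUc.sub continuous_const).max continuous_const)
  set P : ℝ → ℝ := fun q => ∫ s in (0:ℝ)..q, s * (U s - wt s) with hP
  have hci : Continuous fun s => s * (U s - wt s) := continuous_id.mul (hUc.sub hwtc)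
  have hPd : ∀ q, HasDerivAt P (q * (U q - wt q)) q := fun q =>
    intervalIntegral.integral_hasDerivAt_right (hci.intervalIntegrable _ _)
      (hci.stronglyMeasurableAtFilter _ _) hci.continuousAt
  have hPc : Continuous P := continuous_iff_continuousAt.2 fun q => (hPd q).continuousAt
  have hVi : ContinuousOn (fun s => P s / (4 * s ^ 2)) (Ioi 0) := by
    apply hPc.continuousOn.div (by fun_prop)
    intro s hs
    have : (0:ℝ) < s := hs
    positivity
  set V : ℝ → ℝ := fun q => ∫ s in (1:ℝ)..q, P s / (4 * s ^ 2) with hV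
  have hVd : ∀ q, 0 < q → HasDerivAt V (P q / (4 * q ^ 2)) q := by
    intro q hq
    have hsub : uIcc 1 q ⊆ Ioi (0:ℝ) := by
      intro x hx
      exact lt_of_lt_of_le (lt_min one_pos hq) hx.1
    refine intervalIntegral.integral_hasDerivAt_right ((hVi.mono hsub).intervalIntegrable) ?_ (hVi.continuousAt (Ioi_mem_nhds hq))
    exact hVi.stronglyMeasurableAtFilter isOpen_Ioi q hq
  have hVc : ContinuousOn V (Ioi 0) := fun q hq => (hVd q hq).continuousAt.continuousWithinAt
  have hdbr : ∃ c, ∀ q, 0 < q → U q - V q = c := by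
    refine dBR (f := fun q => U q - V q) (hUc.continuousOn.sub hVc) ?_
    intro η a b η1 hη hηd
    have ha := hη.pos
    have hab := hη.lt
    have hb0 : 0 < b := ha.trans hab
    have hη1 : η1 = deriv η := by ext q; exact (hηd q).deriv.symm
    have hη1c : Continuous η1 := by rw [hη1]; exact hη.sm.continuous_deriv (by simp)
    have hηc : Continuous η := hη.sm.continuous
    have e1lo : ∀ q, q < a → η1 q = 0 := by
      intro q hq
      rw [hη1]
      have : η =ᶠ[𝓝 q] fun _ => 0 := by
        filter_upwards [Iio_mem_nhds hq] with x hx using hη.lo x (le_of_lt hx)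
      rw [this.deriv_eq]; simp
    have e1hi : ∀ q, b < q → η1 q = 0 := by
      intro q hq
      rw [hη1]
      have : η =ᶠ[𝓝 q] fun _ => 0 := by
        filter_upwards [Ioi_mem_nhds hq] with x hx using hη.hi x (le_of_lt hx)
      rw [this.deriv_eq]; simp
    -- chi
    set χ : ℝ → ℝ := fun q => η q / q ^ 2 with hχ
    have hχs : ContDiff ℝ ∞ χ := by
      rw [contDiff_iff_contDiffAt]
      intro q
      by_cases hq : q < a
      · have : χ =ᶠ[𝓝 q] fun _ => 0 := by
          filter_upwards [Iio_mem_nhds hq] with x hx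
          simp only [hχ, hη.lo x (le_of_lt hx), zero_div]
        exact (contDiffAt_const).congr_of_eventuallyEq this
      · push Not at hq
        exact hη.sm.contDiffAt.div (contDiffAt_id.pow 2) (by have : 0 < q := by linarith
                                                             positivity)
    set χ1 : ℝ → ℝ := deriv χ with hχ1
    have hχd : ∀ q, HasDerivAt χ (χ1 q) q := fun q =>
      (hχs.differentiable (by simp) q).hasDerivAt
    have hχ1c : Continuous χ1 := hχs.continuous_deriv (by simp)
    have hχhi : ∀ q, b ≤ q → χ q = 0 := fun q hq => by simp only [hχ, hη.hi q hq, zero_div]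
    have hχ1hi : ∀ q, b < q → χ1 q = 0 := by
      intro q hq
      have : χ =ᶠ[𝓝 q] fun _ => 0 := by
        filter_upwards [Ioi_mem_nhds hq] with x hx using hχhi x (le_of_lt hx)
      rw [hχ1, this.deriv_eq]; simp
    set T : ℝ → ℝ := fun q => -∫ x in (b)..q, χ x with hT
    have hTd : ∀ q, HasDerivAt T (-χ q) q := fun q =>
      (intervalIntegral.integral_hasDerivAt_right (hχs.continuous.intervalIntegrable _ _)
        (hχs.continuous.stronglyMeasurableAtFilter _ _) hχs.continuous.continuousAt).neg
    have hTs : ContDiff ℝ ∞ T := by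
      rw [contDiff_infty_iff_deriv]
      refine ⟨fun q => (hTd q).differentiableAt, ?_⟩
      have : deriv T = fun q => -χ q := by ext q; exact (hTd q).deriv
      rw [this]; exact hχs.neg
    have hThi : ∀ q, b ≤ q → T q = 0 := by
      intro q hq
      simp only [hT]
      rw [intervalIntegral.integral_congr (g := fun _ => 0)]
      · simp
      · intro x hx
        rw [uIcc_of_le hq] at hx
        exact hχhi x hx.1
    have hTc : Continuous T := hTs.continuous
    have hpde := weak_pde hw.1.1.l2 hTs hTd (fun q => (hχd q).neg) hThi
    have hl1 : ∫ x, (T (‖x‖ ^ 2) - (8 * -χ (‖x‖ ^ 2) + 4 * ‖x‖ ^ 2 * -χ1 (‖x‖ ^ 2))) * cv gv w x =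
        c4 * ∫ q in Ioi (0:ℝ), q * ((T q - (8 * -χ q + 4 * q * -χ1 q)) * U q) := by
      rw [← polar]; simp_rw [hcv]
    have hr1 : ∫ x, w x * T (‖x‖ ^ 2) = c4 * ∫ q in Ioi (0:ℝ), q * (wt q * T q) := by
      rw [← polar]
      apply integral_congr_ae
      filter_upwards [hae] with x hx
      rw [hx]
    rw [hl1, hr1] at hpde
    have hpde2 := mul_left_cancel₀ c4_pos.ne' hpde
    have cut : ∀ F : ℝ → ℝ, (∀ q, b < q → F q = 0) → ∫ q in Ioi (0:ℝ), F q = ∫ q in (0:ℝ)..b, F q := by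
      intro F hF
      rw [intervalIntegral.integral_of_le hb0.le]
      apply setIntegral_eq_of_subset_of_forall_sdiff_eq_zero measurableSet_Ioi Ioc_subset_Ioi_self
      intro x hx
      apply hF
      by_contra h
      exact hx.2 ⟨hx.1, not_lt.1 h⟩
    rw [cut _ (fun q hq => by rw [hThi q hq.le, hχhi q hq.le, hχ1hi q hq]; ring),
      cut _ (fun q hq => by rw [hThi q hq.le]; ring)] at hpde2
    -- integrate by parts P T
    have ibp1 : ∫ q in (0:ℝ)..b, (q * (U q - wt q) * T q + P q * (-χ q)) = P b * T b - P 0 * T 0 := by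
      apply intervalIntegral.integral_eq_sub_of_hasDerivAt (f := fun q => P q * T q)
      · intro q _; exact (hPd q).mul (hTd q)
      · apply Continuous.intervalIntegrable
        exact ((hci.mul hTc)).add (hPc.mul hχs.continuous.neg)
    have hP0 : P 0 = 0 := by simp [hP]
    rw [hThi b le_rfl, hP0] at ibp1
    have hrel : ∀ q, η1 q = 2 * q * χ q + q ^ 2 * χ1 q := by
      intro q
      have e : η = fun q => q ^ 2 * χ q := by
        ext q
        by_cases hq : q ≤ 0
        · rw [hη.lo q (by linarith)]; simp only [hχ, hη.lo q (by linarith : q ≤ a)]; simp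
        · push Not at hq; simp only [hχ]; field_simp
      have h2 := ((hasDerivAt_pow 2 q).mul (hχd q))
      have h3 : HasDerivAt η (((2:ℕ):ℝ) * q ^ (2 - 1) * χ q + q ^ 2 * χ1 q) q := by
        rw [e]; exact h2
      rw [(hηd q).unique h3]; norm_num
    have hchic := hχs.continuous
    have key1 : ∫ q in (0:ℝ)..b, (P q * χ q + 4 * U q * η1 q) = 0 := by
      have e : ∀ q, P q * χ q + 4 * U q * η1 q =
          q * ((T q - (8 * -χ q + 4 * q * -χ1 q)) * U q) - q * (wt q * T q) -
            (q * (U q - wt q) * T q + P q * (-χ q)) := by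
        intro q; rw [hrel]; ring
      simp_rw [e]
      rw [intervalIntegral.integral_sub, intervalIntegral.integral_sub, hpde2, ibp1]
      · ring
      · exact Continuous.intervalIntegrable (by fun_prop) _ _
      · exact Continuous.intervalIntegrable (by fun_prop) _ _
      · exact Continuous.intervalIntegrable (by fun_prop) _ _
      · exact Continuous.intervalIntegrable (by fun_prop) _ _
    have key2 : ∫ q in a..b, (P q * χ q + 4 * U q * η1 q) = 0 := by
      rw [← key1, ← intervalIntegral.integral_add_adjacent_intervals (a := 0) (b := a) (c := b)]
      · have : ∫ q in (0:ℝ)..a, (P q * χ q + 4 * U q * η1 q) = 0 := by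
          rw [intervalIntegral.integral_of_le ha.le, integral_Ioc_eq_integral_Ioo]
          rw [setIntegral_congr_fun (g := fun _ => 0) measurableSet_Ioo]
          · simp
          · intro x hx
            simp only [hχ, hη.lo x hx.2.le, e1lo x hx.2]; ring
        rw [this, zero_add]
      · exact Continuous.intervalIntegrable (by fun_prop) _ _
      · exact Continuous.intervalIntegrable (by fun_prop) _ _
    have hsub : uIcc a b ⊆ Ioi (0:ℝ) := by
      rw [uIcc_of_le hab.le]; intro x hx; exact lt_of_lt_of_le ha hx.1
    have ibp2 : ∫ q in a..b, (P q / (4 * q ^ 2) * η q + V q * η1 q) = V b * η b - V a * η a := by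
      apply intervalIntegral.integral_eq_sub_of_hasDerivAt (f := fun q => V q * η q)
      · intro q hq; exact (hVd q (hsub hq)).mul (hηd q)
      · apply ContinuousOn.intervalIntegrable
        exact ((hVi.mono hsub).mul hηc.continuousOn).add ((hVc.mono hsub).mul hη1c.continuousOn)
    rw [hη.lo a le_rfl, hη.hi b le_rfl] at ibp2
    have fin : ∫ q, (U q - V q) * η1 q = ∫ q in a..b, (U q - V q) * η1 q := by
      rw [intervalIntegral.integral_of_le hab.le, integral_Ioc_eq_integral_Ioo, ← integral_Icc_eq_integral_Ioo,
        setIntegral_eq_integral_of_forall_compl_eq_zero]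
      intro q hq
      have : η1 q = 0 := by
        by_cases h1 : q < a
        · exact e1lo q h1
        · by_cases h2 : b < q
          · exact e1hi q h2
          · exact absurd ⟨not_lt.1 h1, not_lt.1 h2⟩ hq
      rw [this, mul_zero]
    rw [fin]
    have e : ∀ q ∈ uIcc a b, (U q - V q) * η1 q = (1/4) * (P q * χ q + 4 * U q * η1 q) -
        (P q / (4 * q ^ 2) * η q + V q * η1 q) := by
      intro q hq
      have : 0 < q := hsub hq
      simp only [hχ]; field_simp; ring
    rw [intervalIntegral.integral_congr e, intervalIntegral.integral_sub, intervalIntegral.integral_const_mul, key2, ibp2]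
    · ring
    · exact Continuous.intervalIntegrable (by fun_prop) _ _
    · apply ContinuousOn.intervalIntegrable
      exact ((hVi.mono hsub).mul hηc.continuousOn).add ((hVc.mono hsub).mul hη1c.continuousOn)
  obtain ⟨c', hc'⟩ := hdbr
  intro q hq
  have h := (hVd q hq).add_const c'
  refine h.congr_of_eventuallyEq ?_
  filter_upwards [Ioi_mem_nhds hq] with x hx
  linarith [hc' x hx]

end LambPart11

section LambPart12
open Set Topology
open scoped Nat

lemma ser_summable {c : ℕ → ℝ} (hc : ∀ k, |c k| ≤ 1 / (k ! : ℝ)) (s : ℝ) : Summable fun k => c k * s ^ k := by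
  refine Summable.of_norm_bounded (g := fun k => |s| ^ k / (k ! : ℝ)) (Real.summable_pow_div_factorial |s|) ?_
  intro k
  rw [norm_mul, norm_pow, Real.norm_eq_abs, Real.norm_eq_abs]
  calc |c k| * |s| ^ k ≤ 1 / (k ! : ℝ) * |s| ^ k := by gcongr; exact hc k
    _ = _ := by ring

lemma ser_deriv {c : ℕ → ℝ} (hc : ∀ k, |c k| ≤ 1 / (k ! : ℝ)) (s : ℝ) :
    HasDerivAt (fun s => ∑' k, c k * s ^ k) (∑' k : ℕ, ((k + 1 : ℝ) * c (k + 1)) * s ^ k) s := by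
  set R := |s| + 1
  have hsum : Summable (fun k : ℕ => (k : ℝ) * R ^ (k - 1) / (k ! : ℝ)) := by
    rw [← summable_nat_add_iff 1]
    refine (Real.summable_pow_div_factorial R).congr fun k => ?_
    rw [Nat.factorial_succ]; push_cast
    have : ((k ! : ℕ) : ℝ) ≠ 0 := by positivity
    have : (k + 1 : ℝ) ≠ 0 := by positivity
    field_simp
  have h := hasDerivAt_tsum_of_isPreconnected (u := fun k : ℕ => (k : ℝ) * R ^ (k - 1) / (k ! : ℝ))
    (g := fun (k : ℕ) s => c k * s ^ k) (g' := fun k s => c k * ((k:ℝ) * s ^ (k - 1))) (t := Metric.ball 0 R) hsum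
    Metric.isOpen_ball (convex_ball 0 R).isPreconnected
    (fun k y _ => (hasDerivAt_pow k y).const_mul (c k)) ?_ (y₀ := s) (y := s) ?_ (ser_summable hc s) ?_
  · have e : ∑' k : ℕ, c k * ((k:ℝ) * s ^ (k - 1)) = ∑' k : ℕ, ((k + 1 : ℝ) * c (k + 1)) * s ^ k := by
      rw [Summable.tsum_eq_zero_add]
      · simp only [Nat.cast_zero, zero_mul, mul_zero, zero_add]
        congr 1; ext k; push_cast; ring
      · refine Summable.of_norm_bounded hsum ?_
        intro k
        rw [norm_mul, norm_mul, norm_pow, Real.norm_eq_abs, Real.norm_eq_abs, Real.norm_eq_abs, Nat.abs_cast]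
        calc |c k| * ((k:ℝ) * |s| ^ (k-1)) ≤ 1 / (k ! : ℝ) * ((k:ℝ) * R ^ (k-1)) := by
              gcongr
              · exact hc k
              · linarith
          _ = _ := by ring
    rw [← e]; exact h
  · intro k y hy
    rw [mem_ball_zero_iff, Real.norm_eq_abs] at hy
    rw [norm_mul, norm_mul, norm_pow, Real.norm_eq_abs, Real.norm_eq_abs, Real.norm_eq_abs, Nat.abs_cast]
    calc |c k| * ((k:ℝ) * |y| ^ (k-1)) ≤ 1 / (k ! : ℝ) * ((k:ℝ) * R ^ (k-1)) := by
          gcongr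
          exact hc k
      _ = _ := by ring
  · rw [mem_ball_zero_iff, Real.norm_eq_abs]; exact lt_add_one _
  · rw [mem_ball_zero_iff, Real.norm_eq_abs]; exact lt_add_one _

noncomputable def cJ (k : ℕ) : ℝ := (-1 : ℝ) ^ k / ((k ! : ℝ) * ((k + 1)! : ℝ))
noncomputable def cJ' (k : ℕ) : ℝ := (k + 1 : ℝ) * cJ (k + 1)
noncomputable def cJ'' (k : ℕ) : ℝ := (k + 1 : ℝ) * cJ' (k + 1)

lemma cJ'_rel (k : ℕ) : cJ' k * (k + 2) = - cJ k := by
  unfold cJ' cJ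
  rw [Nat.factorial_succ (k + 1), Nat.factorial_succ k, pow_succ]
  push_cast
  have : ((k ! : ℕ) : ℝ) ≠ 0 := by positivity
  have : (k + 1 : ℝ) ≠ 0 := by positivity
  have : (k + 1 + 1 : ℝ) ≠ 0 := by positivity
  field_simp
  ring

lemma cJ_le (k : ℕ) : |cJ k| ≤ 1 / (k ! : ℝ) := by
  unfold cJ
  rw [abs_div, abs_pow, abs_neg, abs_one, one_pow, abs_of_pos (by positivity)]
  have h1 : (1:ℝ) ≤ ((k+1)! : ℝ) := by exact_mod_cast Nat.factorial_pos (k + 1)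
  have h0 : (0:ℝ) < (k ! : ℝ) := by positivity
  apply one_div_le_one_div_of_le h0
  nlinarith

lemma cJ'_le (k : ℕ) : |cJ' k| ≤ 1 / (k ! : ℝ) := by
  have h := cJ'_rel k
  have h2 : |cJ' k| * (k + 2) = |cJ k| := by
    rw [← abs_neg (cJ k), ← h, abs_mul, abs_of_pos (by positivity : (0:ℝ) < k + 2)]
  have := cJ_le k
  have h3 := abs_nonneg (cJ' k)
  have : (0:ℝ) ≤ k := by positivity
  nlinarith

noncomputable def Js (s : ℝ) : ℝ := ∑' k, cJ k * s ^ k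
noncomputable def Js' (s : ℝ) : ℝ := ∑' k, cJ' k * s ^ k
noncomputable def Js'' (s : ℝ) : ℝ := ∑' k, cJ'' k * s ^ k

lemma Js_deriv (s : ℝ) : HasDerivAt Js (Js' s) s := ser_deriv cJ_le s
lemma Js'_deriv (s : ℝ) : HasDerivAt Js' (Js'' s) s := ser_deriv cJ'_le s

lemma cJ''_le (k : ℕ) : |cJ'' k| ≤ 1 / (k ! : ℝ) := by
  unfold cJ''
  rw [abs_mul, abs_of_pos (by positivity : (0:ℝ) < k + 1)]
  have h := cJ'_le (k + 1)
  rw [Nat.factorial_succ] at h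
  push_cast at h
  calc (k + 1 : ℝ) * |cJ' (k + 1)| ≤ (k + 1) * (1 / ((k + 1) * (k ! : ℝ))) := by gcongr
    _ = _ := by
      have : (k + 1 : ℝ) ≠ 0 := by positivity
      field_simp

lemma Js_ode (s : ℝ) : s * Js'' s + 2 * Js' s + Js s = 0 := by
  have h0 := ser_summable cJ_le s
  have h1 := ser_summable cJ'_le s
  have h2 := ser_summable cJ''_le s
  have e : s * Js'' s = ∑' k : ℕ, (k : ℝ) * cJ' k * s ^ k := by
    have hs : Summable (fun k : ℕ => (k : ℝ) * cJ' k * s ^ k) := by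
      rw [← summable_nat_add_iff 1]
      refine (h2.mul_left s).congr fun k => ?_
      unfold cJ''; push_cast; ring
    rw [hs.tsum_eq_zero_add, Js'', ← tsum_mul_left]
    simp only [Nat.cast_zero, zero_mul, zero_add]
    congr 1; ext k; unfold cJ''; push_cast; ring
  have hs : Summable (fun k : ℕ => (k : ℝ) * cJ' k * s ^ k) := by
    rw [← summable_nat_add_iff 1]
    refine (h2.mul_left s).congr fun k => ?_
    unfold cJ''; push_cast; ring
  rw [e, Js', Js, ← tsum_mul_left, ← hs.tsum_add (h1.mul_left 2), ← (hs.add (h1.mul_left 2)).tsum_add h0]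
  rw [← tsum_zero (α := ℝ) (β := ℕ)]
  congr 1; ext k
  have := cJ'_rel k
  linear_combination s ^ k * this

lemma Js_zero : Js 0 = 1 := by
  unfold Js
  rw [tsum_eq_single 0]
  · simp [cJ]
  · intro k hk; simp [hk]

lemma J1_eq (r : ℝ) : J1 r = (r / 2) * Js (r ^ 2 / 4) := by
  unfold J1 Js
  rw [← tsum_mul_left]
  congr 1; ext k
  unfold cJ
  rw [pow_succ (r / 2), pow_mul]
  have : (r / 2) ^ 2 = r ^ 2 / 4 := by ring
  rw [this]; ring

/-- `jq κ q = Js (κ² q / 4)` -/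
noncomputable def jq (k q : ℝ) : ℝ := Js (k ^ 2 * q / 4)
noncomputable def jq' (k q : ℝ) : ℝ := k ^ 2 / 4 * Js' (k ^ 2 * q / 4)

lemma jq_deriv (k q : ℝ) : HasDerivAt (jq k) (jq' k q) q := by
  have h : HasDerivAt (fun q : ℝ => k ^ 2 * q / 4) (k ^ 2 / 4) q := by
    simpa using ((hasDerivAt_id q).const_mul (k ^ 2)).div_const 4
  have := (Js_deriv (k ^ 2 * q / 4)).comp q h
  refine this.congr_deriv ?_
  unfold jq'; ring

lemma jq'_deriv (k q : ℝ) : HasDerivAt (jq' k) (k ^ 4 / 16 * Js'' (k ^ 2 * q / 4)) q := by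
  have h : HasDerivAt (fun q : ℝ => k ^ 2 * q / 4) (k ^ 2 / 4) q := by
    simpa using ((hasDerivAt_id q).const_mul (k ^ 2)).div_const 4
  have := ((Js'_deriv (k ^ 2 * q / 4)).comp q h).const_mul (k ^ 2 / 4)
  refine this.congr_deriv ?_
  ring

lemma jq_ode (k q : ℝ) : HasDerivAt (fun q => 4 * q ^ 2 * jq' k q) (-(k ^ 2 * q * jq k q)) q := by
  have h := ((hasDerivAt_pow 2 q).const_mul 4).mul (jq'_deriv k q)
  refine h.congr_deriv ?_
  have := Js_ode (k ^ 2 * q / 4)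
  unfold jq' jq
  simp only [Nat.cast_ofNat, Nat.add_one_sub_one, pow_one]
  linear_combination k ^ 2 * q * this

lemma jq_zero (k : ℝ) : jq k 0 = 1 := by unfold jq; simp [Js_zero]

lemma jq_cont (k : ℝ) : Continuous (jq k) := continuous_iff_continuousAt.2 fun q => (jq_deriv k q).continuousAt
lemma jq'_cont (k : ℝ) : Continuous (jq' k) := continuous_iff_continuousAt.2 fun q => (jq'_deriv k q).continuousAt

lemma J1_jq (k r : ℝ) : J1 (k * r) = (k * r / 2) * jq k (r ^ 2) := by
  rw [J1_eq, jq]; congr 2; ring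

/-- derivative of `J1` at `k r` -/
lemma J1_deriv {k r : ℝ} (hk : k ≠ 0) : deriv J1 (k * r) = (jq k (r ^ 2) + 2 * r ^ 2 * jq' k (r ^ 2)) / 2 := by
  have e : J1 = fun r => (r / 2) * Js (r ^ 2 / 4) := by ext r; exact J1_eq r
  have h1 : HasDerivAt (fun x : ℝ => x ^ 2 / 4) (2 * (k * r) / 4) (k * r) := by
    simpa using (hasDerivAt_pow 2 (k * r)).div_const 4
  have h := ((hasDerivAt_id (k * r)).div_const 2).mul ((Js_deriv ((k * r) ^ 2 / 4)).comp (k * r) h1)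
  have e2 : J1 = ((fun x => id x / 2) * Js ∘ fun x => x ^ 2 / 4) := by rw [e]; rfl
  rw [e2, h.deriv]
  have : k ^ 2 * r ^ 2 / 4 = (k * r) ^ 2 / 4 := by ring
  unfold jq jq'
  rw [this]; simp only [Function.comp, id]; ring

end LambPart12

section LambPart13
open Set Topology
open scoped Nat

noncomputable def fn (n : ℕ) (q t : ℝ) : ℝ := Real.exp (-t) * ((t ^ n)⁻¹ * Real.exp (-(q / (4 * t))))
noncomputable def gn (n : ℕ) (q : ℝ) : ℝ := ∫ t in Ioi (0:ℝ), fn n q t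

lemma fn_pos (n : ℕ) (q : ℝ) {t : ℝ} (ht : 0 < t) : 0 < fn n q t := by unfold fn; positivity

lemma exp_le_fac (m : ℕ) {q t : ℝ} (hq : 0 < q) (ht : 0 < t) :
    Real.exp (-(q / (4 * t))) ≤ (m ! : ℝ) * (4 * t / q) ^ m := by
  have hy : 0 < q / (4 * t) := by positivity
  have h := Real.pow_div_factorial_le_exp _ hy.le m
  rw [Real.exp_neg]
  have h2 : (m ! : ℝ) * (4 * t / q) ^ m = ((q / (4 * t)) ^ m / (m ! : ℝ))⁻¹ := by
    rw [inv_div, div_pow, div_pow]; field_simp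
  rw [h2]
  exact inv_anti₀ (by positivity) h

lemma fn_le (n k : ℕ) {q t : ℝ} (hq : 0 < q) (ht : 0 < t) :
    fn n q t ≤ ((n + k)! : ℝ) * (4 / q) ^ (n + k) * (Real.exp (-t) * t ^ k) := by
  unfold fn
  have h := exp_le_fac (n + k) hq ht
  calc Real.exp (-t) * ((t ^ n)⁻¹ * Real.exp (-(q / (4 * t)))) ≤ Real.exp (-t) * ((t ^ n)⁻¹ * (((n + k)! : ℝ) * (4 * t / q) ^ (n + k))) := by gcongr
    _ = _ := by
      have : 4 * t / q = 4 / q * t := by ring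
      rw [this, mul_pow, pow_add t]
      field_simp

lemma exp_pow_int (k : ℕ) : IntegrableOn (fun t : ℝ => Real.exp (-t) * t ^ k) (Ioi 0) := by
  have h := Real.GammaIntegral_convergent (s := k + 1) (by positivity)
  refine h.congr_fun (fun t ht => ?_) measurableSet_Ioi
  simp only [add_sub_cancel_right, rpow_natCast]

lemma fn_meas (n : ℕ) (q : ℝ) : AEStronglyMeasurable (fn n q) (volume.restrict (Ioi 0)) := by
  have : Measurable (fn n q) := by unfold fn; fun_prop
  exact this.aestronglyMeasurable

lemma fn_int (n : ℕ) {q : ℝ} (hq : 0 < q) : IntegrableOn (fn n q) (Ioi 0) := by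
  refine ((exp_pow_int 0).const_mul ((((n + 0)! : ℕ) : ℝ) * (4 / q) ^ (n + 0))).mono' (fn_meas n q) ?_
  rw [ae_restrict_iff' measurableSet_Ioi]
  refine Eventually.of_forall fun t ht => ?_
  rw [Real.norm_of_nonneg (fn_pos n q ht).le]
  exact fn_le n 0 hq ht

lemma gn_pos (n : ℕ) {q : ℝ} (hq : 0 < q) : 0 < gn n q :=
  setIntegral_Ioi_pos (fn_int n hq) (fun t ht => fn_pos n q ht)

lemma gn_decay (n : ℕ) : ∃ C, 0 ≤ C ∧ ∀ q, 0 < q → gn n q ≤ C / q ^ (n + 3) := by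
  refine ⟨((n + 3)! : ℝ) * 4 ^ (n + 3) * ∫ t in Ioi (0:ℝ), Real.exp (-t) * t ^ 3, ?_, ?_⟩
  · have : 0 ≤ ∫ t in Ioi (0:ℝ), Real.exp (-t) * t ^ 3 :=
      setIntegral_nonneg measurableSet_Ioi fun t (ht : 0 < t) => by positivity
    positivity
  · intro q hq
    have : gn n q ≤ ∫ t in Ioi (0:ℝ), ((n + 3)! : ℝ) * (4 / q) ^ (n + 3) * (Real.exp (-t) * t ^ 3) :=
      setIntegral_mono_on (fn_int n hq) ((exp_pow_int 3).const_mul _) measurableSet_Ioi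
        (fun t ht => fn_le n 3 hq ht)
    rw [integral_const_mul] at this
    refine this.trans (le_of_eq ?_)
    rw [div_pow]; field_simp

lemma gn_deriv (n : ℕ) {q : ℝ} (hq : 0 < q) : HasDerivAt (gn n) (-(1 / 4) * gn (n + 1) q) q := by
  have h := hasDerivAt_integral_of_dominated_loc_of_deriv_le (μ := volume.restrict (Ioi (0:ℝ)))
    (F := fun q t => fn n q t) (F' := fun q t => -(1 / 4) * fn (n + 1) q t) (x₀ := q)
    (s := Ioi (q / 2)) (bound := fun t => (((n + 1 + 0)! : ℕ) : ℝ) * (4 / (q / 2)) ^ (n + 1 + 0) * (Real.exp (-t) * t ^ 0))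
    (Ioi_mem_nhds (half_lt_self hq)) (Eventually.of_forall fun q => fn_meas n q) (fn_int n hq)
    ((fn_meas (n+1) q).const_mul _) ?_ ((exp_pow_int 0).const_mul _) ?_
  · have h2 := h.2
    rw [integral_const_mul] at h2
    exact h2
  · rw [ae_restrict_iff' measurableSet_Ioi]
    refine Eventually.of_forall fun t ht s (hs : q / 2 < s) => ?_
    have hs0 : 0 < s := lt_trans (by positivity) hs
    have h0 := fn_pos (n+1) s ht
    rw [norm_mul, Real.norm_of_nonneg h0.le]
    have h1 := fn_le (n+1) 0 hs0 ht
    have ht' : (0:ℝ) < t := ht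
    have : ((n + 1 + 0)! : ℝ) * (4 / s) ^ (n + 1 + 0) * (Real.exp (-t) * t ^ 0) ≤
        (((n + 1 + 0)! : ℕ) : ℝ) * (4 / (q / 2)) ^ (n + 1 + 0) * (Real.exp (-t) * t ^ 0) := by
      gcongr
    have h3 : ‖(-(1/4) : ℝ)‖ ≤ 1 := by norm_num
    nlinarith
  · rw [ae_restrict_iff' measurableSet_Ioi]
    refine Eventually.of_forall fun t ht s _ => ?_
    have ht' : (0:ℝ) < t := ht
    unfold fn
    have h1 : HasDerivAt (fun s : ℝ => -(s / (4 * t))) (-(1 / (4 * t))) s := ((hasDerivAt_id s).div_const (4 * t)).neg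
    have := ((h1.exp).const_mul ((t ^ n)⁻¹)).const_mul (Real.exp (-t))
    refine this.congr_deriv ?_
    rw [pow_succ]; field_simp

lemma gn_rel (n : ℕ) {q : ℝ} (hq : 0 < q) : gn n q = -(n:ℝ) * gn (n + 1) q + q / 4 * gn (n + 2) q := by
  have hF : ∀ t ∈ Ioi (0:ℝ), HasDerivAt (fn n q) (-fn n q t + (-(n:ℝ) * fn (n + 1) q t + q / 4 * fn (n + 2) q t)) t := by
    intro t ht
    have ht' : (0:ℝ) < t := ht
    unfold fn
    have h1 : HasDerivAt (fun t : ℝ => -(q / (4 * t))) (q / (4 * t ^ 2)) t := by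
      have := (((hasDerivAt_id t).const_mul 4).inv (by simp; positivity)).const_mul q |>.neg
      refine (this.congr_deriv ?_).congr_of_eventuallyEq ?_
      · simp only [id]; field_simp
      · exact Eventually.of_forall fun x => by simp [div_eq_mul_inv]
    have h2 : HasDerivAt (fun t : ℝ => (t ^ n)⁻¹) (-(n:ℝ) * (t ^ (n + 1))⁻¹) t := by
      have := (hasDerivAt_pow n t).inv (by positivity)
      refine this.congr_deriv ?_
      rcases n with _ | n
      · simp
      · rw [Nat.add_sub_cancel]; field_simp; ring
    have h3 : HasDerivAt (fun t : ℝ => Real.exp (-t)) (-Real.exp (-t)) t := by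
      simpa using (hasDerivAt_neg t).exp
    have := h3.mul (h2.mul h1.exp)
    refine this.congr_deriv ?_
    simp only [Pi.mul_apply]
    rw [pow_add t n 2, pow_succ]
    field_simp
  have hi : IntegrableOn (fun t => -fn n q t + (-(n:ℝ) * fn (n + 1) q t + q / 4 * fn (n + 2) q t)) (Ioi 0) :=
    (fn_int n hq).neg.add (((fn_int (n+1) hq).const_mul _).add ((fn_int (n+2) hq).const_mul _))
  have l0 : Tendsto (fn n q) (𝓝[>] 0) (𝓝 0) := by
    have hb : Tendsto (fun t : ℝ => ((n + 1)! : ℝ) * (4 / q) ^ (n + 1) * (Real.exp (-t) * t ^ 1)) (𝓝[>] 0) (𝓝 0) := by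
      have : Continuous fun t : ℝ => ((n + 1)! : ℝ) * (4 / q) ^ (n + 1) * (Real.exp (-t) * t ^ 1) := by fun_prop
      have h := this.tendsto 0
      simp only [neg_zero, Real.exp_zero, pow_one, mul_zero] at h
      simp only [pow_one]
      exact h.mono_left nhdsWithin_le_nhds
    refine squeeze_zero' ?_ ?_ hb
    · filter_upwards [self_mem_nhdsWithin] with t ht using (fn_pos n q ht).le
    · filter_upwards [self_mem_nhdsWithin] with t ht using fn_le n 1 hq ht
  have l1 : Tendsto (fn n q) atTop (𝓝 0) := by
    have hb : Tendsto (fun t : ℝ => ((n + 0)! : ℝ) * (4 / q) ^ (n + 0) * (Real.exp (-t) * t ^ 0)) atTop (𝓝 0) := by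
      have := (Real.tendsto_exp_neg_atTop_nhds_zero).const_mul (((n + 0)! : ℝ) * (4 / q) ^ (n + 0))
      simpa using this
    refine squeeze_zero' ?_ ?_ hb
    · filter_upwards [eventually_gt_atTop 0] with t ht using (fn_pos n q ht).le
    · filter_upwards [eventually_gt_atTop 0] with t ht using fn_le n 0 hq ht
  have h := integral_Ioi_of_hasDerivAt_of_tendsto (a := 0) (f := Function.update (fn n q) 0 0) (f' := fun t => -fn n q t + (-(n:ℝ) * fn (n + 1) q t + q / 4 * fn (n + 2) q t)) (m := 0) ?_ ?_ hi ?_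
  · rw [Function.update_self, sub_zero] at h
    have e1 : IntegrableOn (fun t => -(n:ℝ) * fn (n + 1) q t) (Ioi 0) := (fn_int (n+1) hq).const_mul _
    have e2 : IntegrableOn (fun t => q / 4 * fn (n + 2) q t) (Ioi 0) := (fn_int (n+2) hq).const_mul _
    have e3 : IntegrableOn (fun t => -(n:ℝ) * fn (n + 1) q t + q / 4 * fn (n + 2) q t) (Ioi 0) := e1.add e2
    have e4 : IntegrableOn (fun t => -fn n q t) (Ioi 0) := (fn_int n hq).neg
    rw [integral_add e4 e3, integral_add e1 e2, integral_neg, integral_const_mul, integral_const_mul] at h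
    unfold gn
    linarith
  · have : ContinuousWithinAt (Function.update (fn n q) 0 0) (Ioi 0) 0 := by
      rw [ContinuousWithinAt, Function.update_self]
      refine l0.congr' ?_
      filter_upwards [self_mem_nhdsWithin] with t ht
      rw [Function.update_of_ne (ne_of_gt ht)]
    rw [← continuousWithinAt_insert_self] at this
    simpa using this
  · intro t ht
    refine (hF t ht).congr_of_eventuallyEq ?_
    filter_upwards [Ioi_mem_nhds ht] with s hs
    rw [Function.update_of_ne (ne_of_gt hs)]
  · refine l1.congr' ?_
    filter_upwards [eventually_gt_atTop 0] with t ht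
    rw [Function.update_of_ne (ne_of_gt ht)]

lemma gn2_ode {q : ℝ} (hq : 0 < q) : HasDerivAt (fun q => 4 * q ^ 2 * (-(1 / 4) * gn 3 q)) (q * gn 2 q) q := by
  have h := ((hasDerivAt_pow 2 q).const_mul 4).mul ((gn_deriv 3 hq).const_mul (-(1/4)))
  refine h.congr_deriv ?_
  rw [gn_rel 2 hq]
  simp only [Nat.cast_ofNat, Nat.add_one_sub_one, pow_one]
  ring

/-- logarithmic substitution -/
lemma log_subst {c : ℝ} (hc : 0 < c) (F : ℝ → ℝ) :
    ∫ t in Ioi (0:ℝ), F t = ∫ s : ℝ, (c * Real.exp s) * F (c * Real.exp s) := by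
  have him : (fun s : ℝ => c * Real.exp s) '' univ = Ioi 0 := by
    ext t
    simp only [image_univ, mem_range, mem_Ioi]
    constructor
    · rintro ⟨s, rfl⟩; positivity
    · intro ht; exact ⟨Real.log (t / c), by rw [Real.exp_log (by positivity)]; field_simp⟩
  have h := integral_image_eq_integral_abs_deriv_smul (s := univ) (f := fun s : ℝ => c * Real.exp s)
    (f' := fun s => c * Real.exp s) MeasurableSet.univ
    (fun s _ => ((Real.hasDerivAt_exp s).const_mul c).hasDerivWithinAt)
    (fun x _ y _ hxy => Real.exp_injective (mul_left_cancel₀ hc.ne' hxy)) F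
  rw [him] at h
  rw [h, setIntegral_univ]
  congr 1; ext s
  rw [abs_of_pos (by positivity), smul_eq_mul]

lemma subst_fn (n : ℕ) {r : ℝ} (hr : 0 < r) (s : ℝ) :
    (r / 2 * Real.exp s) * fn n (r ^ 2) (r / 2 * Real.exp s) =
      (r / 2 * Real.exp s) * ((r / 2 * Real.exp s) ^ n)⁻¹ * Real.exp (-(r * Real.cosh s)) := by
  unfold fn
  have : Real.exp (-(r * Real.cosh s)) = Real.exp (-(r / 2 * Real.exp s)) * Real.exp (-(r ^ 2 / (4 * (r / 2 * Real.exp s)))) := by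
    rw [← Real.exp_add, Real.cosh_eq, Real.exp_neg s]
    congr 1
    field_simp
    ring
  rw [this]; ring

lemma sym_int {f : ℝ → ℝ} (hf : Integrable f) (he : ∀ s, f (-s) = f s) : ∫ s, f s = 2 * ∫ s in Ioi (0:ℝ), f s := by
  rw [← intervalIntegral.integral_Iic_add_Ioi (b := 0) hf.integrableOn hf.integrableOn]
  have h := integral_comp_neg_Iic (0:ℝ) f
  simp only [he, neg_zero] at h
  rw [h]; ring

lemma log_subst_int {c : ℝ} (hc : 0 < c) (F : ℝ → ℝ) :
    IntegrableOn F (Ioi (0:ℝ)) ↔ Integrable fun s : ℝ => (c * Real.exp s) * F (c * Real.exp s) := by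
  have him : (fun s : ℝ => c * Real.exp s) '' univ = Ioi 0 := by
    ext t
    simp only [image_univ, mem_range, mem_Ioi]
    constructor
    · rintro ⟨s, rfl⟩; positivity
    · intro ht; exact ⟨Real.log (t / c), by rw [Real.exp_log (by positivity)]; field_simp⟩
  have h := integrableOn_image_iff_integrableOn_abs_deriv_smul (s := univ) (f := fun s : ℝ => c * Real.exp s)
    (f' := fun s => c * Real.exp s) MeasurableSet.univ
    (fun s _ => ((Real.hasDerivAt_exp s).const_mul c).hasDerivWithinAt)
    (fun x _ y _ hxy => Real.exp_injective (mul_left_cancel₀ hc.ne' hxy)) F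
  rw [him] at h
  rw [h, integrableOn_univ]
  have : ∀ s : ℝ, |c * Real.exp s| • F (c * Real.exp s) = (c * Real.exp s) * F (c * Real.exp s) := by
    intro s
    rw [abs_of_pos (by positivity), smul_eq_mul]
  simp_rw [this]

lemma K0_gn {r : ℝ} (hr : 0 < r) : gn 1 (r ^ 2) = 2 * K0 r := by
  have hc : 0 < r / 2 := by positivity
  have hi := (log_subst_int hc _).1 (fn_int 1 (by positivity : 0 < r ^ 2))
  unfold gn K0
  rw [log_subst hc]
  simp_rw [subst_fn 1 hr] at hi ⊢
  have e : ∀ s : ℝ, (r / 2 * Real.exp s) * ((r / 2 * Real.exp s) ^ 1)⁻¹ * Real.exp (-(r * Real.cosh s)) = Real.exp (-(r * Real.cosh s)) := by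
    intro s
    rw [pow_one, mul_inv_cancel₀ (by positivity), one_mul]
  simp_rw [e] at hi ⊢
  exact sym_int hi (fun s => by rw [Real.cosh_neg])

lemma K1_gn {r : ℝ} (hr : 0 < r) : gn 2 (r ^ 2) = 4 / r * K1 r := by
  have hc : 0 < r / 2 := by positivity
  have hi := (log_subst_int hc _).1 (fn_int 2 (by positivity : 0 < r ^ 2))
  unfold gn K1
  rw [log_subst hc]
  simp_rw [subst_fn 2 hr] at hi ⊢
  have e : ∀ s : ℝ, (r / 2 * Real.exp s) * ((r / 2 * Real.exp s) ^ 2)⁻¹ * Real.exp (-(r * Real.cosh s)) =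
      2 / r * (Real.exp (-s) * Real.exp (-(r * Real.cosh s))) := by
    intro s
    rw [Real.exp_neg s]; field_simp
  simp_rw [e] at hi ⊢
  rw [integral_const_mul]
  have hi1 : Integrable fun s => Real.exp (-s) * Real.exp (-(r * Real.cosh s)) := by
    have h2 := hi.const_mul (r / 2)
    refine h2.congr (Eventually.of_forall fun s => ?_)
    field_simp
  have hi2 : Integrable fun s => Real.exp s * Real.exp (-(r * Real.cosh s)) := by
    have := hi1.comp_neg
    refine this.congr (Eventually.of_forall fun s => ?_)
    simp
  have e2 : ∫ s, Real.exp (-s) * Real.exp (-(r * Real.cosh s)) = ∫ s, Real.exp s * Real.exp (-(r * Real.cosh s)) := by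
    rw [← integral_neg_eq_self]
    simp
  have hi3 : Integrable fun s => Real.exp (-(r * Real.cosh s)) * Real.cosh s := by
    have := (hi1.add hi2).div_const 2
    refine this.congr (Eventually.of_forall fun s => ?_)
    simp only [Pi.add_apply]
    rw [Real.cosh_eq s]; ring
  have e3 : ∫ s, Real.exp (-(r * Real.cosh s)) * Real.cosh s = ∫ s, Real.exp (-s) * Real.exp (-(r * Real.cosh s)) := by
    have : ∀ s, Real.exp (-(r * Real.cosh s)) * Real.cosh s = 2⁻¹ * (Real.exp (-s) * Real.exp (-(r * Real.cosh s))) + 2⁻¹ * (Real.exp s * Real.exp (-(r * Real.cosh s))) := by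
      intro s; 
      have := Real.cosh_eq s
      linear_combination Real.exp (-(r * Real.cosh s)) * this
    simp_rw [this]
    rw [integral_add (hi1.const_mul _) (hi2.const_mul _), integral_const_mul, integral_const_mul, ← e2]
    ring
  rw [← e3, sym_int hi3 (fun s => by rw [Real.cosh_neg])]
  ring

lemma gq_gn (q : ℝ) : gq q = (16 * π ^ 2)⁻¹ * gn 2 q := by
  unfold gq gn
  rw [← integral_const_mul]
  congr 1; ext t
  unfold hk fn
  rw [mul_pow, mul_inv, mul_pow, mul_inv]
  rw [mul_inv]
  norm_num
  ring

/-- `v(q) = gn 2 q`, `K1 r = (r/4) v(r²)`. -/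
lemma K1_eq {r : ℝ} (hr : 0 < r) : K1 r = r / 4 * gn 2 (r ^ 2) := by
  rw [K1_gn hr]; field_simp

lemma K1_deriv {r : ℝ} (hr : 0 < r) :
    deriv K1 r = (gn 2 (r ^ 2) + 2 * r ^ 2 * (-(1/4) * gn 3 (r ^ 2))) / 4 := by
  have e : K1 =ᶠ[𝓝 r] fun r => r / 4 * gn 2 (r ^ 2) := by
    filter_upwards [Ioi_mem_nhds hr] with s hs using K1_eq hs
  rw [e.deriv_eq]
  have h1 : HasDerivAt (fun x : ℝ => x ^ 2) (2 * r) r := by simpa using hasDerivAt_pow 2 r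
  have h2 : HasDerivAt (gn 2 ∘ fun x => x ^ 2) (-(1 / 4) * gn (2 + 1) (r ^ 2) * (2 * r)) r :=
    HasDerivAt.comp (h₂ := gn 2) (h := fun x => x ^ 2) r (gn_deriv 2 (by positivity : (0:ℝ) < r ^ 2)) h1
  have h := ((hasDerivAt_id r).div_const 4).mul h2
  have := h.deriv
  have e2 : (fun r : ℝ => r / 4 * gn 2 (r ^ 2)) = ((fun x => id x / 4) * (gn 2 ∘ fun x => x ^ 2)) := rfl
  rw [e2, this]
  simp only [Function.comp, id]; ring

end LambPart13

section LambPart14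
open Set Topology

lemma inner_zero {h : ℝ → ℝ} {k α : ℝ} (hc : Continuous h) (h0 : h 0 = 0)
    (hk : 0 < k)
    (hd : ∀ q, 0 < q → q ≤ α → HasDerivAt h ((-(k ^ 2) * ∫ s in (0:ℝ)..q, s * h s) / (4 * q ^ 2)) q) :
    ∀ q, 0 < q → q < α → h q = 0 := by
  have hcs : Continuous fun s => s * h s := continuous_id.mul hc
  obtain ⟨M, hM⟩ : ∃ M, ∀ q ∈ Icc 0 α, |h q| ≤ M :=
    (isCompact_Icc.exists_bound_of_continuousOn hc.continuousOn)
  have hHd : ∀ q, HasDerivAt (fun q => ∫ s in (0:ℝ)..q, s * h s) (q * h q) q := fun q =>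
    intervalIntegral.integral_hasDerivAt_right (hcs.intervalIntegrable _ _)
      (hcs.stronglyMeasurableAtFilter _ _) hcs.continuousAt
  set H : ℝ → ℝ := fun q => ∫ s in (0:ℝ)..q, s * h s with hH
  have hHb : ∀ q, 0 < q → q ≤ α → |H q| ≤ M * q ^ 2 := by
    intro q hq hqa
    have := intervalIntegral.norm_integral_le_of_norm_le_const (a := 0) (b := q) (f := fun s => s * h s)
      (C := q * M) (by
        intro s hs
        rw [uIoc_of_le hq.le] at hs
        rw [norm_mul, Real.norm_of_nonneg hs.1.le, Real.norm_eq_abs]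
        exact mul_le_mul hs.2 (hM s ⟨hs.1.le, hs.2.trans hqa⟩) (abs_nonneg _) hq.le)
    rw [sub_zero, abs_of_pos hq] at this
    calc |H q| ≤ q * M * q := this
      _ = _ := by ring
  set d : ℝ → ℝ := fun q => (-(k ^ 2) * H q) / (4 * q ^ 2) with hdd
  have hd' : ∀ q, 0 < q → HasDerivAt d (-(k ^ 2) * h q / (4 * q) - 2 * d q / q) q := by
    intro q hq
    have h1 := ((hHd q).const_mul (-(k ^ 2))).div ((hasDerivAt_pow 2 q).const_mul 4) (by positivity)
    refine h1.congr_deriv ?_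
    simp only [hdd, hH]
    field_simp
    norm_num
    ring
  set e : ℝ → ℝ := fun q => 4 * (q * (d q) ^ 2) + k ^ 2 * (h q) ^ 2 with he
  have hed : ∀ q, 0 < q → q ≤ α → HasDerivAt e (-12 * d q ^ 2) q := by
    intro q hq hqa
    have h1 : HasDerivAt h (d q) q := hd q hq hqa
    have h2 := (((hasDerivAt_id q).mul ((hd' q hq).pow 2)).const_mul 4).add ((h1.pow 2).const_mul (k ^ 2))
    refine h2.congr_deriv ?_
    simp only [id, Pi.pow_apply]
    norm_num
    field_simp
    ring
  have hanti : AntitoneOn e (Ioo 0 α) := by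
    refine antitoneOn_of_deriv_nonpos (convex_Ioo 0 α) ?_ ?_ ?_
    · intro q hq; exact (hed q hq.1 hq.2.le).continuousAt.continuousWithinAt
    · rw [interior_Ioo]; intro q hq; exact (hed q hq.1 hq.2.le).differentiableAt.differentiableWithinAt
    · rw [interior_Ioo]; intro q hq; rw [(hed q hq.1 hq.2.le).deriv]; nlinarith [sq_nonneg (d q)]
  intro q hq hqa
  have hlim : Tendsto e (𝓝[>] 0) (𝓝 0) := by
    have hb : Tendsto (fun q : ℝ => 4 * (q * (k ^ 2 * M) ^ 2) + k ^ 2 * (h q) ^ 2) (𝓝[>] 0) (𝓝 0) := by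
      have : Continuous fun q : ℝ => 4 * (q * (k ^ 2 * M) ^ 2) + k ^ 2 * (h q) ^ 2 := by fun_prop
      have h3 := this.tendsto 0
      simp only [h0] at h3
      norm_num at h3
      exact h3.mono_left nhdsWithin_le_nhds
    refine squeeze_zero' ?_ ?_ hb
    · filter_upwards [self_mem_nhdsWithin] with s hs
      have : (0:ℝ) < s := hs
      simp only [he]; positivity
    · filter_upwards [Ioo_mem_nhdsGT (hq.trans hqa)] with s hs
      have hs0 := hs.1
      have : |d s| ≤ k ^ 2 * M := by
        simp only [hdd]
        rw [abs_div, abs_mul, abs_neg, abs_of_pos (by positivity : 0 < k ^ 2), abs_of_pos (by positivity : 0 < 4 * s ^ 2), div_le_iff₀ (by positivity)]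
        have h4 := hHb s hs0 hs.2.le
        have hM0 : 0 ≤ M := (abs_nonneg _).trans (hM s ⟨hs0.le, hs.2.le⟩)
        have : k ^ 2 * |H s| ≤ k ^ 2 * (M * s ^ 2) := by gcongr
        have : 0 ≤ k ^ 2 * (M * s ^ 2) := by positivity
        linarith
      have h5 : (d s) ^ 2 ≤ (k ^ 2 * M) ^ 2 := by
        rw [← sq_abs (d s)]; gcongr
      simp only [he]
      gcongr
  have hle : e q ≤ 0 := by
    refine ge_of_tendsto hlim ?_
    filter_upwards [Ioo_mem_nhdsGT hq] with s hs
    exact hanti ⟨hs.1, hs.2.trans hqa⟩ ⟨hq, hqa⟩ hs.2.le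
  simp only [he] at hle
  have h6 : 0 ≤ 4 * (q * (d q) ^ 2) := by positivity
  have h7 : k ^ 2 * (h q) ^ 2 ≤ 0 := by linarith
  have h8 : (h q) ^ 2 ≤ 0 := by
    by_contra hh
    push Not at hh
    have : 0 < k ^ 2 * (h q) ^ 2 := by positivity
    linarith
  exact pow_eq_zero_iff (two_ne_zero) |>.1 (le_antisymm h8 (sq_nonneg _))

lemma aSet_iff {lam : ℝ} (hl : 1 < lam) {t : ℝ} (ht : 0 < t) :
    t ∈ aSet lam ↔ jq (√(lam - 1)) (t ^ 2) ≠ 0 ∧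
      (lam - 1) * (-(1/4) * gn 3 (t ^ 2)) * jq (√(lam - 1)) (t ^ 2) + gn 2 (t ^ 2) * jq' (√(lam - 1)) (t ^ 2) = 0 := by
  have hk : 0 < √(lam - 1) := Real.sqrt_pos.2 (by linarith)
  have hk2 : √(lam - 1) ^ 2 = lam - 1 := Real.sq_sqrt (by linarith)
  set k := √(lam - 1)
  have hl' : lam = k ^ 2 + 1 := by linarith
  have hv := gn_pos 2 (by positivity : 0 < t ^ 2)
  unfold aSet
  rw [mem_ofPred_eq, J1_jq, J1_deriv hk.ne', K1_deriv ht, K1_eq ht, ← hk2, Real.sqrt_sq hk.le]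
  have hJ : k * t / 2 * jq k (t ^ 2) ≠ 0 ↔ jq k (t ^ 2) ≠ 0 := by
    have : k * t / 2 ≠ 0 := by positivity
    simp [this]
  change 0 < t ∧ k * t / 2 * jq k (t ^ 2) ≠ 0 ∧ _ ↔ _
  rw [hJ]
  simp only [ht, true_and]
  refine and_congr_right fun hj => ?_
  set j := jq k (t ^ 2)
  set j' := jq' k (t ^ 2)
  set v := gn 2 (t ^ 2)
  set v' := -(1/4) * gn 3 (t ^ 2)
  have key : t * ((v + 2 * t ^ 2 * v') / 4 / (t / 4 * v) + 1 / k * ((j + 2 * t ^ 2 * j') / 2 / (k * t / 2 * j))) - lam / k ^ 2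
      = 2 * t ^ 2 / (k ^ 2 * v * j) * (k ^ 2 * v' * j + v * j') := by
    rw [hl']; field_simp; ring
  rw [← sub_eq_zero]
  change t * ((v + 2 * t ^ 2 * v') / 4 / (t / 4 * v) + 1 / k * ((j + 2 * t ^ 2 * j') / 2 / (k * t / 2 * j))) - lam / k ^ 2 = 0 ↔ _
  rw [key, mul_eq_zero]
  have : 2 * t ^ 2 / (k ^ 2 * v * j) ≠ 0 := by
    have := hv.ne'
    positivity
  simp [this]

lemma lamb_match {lam W : ℝ} (hl : 1 < lam) (hW : 0 < W) {U : ℝ → ℝ} (hc : Continuous U)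
    (ha : Antitone U) (h0 : ∀ q, 0 ≤ U q)
    (hd : ∀ q, 0 < q → HasDerivAt U ((∫ s in (0:ℝ)..q, s * (U s - lam * max (U s - W) 0)) / (4 * q ^ 2)) q)
    (hex : ∃ q, 0 < q ∧ W < U q) (hex2 : ∃ q, U q ≤ W) :
    ∀ x : ℝ × ℝ, 0 < x.2 → PsiL lam W x = x.2 * U (rad x ^ 2) := by
  have hk : 0 < √(lam - 1) := Real.sqrt_pos.2 (by linarith)
  have hk2 : √(lam - 1) ^ 2 = lam - 1 := Real.sq_sqrt (by linarith)
  have hl0 : 0 < lam := by linarith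
  set k := √(lam - 1) with hkdef
  -- α
  obtain ⟨α, hα0, hin, hout, hWα⟩ : ∃ α, 0 < α ∧ (∀ q < α, W < U q) ∧ (∀ q, α ≤ q → U q ≤ W) ∧ U α = W := by
    set S := {q | W < U q}
    obtain ⟨q1, hq1, hq1W⟩ := hex
    obtain ⟨q2, hq2⟩ := hex2
    have hbd : BddAbove S := ⟨q2, fun s (hs : W < U s) => by
      by_contra hh; push Not at hh
      have := ha hh.le; linarith⟩
    have hne : S.Nonempty := ⟨q1, hq1W⟩
    have hlt : ∀ q < sSup S, W < U q := by
      intro q hq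
      obtain ⟨s, hs, hqs⟩ := exists_lt_of_lt_csSup hne hq
      exact lt_of_lt_of_le hs (ha hqs.le)
    have hgt : ∀ q > sSup S, U q ≤ W := by
      intro q hq
      by_contra hh; push Not at hh
      exact absurd (le_csSup hbd (show q ∈ S from hh)) (not_le.2 hq)
    have hle : U (sSup S) ≤ W := by
      have : Tendsto U (𝓝[>] (sSup S)) (𝓝 (U (sSup S))) := hc.continuousAt.tendsto.mono_left nhdsWithin_le_nhds
      refine le_of_tendsto this ?_
      filter_upwards [self_mem_nhdsWithin] with s hs using hgt s hs
    have hge : W ≤ U (sSup S) := by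
      have : Tendsto U (𝓝[<] (sSup S)) (𝓝 (U (sSup S))) := hc.continuousAt.tendsto.mono_left nhdsWithin_le_nhds
      refine ge_of_tendsto this ?_
      filter_upwards [self_mem_nhdsWithin] with s hs using (hlt s hs).le
    refine ⟨sSup S, lt_of_lt_of_le hq1 (le_csSup hbd hq1W), hlt, fun q hq => ?_, le_antisymm hle hge⟩
    rcases hq.eq_or_lt with h | h
    · rw [← h]; exact hle
    · exact hgt q h
  set R : ℝ → ℝ := fun s => s * (U s - lam * max (U s - W) 0) with hR
  have hRc : Continuous R := by simp only [hR]; fun_prop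
  set P : ℝ → ℝ := fun q => ∫ s in (0:ℝ)..q, R s with hP
  have hPd : ∀ q, HasDerivAt P (R q) q := fun q =>
    intervalIntegral.integral_hasDerivAt_right (hRc.intervalIntegrable _ _)
      (hRc.stronglyMeasurableAtFilter _ _) hRc.continuousAt
  have hUd : ∀ q, 0 < q → HasDerivAt U (P q / (4 * q ^ 2)) q := hd
  -- inner
  set A := U 0 - lam * W / k ^ 2 with hA
  have hjint : ∀ q, -(k ^ 2) * ∫ s in (0:ℝ)..q, s * jq k s = 4 * q ^ 2 * jq' k q := by
    intro q
    have hcj : Continuous fun s => -(k ^ 2 * s * jq k s) := by have := jq_cont k; fun_prop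
    have := intervalIntegral.integral_eq_sub_of_hasDerivAt (a := 0) (b := q) (fun s _ => jq_ode k s) (hcj.intervalIntegrable _ _)
    rw [← intervalIntegral.integral_const_mul]
    have e : ∀ s, -(k ^ 2) * (s * jq k s) = -(k ^ 2 * s * jq k s) := fun s => by ring
    simp_rw [e]; rw [this]; ring
  have hz := inner_zero (h := fun q => U q - lam * W / k ^ 2 - A * jq k q) (k := k) (α := α)
    (by have := jq_cont k; fun_prop) (by simp only [jq_zero, hA]; ring) hk ?_
  swap
  · intro q hq hqa
    have h1 := ((hUd q hq).sub_const (lam * W / k ^ 2)).sub ((jq_deriv k q).const_mul A)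
    refine h1.congr_deriv ?_
    have e1 : P q = ∫ s in (0:ℝ)..q, (-(k ^ 2) * (s * (U s - lam * W / k ^ 2))) := by
      simp only [hP]
      apply intervalIntegral.integral_congr
      intro s hs
      rw [uIcc_of_le hq.le] at hs
      have : W ≤ U s := by rw [← hWα]; exact ha (hs.2.trans hqa)
      simp only [hR]
      rw [max_eq_left (by linarith)]
      have : lam = k ^ 2 + 1 := by linarith
      rw [this]; field_simp; ring
    have e2 : ∫ s in (0:ℝ)..q, s * (U s - lam * W / k ^ 2 - A * jq k s) =
        (∫ s in (0:ℝ)..q, s * (U s - lam * W / k ^ 2)) - A * ∫ s in (0:ℝ)..q, s * jq k s := by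
      have hcj := jq_cont k
      rw [← intervalIntegral.integral_const_mul, ← intervalIntegral.integral_sub]
      · congr 1; ext s; ring
      · exact Continuous.intervalIntegrable (by fun_prop) _ _
      · exact Continuous.intervalIntegrable (by fun_prop) _ _
    rw [e2, e1, intervalIntegral.integral_const_mul]
    have := hjint q
    have h9 : jq' k q = (-(k ^ 2) * ∫ s in (0:ℝ)..q, s * jq k s) / (4 * q ^ 2) := by
      rw [this]; field_simp
    rw [h9]; ring
  have hUin : ∀ q, 0 ≤ q → q ≤ α → U q = A * jq k q + lam * W / k ^ 2 := by
    have hcl : IsClosed {q | U q = A * jq k q + lam * W / k ^ 2} := isClosed_eq hc (by have := jq_cont k; fun_prop)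
    have : Ioo 0 α ⊆ {q | U q = A * jq k q + lam * W / k ^ 2} := fun q hq => by
      have := hz q hq.1 hq.2
      simp only [mem_ofPred_eq]; linarith
    have := closure_minimal this hcl
    rw [closure_Ioo hα0.ne] at this
    intro q h1 h2; exact this ⟨h1, h2⟩
  have hPj : ∀ q, 0 < q → q < α → P q = 4 * q ^ 2 * (A * jq' k q) := by
    intro q hq hqa
    have h1 : HasDerivAt U (A * jq' k q) q := by
      refine ((jq_deriv k q).const_mul A |>.add_const (lam * W / k ^ 2)).congr_of_eventuallyEq ?_
      filter_upwards [Ioo_mem_nhds hq hqa] with s hs using hUin s hs.1.le hs.2.le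
    have := (hUd q hq).unique h1
    rw [← this]; field_simp
  have hPα : P α = 4 * α ^ 2 * (A * jq' k α) := by
    have hcl : IsClosed {q | P q = 4 * q ^ 2 * (A * jq' k q)} :=
      isClosed_eq (continuous_iff_continuousAt.2 fun q => (hPd q).continuousAt) (by have := jq'_cont k; fun_prop)
    have : Ioo 0 α ⊆ {q | P q = 4 * q ^ 2 * (A * jq' k q)} := fun q hq => hPj q hq.1 hq.2
    have := closure_minimal this hcl
    rw [closure_Ioo hα0.ne] at this
    exact this ⟨hα0.le, le_rfl⟩
  -- outer
  set v := gn 2 with hv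
  set v' : ℝ → ℝ := fun q => -(1/4) * gn 3 q with hv'
  have hvd : ∀ q, 0 < q → HasDerivAt v (v' q) q := fun q hq => gn_deriv 2 hq
  have hvode : ∀ q, 0 < q → HasDerivAt (fun q => 4 * q ^ 2 * v' q) (q * v q) q := fun q hq => gn2_ode hq
  have hvp : ∀ q, 0 < q → 0 < v q := fun q hq => gn_pos 2 hq
  have hv'n : ∀ q, 0 < q → v' q < 0 := fun q hq => by have := gn_pos 3 hq; simp only [hv']; linarith
  set Wr : ℝ → ℝ := fun q => U q * (4 * q ^ 2 * v' q) - P q * v q with hWr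
  have hWrd : ∀ q, α ≤ q → HasDerivAt Wr 0 q := by
    intro q hq
    have hq0 : 0 < q := lt_of_lt_of_le hα0 hq
    have h1 := ((hUd q hq0).mul (hvode q hq0)).sub ((hPd q).mul (hvd q hq0))
    refine h1.congr_deriv ?_
    have : R q = q * U q := by
      simp only [hR]; rw [max_eq_right (by linarith [hout q hq])]; ring
    rw [this]; field_simp; ring
  have hWrc : ∀ q, α ≤ q → Wr q = Wr α := by
    intro q hq
    refine constant_of_has_deriv_right_zero (f := Wr) (a := α) (b := q) ?_ ?_ q ⟨hq, le_rfl⟩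
    · intro s hs; exact (hWrd s hs.1).continuousAt.continuousWithinAt
    · intro s hs; exact (hWrd s hs.1).hasDerivWithinAt
  have hWr0 : Wr α = 0 := by
    obtain ⟨C2, hC2, hb2⟩ := gn_decay 2
    obtain ⟨C3, hC3, hb3⟩ := gn_decay 3
    have hPb : ∀ q, 0 < q → |P q| ≤ (lam + 1) * (U 0) * q ^ 2 := by
      intro q hq
      have := intervalIntegral.norm_integral_le_of_norm_le_const (a := 0) (b := q) (f := R)
        (C := q * ((lam + 1) * U 0)) (by
          intro s hs
          rw [uIoc_of_le hq.le] at hs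
          simp only [hR]
          rw [norm_mul, Real.norm_of_nonneg hs.1.le, Real.norm_eq_abs]
          have hs0 := h0 s
          have hs1 := ha hs.1.le
          have h3 : 0 ≤ max (U s - W) 0 := le_max_right _ _
          have h4 : max (U s - W) 0 ≤ U 0 := max_le (by linarith) (by linarith)
          have h5 : lam * max (U s - W) 0 ≤ lam * U 0 := by gcongr
          have h6 : 0 ≤ lam * max (U s - W) 0 := by positivity
          have : |U s - lam * max (U s - W) 0| ≤ (lam + 1) * U 0 := by
            rw [abs_le]; constructor <;> nlinarith
          exact mul_le_mul hs.2 this (abs_nonneg _) hq.le)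
      rw [sub_zero, abs_of_pos hq] at this
      calc |P q| ≤ q * ((lam + 1) * U 0) * q := this
        _ = _ := by ring
    have hU0 := h0 0
    have hlim : Tendsto (fun q : ℝ => (U 0 * C3 + (lam + 1) * U 0 * C2) / q) atTop (𝓝 0) :=
      tendsto_const_nhds.div_atTop tendsto_id
    have hlim2 : Tendsto Wr atTop (𝓝 0) := by
      refine squeeze_zero_norm' ?_ hlim
      filter_upwards [eventually_ge_atTop 1] with q hq
      have hq0 : 0 < q := by linarith
      rw [Real.norm_eq_abs]
      have g3 := gn_pos 3 hq0
      have g2 := gn_pos 2 hq0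
      have e1 : |U q * (4 * q ^ 2 * v' q)| ≤ U 0 * C3 / q := by
        have : U q * (4 * q ^ 2 * v' q) = -(U q * (q ^ 2 * gn 3 q)) := by simp only [hv']; ring
        rw [this, abs_neg, abs_of_nonneg (by have := h0 q; positivity)]
        have h1 := ha hq0.le
        have h2 : q ^ 2 * gn 3 q ≤ C3 / q := by
          calc q ^ 2 * gn 3 q ≤ q ^ 2 * (C3 / q ^ 6) := by gcongr; exact hb3 q hq0
            _ = C3 / q ^ 4 := by field_simp
            _ ≤ C3 / q := by gcongr; exact le_self_pow₀ hq (by norm_num)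
        calc U q * (q ^ 2 * gn 3 q) ≤ U 0 * (C3 / q) := by gcongr
          _ = _ := by ring
      have e2 : |P q * v q| ≤ (lam + 1) * U 0 * C2 / q := by
        rw [abs_mul, abs_of_pos (hvp q hq0)]
        calc |P q| * v q ≤ ((lam + 1) * U 0 * q ^ 2) * (C2 / q ^ 5) := by
              gcongr
              · exact hPb q hq0
              · exact hb2 q hq0
          _ = (lam + 1) * U 0 * C2 / q ^ 3 := by field_simp
          _ ≤ (lam + 1) * U 0 * C2 / q := by gcongr; exact le_self_pow₀ hq (by norm_num)
      calc |Wr q| ≤ |U q * (4 * q ^ 2 * v' q)| + |P q * v q| := abs_sub _ _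
        _ ≤ U 0 * C3 / q + (lam + 1) * U 0 * C2 / q := add_le_add e1 e2
        _ = _ := by ring
    have : Tendsto Wr atTop (𝓝 (Wr α)) := by
      refine tendsto_const_nhds.congr' ?_
      filter_upwards [eventually_ge_atTop α] with q hq using (hWrc q hq).symm
    exact tendsto_nhds_unique this hlim2
  have hUout : ∀ q, α ≤ q → U q = W / v α * v q := by
    have hr : ∀ q, α ≤ q → HasDerivAt (fun q => U q / v q) 0 q := by
      intro q hq
      have hq0 : 0 < q := lt_of_lt_of_le hα0 hq
      have h1 := (hUd q hq0).div (hvd q hq0) (hvp q hq0).ne'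
      refine h1.congr_deriv ?_
      have h2 : Wr q = 0 := by rw [hWrc q hq, hWr0]
      simp only [hWr] at h2
      have h3 : P q / (4 * q ^ 2) * v q - U q * v' q = 0 := by
        field_simp; linarith
      rw [h3, zero_div]
    intro q hq
    have := constant_of_has_deriv_right_zero (f := fun q => U q / v q) (a := α) (b := q)
      (fun s hs => (hr s hs.1).continuousAt.continuousWithinAt) (fun s hs => (hr s hs.1).hasDerivWithinAt) q ⟨hq, le_rfl⟩
    have h1 := hvp α hα0
    have h2 := hvp q (lt_of_lt_of_le hα0 hq)
    simp only [hWα] at this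
    rw [← this]; field_simp
  -- matching
  have hAj : A * jq k α = -(W / k ^ 2) := by
    have := hUin α hα0.le le_rfl
    rw [hWα] at this
    have e : lam * W / k ^ 2 = W + W / k ^ 2 := by
      have : lam = k ^ 2 + 1 := by linarith
      rw [this]; field_simp
    linarith
  have hA0 : A ≠ 0 := by
    intro h; rw [h] at hAj; 
    have : 0 < W / k ^ 2 := by positivity
    linarith
  have hj0 : jq k α ≠ 0 := by
    intro h; rw [h] at hAj; 
    have : 0 < W / k ^ 2 := by positivity
    linarith
  have hm : W * v' α = A * jq' k α * v α := by
    have := hWr0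
    simp only [hWr] at this
    rw [hWα, hPα] at this
    have h4 : 4 * α ^ 2 * (W * v' α - A * jq' k α * v α) = 0 := by linarith
    rcases mul_eq_zero.1 h4 with h | h
    · exact absurd h (by positivity)
    · linarith
  set N : ℝ → ℝ := fun q => k ^ 2 * v' q * jq k q + v q * jq' k q with hN
  have hNα : N α = 0 := by
    have h1 : A * N α = 0 := by
      simp only [hN]
      have : k ^ 2 * (A * jq k α) = -W := by rw [hAj]; field_simp
      linear_combination v' α * this - hm
    exact (mul_eq_zero.1 h1).resolve_left hA0
  have hsq : √α ^ 2 = α := Real.sq_sqrt hα0.le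
  have hleast : IsLeast (aSet lam) (√α) := by
    constructor
    · rw [aSet_iff hl (Real.sqrt_pos.2 hα0), hsq]
      refine ⟨hj0, ?_⟩
      rw [← hkdef, ← hk2]; exact hNα
    · intro b hb
      have hb0 : 0 < b := hb.1
      by_contra hh
      push Not at hh
      rw [aSet_iff hl hb0, ← hkdef, ← hk2] at hb
      obtain ⟨-, hNb⟩ := hb
      set β := b ^ 2 with hβ
      have hβ0 : 0 < β := by positivity
      have hβα : β < α := by
        have := pow_lt_pow_left₀ hh hb0.le two_ne_zero
        rwa [hsq] at this
      have hNβ : N β = 0 := hNb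
      have hAN : ∀ q, 0 < q → HasDerivAt (fun q => A * (4 * q ^ 2 * N q)) (4 * lam * q ^ 2 * (v' q * (A * jq' k q))) q := by
        intro q hq
        have h1 := ((((hvode q hq).mul (jq_deriv k q)).const_mul (k ^ 2)).add ((hvd q hq).mul (jq_ode k q))).const_mul A
        have h2 := h1.congr_deriv (g' := 4 * lam * q ^ 2 * (v' q * (A * jq' k q))) (by
          have : lam = k ^ 2 + 1 := by linarith
          rw [this]; ring)
        refine h2.congr_of_eventuallyEq (Eventually.of_forall fun s => ?_)
        simp only [hN, Pi.add_apply, Pi.mul_apply]; ring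
      have hj'n : ∀ q, 0 < q → q < α → A * jq' k q ≤ 0 := by
        intro q hq hqa
        have h1 : deriv U q ≤ 0 := ha.deriv_nonpos
        rw [(hUd q hq).deriv, hPj q hq hqa] at h1
        have : 4 * q ^ 2 * (A * jq' k q) / (4 * q ^ 2) = A * jq' k q := by field_simp
        linarith
      have hmono : MonotoneOn (fun q => A * (4 * q ^ 2 * N q)) (Icc β α) := by
        refine monotoneOn_of_deriv_nonneg (convex_Icc _ _) ?_ ?_ ?_
        · intro q hq; exact (hAN q (lt_of_lt_of_le hβ0 hq.1)).continuousAt.continuousWithinAt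
        · rw [interior_Icc]; intro q hq; exact (hAN q (hβ0.trans hq.1)).differentiableAt.differentiableWithinAt
        · rw [interior_Icc]; intro q hq
          have hq0 := hβ0.trans hq.1
          rw [(hAN q hq0).deriv]
          have := mul_nonneg_of_nonpos_of_nonpos (hv'n q hq0).le (hj'n q hq0 hq.2)
          positivity
      have hzero : ∀ q ∈ Icc β α, A * (4 * q ^ 2 * N q) = 0 := by
        intro q hq
        have h1 := hmono ⟨le_rfl, hβα.le⟩ hq hq.1
        have h2 := hmono hq ⟨hβα.le, le_rfl⟩ hq.2
        simp only [hNβ, hNα, mul_zero] at h1 h2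
        linarith
      have hj' : ∀ q ∈ Ioo β α, jq' k q = 0 := by
        intro q hq
        have hq0 := hβ0.trans hq.1
        have h1 := hAN q hq0
        have h2 : HasDerivAt (fun q => A * (4 * q ^ 2 * N q)) 0 q := by
          refine (hasDerivAt_const q (0:ℝ)).congr_of_eventuallyEq ?_
          filter_upwards [Ioo_mem_nhds hq.1 hq.2] with s hs using hzero s ⟨hs.1.le, hs.2.le⟩
        have h3 := h1.unique h2
        have h4 := (hv'n q hq0).ne
        have h5 : 4 * lam * q ^ 2 ≠ 0 := by positivity
        simpa [h4, h5, hA0] using h3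
      have hj : Ioo β α ⊆ {q | jq k q = 0} := by
        intro q hq
        have hq0 := hβ0.trans hq.1
        have h2 : HasDerivAt (fun q => 4 * q ^ 2 * jq' k q) 0 q := by
          refine (hasDerivAt_const q (0:ℝ)).congr_of_eventuallyEq ?_
          filter_upwards [Ioo_mem_nhds hq.1 hq.2] with s hs
          rw [hj' s hs, mul_zero]
        have h3 := (jq_ode k q).unique h2
        have h5 : k ^ 2 * q ≠ 0 := by positivity
        simp only [mem_ofPred_eq]
        rw [neg_eq_zero] at h3
        exact (mul_eq_zero.1 h3).resolve_left h5
      have := closure_minimal hj (isClosed_eq (jq_cont k) continuous_const)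
      rw [closure_Ioo hβα.ne] at this
      exact hj0 (this ⟨hβα.le, le_rfl⟩)
  have haL : aLam lam = √α := hleast.csInf_eq
  intro x hx
  have hr : 0 < rad x := Real.sqrt_pos.2 (by positivity)
  have hsp : 0 < √α := Real.sqrt_pos.2 hα0
  unfold PsiL
  rw [haL]
  set r := rad x
  split_ifs with hra
  · have hrα : r ^ 2 ≤ α := by rw [← hsq]; gcongr
    rw [hUin _ (by positivity) hrα, ← hkdef, J1_jq, J1_jq, hsq]
    have hAe : A = -(W / k ^ 2) / jq k α := by rw [← hAj]; field_simp
    rw [hAe, ← hk2]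
    field_simp
  · have hrα : α ≤ r ^ 2 := by rw [← hsq]; push Not at hra; gcongr
    rw [hUout _ hrα, K1_eq hsp, K1_eq hr, hsq]
    have := (hvp α hα0).ne'
    simp only [hv] at this ⊢
    field_simp

end LambPart14

section LambPart15
open Set Topology

lemma cv_integrable {w : VV → ℝ} (hw : Integrable w) : Integrable (cv gv w) := by
  have h := (Integrable.convolution_integrand (ContinuousLinearMap.mul ℝ ℝ) (μ := (volume : Measure VV)) hw gv_integrable).integral_prod_left
  refine h.congr (Eventually.of_forall fun x => ?_)
  unfold cv
  simp only [ContinuousLinearMap.mul_apply']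
  congr 1; ext y; ring

/-- the profile data of a centered maximizer -/
lemma Cx_match {lam W : ℝ} (hl : 1 < lam) (hW : 0 < W) {w : VV → ℝ} (hw : IsCx lam w)
    (hI : Cst lam * ∫ x, w x = W) :
    ∃ U : ℝ → ℝ, Continuous U ∧ Antitone U ∧ (∃ R, U R ≤ W) ∧ (∃ R, 0 < R ∧ W < U R) ∧
      (∀ᵐ x, w x = lam * max (U (‖x‖ ^ 2) - W) 0) ∧
      ∀ x : ℝ × ℝ, 0 < x.2 → PsiL lam W x = x.2 * U (rad x ^ 2) := by
  obtain ⟨U, hc, ha, h0, hcv, hae, hd⟩ := ode_of_Cx hl hw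
  rw [hI] at hae
  simp only [hI] at hd
  have hCp := Cst_pos hl
  have hex2 : ∃ R, U R ≤ W := by
    by_contra hh
    push Not at hh
    have h1 := cv_integrable hw.1.1.l1
    have h2 : Integrable (fun _ : VV => W) := by
      refine h1.mono' aestronglyMeasurable_const (Eventually.of_forall fun x => ?_)
      rw [hcv, Real.norm_of_nonneg hW.le]
      exact (hh _).le
    rw [integrable_const_iff] at h2
    rcases h2 with h2 | h2
    · exact hW.ne' h2
    · have := h2.measure_univ_lt_top
      rw [measure_univ_of_isAddLeftInvariant] at this
      exact lt_irrefl _ this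
  have hex : ∃ R, 0 < R ∧ W < U R := by
    by_contra hh
    push Not at hh
    have hz : ∫ x, w x = 0 := by
      rw [integral_congr_ae (g := fun _ => (0:ℝ))]
      · simp
      · have h3 : ∀ᵐ x : VV, x ≠ 0 := by
          rw [ae_iff]; simp
        filter_upwards [hae, h3] with x hx hx0
        rw [hx, max_eq_right, mul_zero]
        have : 0 < ‖x‖ := norm_pos_iff.2 hx0
        linarith [hh (‖x‖ ^ 2) (by positivity)]
    rw [hz, mul_zero] at hI
    exact hW.ne hI
  exact ⟨U, hc, ha, hex2, hex, hae, lamb_match hl hW hc ha h0 hd hex hex2⟩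

lemma IsMx.congr {lam : ℝ} {w v : VV → ℝ} (hw : IsMx lam w) (hv : ∀ x, 0 ≤ v x) (h : w =ᵐ[volume] v) : IsMx lam v := by
  refine ⟨⟨hw.1.l2.ae_eq h, hw.1.l1.congr h, hv⟩, ?_⟩
  have h2 := hw.2
  unfold Df at h2 ⊢
  rw [integral_congr_ae h] at h2
  rw [← h2, Bf_congr h h]
  congr 2
  unfold N2
  exact integral_congr_ae (by filter_upwards [h] with x hx; rw [hx])

/-- The lifted Lamb dipole. -/
noncomputable def wL (lam W : ℝ) (U : ℝ → ℝ) (x : VV) : ℝ := lam * max (U (‖x‖ ^ 2) - W) 0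

lemma wL_exists {lam W : ℝ} (hl : 1 < lam) (hW : 0 < W) :
    ∃ U : ℝ → ℝ, Continuous U ∧ Antitone U ∧ (∃ R, U R ≤ W) ∧ (∃ R, 0 < R ∧ W < U R) ∧
      (∀ x : ℝ × ℝ, 0 < x.2 → PsiL lam W x = x.2 * U (rad x ^ 2)) ∧
      IsMx lam (wL lam W U) ∧ 0 < ∫ x, wL lam W U x ∧
      ∀ v, IsMx lam v → ∫ x, v x = ∫ x, wL lam W U x → ∃ p : VV, ∀ᵐ x, v (x + p) = wL lam W U x := by
  have hCp := Cst_pos hl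
  obtain ⟨v, hv, hv1, hvD⟩ := exists_max hl
  have hMx : IsMx lam (fun x => W / Cst lam * v x) := by
    refine ⟨hv.smul (by positivity), ?_⟩
    rw [Df_smul, integral_const_mul, hv1, hvD]; ring
  have hI : ∫ x, W / Cst lam * v x = W / Cst lam := by rw [integral_const_mul, hv1, mul_one]
  obtain ⟨p, hp⟩ := exists_center hl hMx (by rw [hI]; positivity)
  have hIp : ∫ x, (fun x => W / Cst lam * v x) (x + p) = W / Cst lam := by
    rw [integral_add_right_eq_self (fun x => W / Cst lam * v x) p, hI]
  obtain ⟨U, hc, ha, hex2, hex, hae, hPsi⟩ := Cx_match hl hW hp (by rw [hIp]; field_simp)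
  have hnn : ∀ x, 0 ≤ wL lam W U x := fun x => by
    unfold wL; exact mul_nonneg (by linarith) (le_max_right _ _)
  have hIw : ∫ x, wL lam W U x = W / Cst lam := by
    rw [← hIp]; exact (integral_congr_ae hae).symm
  refine ⟨U, hc, ha, hex2, hex, hPsi, hp.1.congr hnn hae, by rw [hIw]; positivity, ?_⟩
  intro v' hv' hI'
  rw [hIw] at hI'
  obtain ⟨p', hp'⟩ := exists_center hl hv' (by rw [hI']; positivity)
  refine ⟨p', ?_⟩
  obtain ⟨U', -, -, -, -, hae', hPsi'⟩ := Cx_match hl hW hp' (by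
    rw [integral_add_right_eq_self v' p', hI']; field_simp)
  have hUU : ∀ q, 0 < q → U' q = U q := by
    intro q hq
    have h1 := hPsi (0, √q) (Real.sqrt_pos.2 hq)
    have h2 := hPsi' (0, √q) (Real.sqrt_pos.2 hq)
    have h3 : rad (0, √q) ^ 2 = q := by
      unfold rad; rw [Real.sq_sqrt (by positivity)]; simp [Real.sq_sqrt hq.le]
    rw [h3] at h1 h2
    rw [h1] at h2
    exact (mul_left_cancel₀ (Real.sqrt_pos.2 hq).ne' h2).symm
  have h3 : ∀ᵐ x : VV, x ≠ 0 := by rw [ae_iff]; simp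
  filter_upwards [hae', h3] with x hx hx0
  rw [hx, wL, hUU]
  have : 0 < ‖x‖ := norm_pos_iff.2 hx0
  positivity

end LambPart15

section LambPart16
open Set Topology
open scoped ENNReal

/-- coordinates -/
def crd (x : VV) : ℝ × (ℝ × (ℝ × ℝ)) := (x 0, (x 1, (x 2, x 3)))

lemma crd_mp : MeasurePreserving crd := by
  have h1 : MeasurePreserving (fun x : VV => x.ofLp) := PiLp.volume_preserving_ofLp (Fin 4)
  have h2 := volume_preserving_piFinSuccAbove (fun _ : Fin 4 => ℝ) 0
  have h3 := volume_preserving_piFinSuccAbove (fun _ : Fin 3 => ℝ) 0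
  have h4 := volume_preserving_finTwoArrow ℝ
  have h5 : MeasurePreserving (fun p : ℝ × (Fin 3 → ℝ) =>
      ((p.1, ((MeasurableEquiv.piFinSuccAbove (fun _ : Fin 3 => ℝ) 0 p.2).1,
        MeasurableEquiv.finTwoArrow (MeasurableEquiv.piFinSuccAbove (fun _ : Fin 3 => ℝ) 0 p.2).2)) : ℝ × (ℝ × (ℝ × ℝ)))) :=
    (MeasurePreserving.id volume).prod (((MeasurePreserving.id volume).prod h4).comp h3)
  exact h5.comp (h2.comp h1)

lemma sub_rad (z : ℝ) (F : ℝ → ℝ≥0∞) :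
    ∫⁻ r in Ioi (0:ℝ), ENNReal.ofReal r * F (√(z ^ 2 + r ^ 2)) = ∫⁻ t in Ioi |z|, ENNReal.ofReal t * F t := by
  have him : (fun r : ℝ => √(z ^ 2 + r ^ 2)) '' Ioi 0 = Ioi |z| := by
    ext t
    simp only [mem_image, mem_Ioi]
    constructor
    · rintro ⟨r, hr, rfl⟩
      rw [← Real.sqrt_sq_eq_abs]
      exact Real.sqrt_lt_sqrt (sq_nonneg _) (by nlinarith [sq_pos_of_pos hr])
    · intro ht
      have h0 := abs_nonneg z
      have h1 : 0 < t ^ 2 - z ^ 2 := by rw [← sq_abs z]; nlinarith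
      refine ⟨√(t ^ 2 - z ^ 2), Real.sqrt_pos.2 h1, ?_⟩
      rw [Real.sq_sqrt h1.le, add_sub_cancel, Real.sqrt_sq (by linarith)]
  rw [← him, lintegral_image_eq_lintegral_abs_deriv_mul (f' := fun r => r / √(z ^ 2 + r ^ 2)) measurableSet_Ioi]
  · refine setLIntegral_congr_fun measurableSet_Ioi fun r (hr : 0 < r) => ?_
    have hs : 0 < √(z ^ 2 + r ^ 2) := Real.sqrt_pos.2 (by positivity)
    rw [abs_of_pos (by positivity), ← mul_assoc, ← ENNReal.ofReal_mul (by positivity)]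
    congr 2
    field_simp
  · intro r (hr : 0 < r)
    have h1 : HasDerivAt (fun r : ℝ => z ^ 2 + r ^ 2) (2 * r) r := by
      simpa using (hasDerivAt_pow 2 r).const_add (z ^ 2)
    have h2 := h1.sqrt (by positivity)
    refine (h2.congr_deriv ?_).hasDerivWithinAt
    field_simp
  · intro r (hr : 0 < r) s (hs : 0 < s) h
    simp only at h
    rw [Real.sqrt_inj (by positivity) (by positivity)] at h
    have : r ^ 2 = s ^ 2 := by linarith
    nlinarith [sq_nonneg (r - s)]

lemma plane_polar (F : ℝ → ℝ≥0∞) (hF : Measurable F) :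
    ∫⁻ p : ℝ × ℝ, F (p.1 ^ 2 + p.2 ^ 2) = ENNReal.ofReal (2 * π) * ∫⁻ r in Ioi (0:ℝ), ENNReal.ofReal r * F (r ^ 2) := by
  rw [← lintegral_comp_polarCoord_symm]
  have e : ∀ p : ℝ × ℝ, (polarCoord.symm p).1 ^ 2 + (polarCoord.symm p).2 ^ 2 = p.1 ^ 2 := by
    intro p
    simp only [polarCoord_symm_apply]
    nlinarith [Real.sin_sq_add_cos_sq p.2]
  simp_rw [e, smul_eq_mul]
  rw [polarCoord_target, Measure.volume_eq_prod, ← Measure.prod_restrict]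
  rw [lintegral_prod _ (by fun_prop)]
  simp only [lintegral_const, Measure.restrict_apply MeasurableSet.univ, univ_inter, Real.volume_Ioo]
  rw [lintegral_mul_const _ (by fun_prop), mul_comm]
  congr 2; ring

lemma space_T (F : ℝ → ℝ → ℝ≥0∞) (hF : Measurable (Function.uncurry F)) :
    ∫⁻ p : ℝ × (ℝ × ℝ), F (√(p.1 ^ 2 + (p.2.1 ^ 2 + p.2.2 ^ 2))) p.1 =
      ENNReal.ofReal (2 * π) * ∫⁻ t in Ioi (0:ℝ), ENNReal.ofReal t * ∫⁻ z in Ioo (-t) t, F t z := by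
  have hF1 : Measurable fun p : ℝ × (ℝ × ℝ) => F (√(p.1 ^ 2 + (p.2.1 ^ 2 + p.2.2 ^ 2))) p.1 :=
    hF.comp (f := fun p : ℝ × (ℝ × ℝ) => (√(p.1 ^ 2 + (p.2.1 ^ 2 + p.2.2 ^ 2)), p.1)) (by fun_prop)
  have hFz : ∀ z, Measurable fun t => F t z := fun z => hF.comp (f := fun t : ℝ => (t, z)) (by fun_prop)
  rw [Measure.volume_eq_prod, lintegral_prod _ hF1.aemeasurable]
  have e1 : ∀ z : ℝ, ∫⁻ p : ℝ × ℝ, F (√(z ^ 2 + (p.1 ^ 2 + p.2 ^ 2))) z =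
      ENNReal.ofReal (2 * π) * ∫⁻ t in Ioi (0:ℝ), (Ioi |z|).indicator (fun t => ENNReal.ofReal t * F t z) t := by
    intro z
    rw [plane_polar (fun s => F (√(z ^ 2 + s)) z) ((hFz z).comp (by fun_prop)), sub_rad z (fun t => F t z)]
    rw [setLIntegral_indicator measurableSet_Ioi]
    congr 3
    rw [inter_eq_left.2]
    exact Ioi_subset_Ioi (abs_nonneg z)
  simp only
  simp_rw [e1]
  have hm : Measurable (Function.uncurry fun z t : ℝ => (Ioi |z|).indicator (fun t => ENNReal.ofReal t * F t z) t) := by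
    have : (Function.uncurry fun z t : ℝ => (Ioi |z|).indicator (fun t => ENNReal.ofReal t * F t z) t) =
      {p : ℝ × ℝ | |p.1| < p.2}.indicator (fun p => ENNReal.ofReal p.2 * F p.2 p.1) := by
      ext p
      simp only [Function.uncurry, indicator, mem_Ioi, mem_ofPred_eq]
    rw [this]
    refine Measurable.indicator ?_ (measurableSet_lt (by fun_prop) (by fun_prop))
    exact (by fun_prop : Measurable fun p : ℝ × ℝ => ENNReal.ofReal p.2).mul (hF.comp measurable_swap)
  rw [lintegral_const_mul' _ _ ENNReal.ofReal_ne_top, lintegral_lintegral_swap hm.aemeasurable]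
  congr 1
  refine setLIntegral_congr_fun measurableSet_Ioi fun t (ht : 0 < t) => ?_
  rw [← lintegral_const_mul' _ _ ENNReal.ofReal_ne_top, ← lintegral_indicator measurableSet_Ioo]
  congr 1; ext z
  simp only [indicator, mem_Ioi, mem_Ioo]
  simp only [abs_lt]

end LambPart16

section LambPart17
open Set Topology
open scoped ENNReal

noncomputable def rho (x : VV) : ℝ := √(x 1 ^ 2 + (x 2 ^ 2 + x 3 ^ 2))
noncomputable def pr (x : VV) : ℝ × ℝ := (x 0, rho x)

lemma rho_meas : Measurable rho := by unfold rho; fun_prop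
lemma pr_meas : Measurable pr := by
  unfold pr; exact Measurable.prodMk (by fun_prop) rho_meas

lemma rho_nonneg (x : VV) : 0 ≤ rho x := Real.sqrt_nonneg _
lemma rho_sq (x : VV) : rho x ^ 2 = x 1 ^ 2 + (x 2 ^ 2 + x 3 ^ 2) := Real.sq_sqrt (by positivity)
lemma norm_sq_VV (x : VV) : ‖x‖ ^ 2 = x 0 ^ 2 + (x 1 ^ 2 + (x 2 ^ 2 + x 3 ^ 2)) := by
  rw [EuclideanSpace.norm_sq_eq, Fin.sum_univ_four]
  simp only [Real.norm_eq_abs, sq_abs]; ring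

lemma UHP_meas : MeasurableSet UHP := measurableSet_lt measurable_const measurable_snd
lemma UHP_eq : UHP = univ ×ˢ Ioi (0:ℝ) := by ext p; simp [UHP]
lemma vol_UHP : (volume.restrict UHP : Measure (ℝ × ℝ)) = volume.prod (volume.restrict (Ioi 0)) := by
  rw [UHP_eq, Measure.volume_eq_prod, ← Measure.prod_restrict, Measure.restrict_univ]

/-- general cylindrical reduction -/
lemma cyl (F : ℝ → ℝ → ℝ → ℝ≥0∞) (hF : Measurable fun p : ℝ × ℝ × ℝ => F p.1 p.2.1 p.2.2) :
    ∫⁻ y : VV, F (y 0) (rho y) (y 1) =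
      ∫⁻ p in UHP, ENNReal.ofReal (2 * π) * (ENNReal.ofReal p.2 * ∫⁻ z in Ioo (-p.2) p.2, F p.1 p.2 z) := by
  have h1 : Measurable fun p : ℝ × (ℝ × (ℝ × ℝ)) => F p.1 (√(p.2.1 ^ 2 + (p.2.2.1 ^ 2 + p.2.2.2 ^ 2))) p.2.1 :=
    hF.comp (f := fun p : ℝ × (ℝ × (ℝ × ℝ)) => (p.1, √(p.2.1 ^ 2 + (p.2.2.1 ^ 2 + p.2.2.2 ^ 2)), p.2.1)) (by fun_prop)
  have h2 := crd_mp.lintegral_comp h1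
  have e : ∫⁻ y : VV, F (y 0) (rho y) (y 1) = ∫⁻ y : VV, (fun p : ℝ × (ℝ × (ℝ × ℝ)) => F p.1 (√(p.2.1 ^ 2 + (p.2.2.1 ^ 2 + p.2.2.2 ^ 2))) p.2.1) (crd y) := rfl
  rw [e, h2, Measure.volume_eq_prod, lintegral_prod _ h1.aemeasurable]
  have e2 : ∀ x : ℝ, ∫⁻ p : ℝ × (ℝ × ℝ), F x (√(p.1 ^ 2 + (p.2.1 ^ 2 + p.2.2 ^ 2))) p.1 =
      ∫⁻ t in Ioi (0:ℝ), ENNReal.ofReal (2 * π) * (ENNReal.ofReal t * ∫⁻ z in Ioo (-t) t, F x t z) := by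
    intro x
    rw [space_T (F x) (hF.comp (f := fun p : ℝ × ℝ => (x, p.1, p.2)) (by fun_prop)), lintegral_const_mul' _ _ ENNReal.ofReal_ne_top]
  simp only
  simp_rw [e2]
  rw [vol_UHP, lintegral_prod]
  have hm : Measurable fun p : ℝ × ℝ => ∫⁻ z in Ioo (-p.2) p.2, F p.1 p.2 z := by
    have e3 : ∀ p : ℝ × ℝ, ∫⁻ z in Ioo (-p.2) p.2, F p.1 p.2 z = ∫⁻ z, {q : (ℝ × ℝ) × ℝ | -q.1.2 < q.2 ∧ q.2 < q.1.2}.indicator (fun q => F q.1.1 q.1.2 q.2) (p, z) := by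
      intro p
      rw [← lintegral_indicator measurableSet_Ioo]
      rfl
    simp_rw [e3]
    apply Measurable.lintegral_prod_right'
    refine Measurable.indicator (hF.comp (f := fun q : (ℝ × ℝ) × ℝ => (q.1.1, q.1.2, q.2)) (by fun_prop)) ?_
    exact (measurableSet_lt (f := fun q : (ℝ × ℝ) × ℝ => -q.1.2) (g := fun q => q.2) (by fun_prop) (by fun_prop)).inter
      (measurableSet_lt (f := fun q : (ℝ × ℝ) × ℝ => q.2) (g := fun q => q.1.2) (by fun_prop) (by fun_prop))
  exact ((by fun_prop : Measurable fun p : ℝ × ℝ => ENNReal.ofReal p.2).mul hm |>.const_mul _).aemeasurable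

noncomputable def muU : Measure (ℝ × ℝ) := (volume.restrict UHP).withDensity fun p => ENNReal.ofReal (4 * π * p.2 ^ 2)

lemma lint_pr {F : ℝ × ℝ → ℝ≥0∞} (hF : Measurable F) :
    ∫⁻ x : VV, F (pr x) = ∫⁻ p in UHP, ENNReal.ofReal (4 * π * p.2 ^ 2) * F p := by
  have := cyl (fun a b _ => F (a, b)) (hF.comp (f := fun p : ℝ × ℝ × ℝ => (p.1, p.2.1)) (by fun_prop))
  have e : ∫⁻ x : VV, F (pr x) = ∫⁻ y : VV, F (y 0, rho y) := rfl
  rw [e, this]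
  refine setLIntegral_congr_fun UHP_meas fun p (hp : 0 < p.2) => ?_
  simp only [lintegral_const, Measure.restrict_apply MeasurableSet.univ, univ_inter, Real.volume_Ioo]
  rw [mul_comm (F _), ← mul_assoc, ← mul_assoc, ← ENNReal.ofReal_mul (by positivity), ← ENNReal.ofReal_mul (by positivity)]
  congr 2
  ring

lemma pr_mp : MeasurePreserving pr volume muU := by
  refine ⟨pr_meas, ?_⟩
  ext s hs
  rw [Measure.map_apply pr_meas hs, muU, withDensity_apply _ hs]
  rw [← lintegral_indicator_one (pr_meas hs)]
  have := lint_pr (F := s.indicator 1) (measurable_one.indicator hs)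
  have e : ∀ x, (pr ⁻¹' s).indicator (1 : VV → ℝ≥0∞) x = s.indicator 1 (pr x) := fun x => rfl
  simp_rw [e]
  rw [this, ← lintegral_indicator hs]
  congr 1; ext p
  by_cases hp : p ∈ s <;> simp [hp]

lemma int_pr {F : ℝ × ℝ → ℝ} (hF : Measurable F) :
    ∫ x : VV, F (pr x) = 4 * π * ∫ p in UHP, p.2 ^ 2 * F p := by
  rw [← integral_map (f := F) pr_meas.aemeasurable hF.aestronglyMeasurable, pr_mp.map_eq, muU,
    integral_withDensity_eq_integral_toReal_smul (by fun_prop) (by simp), ← integral_const_mul]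
  congr 1; ext p
  rw [ENNReal.toReal_ofReal (by positivity), smul_eq_mul]; ring

lemma integrable_pr {F : ℝ × ℝ → ℝ} (hF : Measurable F) :
    Integrable (fun x : VV => F (pr x)) ↔ IntegrableOn (fun p => p.2 ^ 2 * F p) UHP := by
  have h1 := integrable_map_measure (f := pr) (μ := volume) (g := F) hF.aestronglyMeasurable pr_meas.aemeasurable
  change _ ↔ Integrable (fun x => F (pr x)) volume at h1
  rw [← h1, pr_mp.map_eq, muU, integrable_withDensity_iff_integrable_smul' (by fun_prop) (by simp)]
  have e : ∀ p : ℝ × ℝ, (ENNReal.ofReal (4 * π * p.2 ^ 2)).toReal • F p = (4 * π) * (p.2 ^ 2 * F p) := by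
    intro p
    rw [ENNReal.toReal_ofReal (by positivity), smul_eq_mul]; ring
  simp_rw [e]
  rw [IntegrableOn, integrable_const_mul_iff (isUnit_iff_ne_zero.2 (by positivity))]

lemma rho_pos_ae : ∀ᵐ x : VV, 0 < rho x := by
  have h : ∀ᵐ p ∂muU, 0 < p.2 := by
    have : ∀ᵐ p ∂(volume.restrict UHP), 0 < p.2 := ae_restrict_mem UHP_meas
    exact (withDensity_absolutelyContinuous _ _).ae_le this
  exact pr_mp.quasiMeasurePreserving.ae h

lemma inner_int {D s t : ℝ} (hs : 0 < s) (ht : 0 < t) (hD : 0 < D - 2 * s * t) :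
    ∫⁻ z in Ioo (-t) t, ENNReal.ofReal (gq (D - 2 * s * z)) =
      ENNReal.ofReal ((16 * π ^ 2)⁻¹ * (2 / s * (gn 1 (D - 2 * s * t) - gn 1 (D + 2 * s * t)))) := by
  have hpos : ∀ z ∈ Icc (-t) t, 0 < D - 2 * s * z := by
    intro z hz
    have : 2 * s * z ≤ 2 * s * t := by gcongr; exact hz.2
    linarith
  have hcont : ContinuousOn (fun z => gq (D - 2 * s * z)) (Icc (-t) t) := by
    intro z hz
    have h1 := gq_contAt (hpos z hz)
    exact (ContinuousAt.comp (g := gq) (f := fun z => D - 2 * s * z) h1 (by fun_prop)).continuousWithinAt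
  have hIntg : IntegrableOn (fun z => gq (D - 2 * s * z)) (Ioo (-t) t) :=
    (hcont.integrableOn_Icc).mono_set Ioo_subset_Icc_self
  rw [← ofReal_integral_eq_lintegral_ofReal hIntg (Eventually.of_forall fun z => gq_nonneg _)]
  congr 1
  rw [← integral_Ioc_eq_integral_Ioo, ← intervalIntegral.integral_of_le (by linarith)]
  have hder : ∀ z ∈ uIcc (-t) t, HasDerivAt (fun z => (16 * π ^ 2)⁻¹ * (2 / s * gn 1 (D - 2 * s * z))) (gq (D - 2 * s * z)) z := by
    intro z hz
    rw [uIcc_of_le (by linarith)] at hz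
    have h1 : HasDerivAt (fun z : ℝ => D - 2 * s * z) (-(2 * s)) z := by
      simpa using ((hasDerivAt_id z).const_mul (2 * s)).const_sub D
    have h2 : HasDerivAt (gn 1 ∘ fun z => D - 2 * s * z) (-(1 / 4) * gn (1 + 1) (D - 2 * s * z) * (-(2 * s))) z :=
      HasDerivAt.comp (h₂ := gn 1) (h := fun z => D - 2 * s * z) z (gn_deriv 1 (hpos z hz)) h1
    have h3 := (h2.const_mul (2 / s)).const_mul ((16 * π ^ 2)⁻¹)
    refine h3.congr_deriv ?_
    rw [gq_gn]; field_simp; norm_num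
  rw [intervalIntegral.integral_eq_sub_of_hasDerivAt hder]
  · simp only [mul_neg, sub_neg_eq_add]; ring
  · apply ContinuousOn.intervalIntegrable
    rw [uIcc_of_le (by linarith)]; exact hcont

lemma GUHP_gn {a s b t : ℝ} (hs : 0 < s) (ht : 0 < t) (h : a ≠ b) :
    GUHP (a, s) (b, t) = (4 * π)⁻¹ * (gn 1 ((a - b) ^ 2 + (s ^ 2 + t ^ 2) - 2 * s * t) - gn 1 ((a - b) ^ 2 + (s ^ 2 + t ^ 2) + 2 * s * t)) := by
  have hab : 0 < (a - b) ^ 2 := by have := sub_ne_zero.2 h; positivity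
  have h1 : 0 < (a - b) ^ 2 + (s - t) ^ 2 := by positivity
  have h2 : 0 < (a - b) ^ 2 + (-s - t) ^ 2 := by positivity
  unfold GUHP Gker reflPt rad
  simp only [Prod.fst_sub, Prod.snd_sub]
  have k1 := K0_gn (Real.sqrt_pos.2 h1)
  have k2 := K0_gn (Real.sqrt_pos.2 h2)
  rw [Real.sq_sqrt h1.le] at k1
  rw [Real.sq_sqrt h2.le] at k2
  have e1 : (a - b) ^ 2 + (s ^ 2 + t ^ 2) - 2 * s * t = (a - b) ^ 2 + (s - t) ^ 2 := by ring
  have e2 : (a - b) ^ 2 + (s ^ 2 + t ^ 2) + 2 * s * t = (a - b) ^ 2 + (-s - t) ^ 2 := by ring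
  rw [e1, e2, k1, k2]
  field_simp; ring

lemma ae_fst_ne (a : ℝ) : ∀ᵐ p ∂(volume.restrict UHP : Measure (ℝ × ℝ)), a ≠ p.1 := by
  refine ae_restrict_of_ae ?_
  have h1 : ∀ᵐ b : ℝ, a ≠ b := by
    rw [ae_iff]; simp
  rw [Measure.volume_eq_prod]
  exact Measure.quasiMeasurePreserving_fst.ae h1

lemma ker_axis {a s : ℝ} (hs : 0 < s) {F : ℝ × ℝ → ℝ≥0∞} (hF : Measurable F) :
    ∫⁻ y : VV, ENNReal.ofReal (gv (!₂[a, s, 0, 0] - y)) * F (pr y) =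
      ∫⁻ p in UHP, ENNReal.ofReal (p.2 / s * GUHP (a, s) p) * F p := by
  have hn : ∀ y : VV, gv (!₂[a, s, 0, 0] - y) = gq ((a - y 0) ^ 2 + (s ^ 2 + rho y ^ 2) - 2 * s * y 1) := by
    intro y
    unfold gv
    rw [norm_sq_VV, rho_sq]
    congr 1
    simp
    ring
  simp_rw [hn]
  have hm := gq_measurable
  have h := cyl (fun y0 r y1 => ENNReal.ofReal (gq ((a - y0) ^ 2 + (s ^ 2 + r ^ 2) - 2 * s * y1)) * F (y0, r))
    (((hm.comp (by fun_prop : Measurable fun p : ℝ × ℝ × ℝ => (a - p.1) ^ 2 + (s ^ 2 + p.2.1 ^ 2) - 2 * s * p.2.2)).ennreal_ofReal).mul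
      (hF.comp (f := fun p : ℝ × ℝ × ℝ => (p.1, p.2.1)) (by fun_prop)))
  have e : ∫⁻ y : VV, ENNReal.ofReal (gq ((a - y 0) ^ 2 + (s ^ 2 + rho y ^ 2) - 2 * s * y 1)) * F (pr y) =
    ∫⁻ y : VV, ENNReal.ofReal (gq ((a - y 0) ^ 2 + (s ^ 2 + rho y ^ 2) - 2 * s * y 1)) * F (y 0, rho y) := rfl
  rw [e, h]
  refine lintegral_congr_ae ?_
  filter_upwards [ae_fst_ne a, ae_restrict_mem UHP_meas] with p hp (hp2 : 0 < p.2)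
  have hab : 0 < (a - p.1) ^ 2 := by have := sub_ne_zero.2 hp; positivity
  have hD : 0 < ((a - p.1) ^ 2 + (s ^ 2 + p.2 ^ 2)) - 2 * s * p.2 := by nlinarith [sq_nonneg (s - p.2)]
  have hmz : Measurable fun z => ENNReal.ofReal (gq ((a - p.1) ^ 2 + (s ^ 2 + p.2 ^ 2) - 2 * s * z)) :=
    (hm.comp (by fun_prop : Measurable fun z : ℝ => (a - p.1) ^ 2 + (s ^ 2 + p.2 ^ 2) - 2 * s * z)).ennreal_ofReal
  rw [lintegral_mul_const _ hmz, inner_int hs hp2 hD, ← mul_assoc, ← mul_assoc, ← ENNReal.ofReal_mul (by positivity),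
    ← ENNReal.ofReal_mul (by positivity)]
  congr 2
  have hg := GUHP_gn (a := a) (s := s) (b := p.1) (t := p.2) hs hp2 hp
  rw [show GUHP (a, s) p = GUHP (a, s) (p.1, p.2) from rfl, hg]
  field_simp
  ring

lemma pr_sg {e : VV} (he : ‖e‖ = 1) (h0 : e 0 = 0) (y : VV) : pr (sg e 0 y) = pr y := by
  have h1 : (sg e 0 y) 0 = y 0 := by
    rw [sg_apply he]; simp [h0]
  have h2 : ‖sg e 0 y‖ = ‖y‖ := by
    have := sg_dist e 0 y 0
    have h0' : sg e 0 0 = 0 := by rw [sg_apply he]; simp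
    rwa [h0', sub_zero, sub_zero] at this
  have h3 := norm_sq_VV (sg e 0 y)
  have h4 := norm_sq_VV y
  rw [h2, h4, h1] at h3
  unfold pr
  rw [h1]
  have : rho (sg e 0 y) = rho y := by
    unfold rho; congr 1; linarith
  rw [this]

lemma exists_rot (x : VV) : ∃ T : VV ≃ᵐ VV, MeasurePreserving T ∧ (∀ y, pr (T y) = pr y) ∧
    ∀ y, gv (x - T y) = gv (!₂[x 0, rho x, 0, 0] - y) := by
  set z : VV := !₂[x 0, rho x, 0, 0] with hz
  by_cases hxz : x = z
  · exact ⟨MeasurableEquiv.refl VV, MeasurePreserving.id _, fun y => rfl, fun y => by rw [← hxz]; rfl⟩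
  · have hd : 0 < ‖x - z‖ := norm_pos_iff.2 (sub_ne_zero.2 hxz)
    set e : VV := ‖x - z‖⁻¹ • (x - z) with he
    have hen : ‖e‖ = 1 := by rw [he, norm_smul, norm_inv, norm_norm, inv_mul_cancel₀ hd.ne']
    have he0 : e 0 = 0 := by simp [he, hz]
    refine ⟨sg e 0, sg_mp e 0, pr_sg hen he0, fun y => ?_⟩
    rw [← gv_sg' hen]
    have hnorm : ‖x‖ = ‖z‖ := by
      have h1 := norm_sq_VV x
      have h2 := norm_sq_VV z
      have : ‖x‖ ^ 2 = ‖z‖ ^ 2 := by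
        rw [h1, h2]; simp [hz, rho_sq]
      exact (sq_eq_sq₀ (norm_nonneg _) (norm_nonneg _)).1 this
    have hsx : sg e 0 x = z := by
      rw [sg_apply hen, sub_zero]
      have hin : 2 * inner ℝ (x - z) x = ‖x - z‖ ^ 2 := by
        rw [← real_inner_self_eq_norm_sq, inner_sub_left, inner_sub_left, inner_sub_right, inner_sub_right,
          real_inner_self_eq_norm_sq, real_inner_self_eq_norm_sq, hnorm, real_inner_comm x z]; ring
      have : (2 * inner ℝ e x) • e = x - z := by
        rw [he, inner_smul_left, smul_smul]
        have : 2 * ((starRingEnd ℝ) ‖x - z‖⁻¹ * inner ℝ (x - z) x) * ‖x - z‖⁻¹ = 1 := by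
          simp only [conj_trivial]
          have : 2 * (‖x - z‖⁻¹ * inner ℝ (x - z) x) * ‖x - z‖⁻¹ = (2 * inner ℝ (x - z) x) * ‖x - z‖⁻¹ ^ 2 := by ring
          rw [this, hin]; field_simp
        rw [this, one_smul]
      rw [this]; abel
    rw [hsx]

lemma ker_all {x : VV} (hx : 0 < rho x) {F : ℝ × ℝ → ℝ≥0∞} (hF : Measurable F) :
    ∫⁻ y : VV, ENNReal.ofReal (gv (x - y)) * F (pr y) =
      ∫⁻ p in UHP, ENNReal.ofReal (p.2 / rho x * GUHP (pr x) p) * F p := by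
  obtain ⟨T, hT, hp, hg⟩ := exists_rot x
  rw [← hT.lintegral_comp_emb T.measurableEmbedding]
  simp_rw [hp, hg]
  exact ker_axis hx hF

end LambPart17

section LambPart18
open Set Topology
open scoped ENNReal

noncomputable def lf (ζ : ℝ × ℝ → ℝ) (x : VV) : ℝ := ζ (pr x) / rho x

lemma K0_meas : Measurable K0 := by
  unfold K0
  have : StronglyMeasurable (fun p : ℝ × ℝ => Real.exp (-(p.1 * Real.cosh p.2))) := by
    apply Measurable.stronglyMeasurable; fun_prop
  exact (this.integral_prod_right (ν := volume.restrict (Ioi 0))).measurable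

lemma GUHP_meas : Measurable fun p : (ℝ × ℝ) × (ℝ × ℝ) => GUHP p.1 p.2 := by
  unfold GUHP Gker reflPt
  refine ((K0_meas.comp ?_).const_mul _).sub ((K0_meas.comp ?_).const_mul _)
  · unfold rad; fun_prop
  · unfold rad; fun_prop

lemma gn_anti {a b : ℝ} (ha : 0 < a) (hab : a ≤ b) : gn 1 b ≤ gn 1 a := by
  have : AntitoneOn (gn 1) (Ioi 0) := by
    refine antitoneOn_of_deriv_nonpos (convex_Ioi 0) ?_ ?_ ?_
    · intro x hx; exact (gn_deriv 1 hx).continuousAt.continuousWithinAt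
    · intro x hx; rw [interior_Ioi] at hx; exact (gn_deriv 1 hx).differentiableAt.differentiableWithinAt
    · intro x hx; rw [interior_Ioi] at hx
      rw [(gn_deriv 1 hx).deriv]
      have := gn_pos 2 hx
      norm_num; linarith
  exact this ha (lt_of_lt_of_le ha hab) hab

lemma GUHP_nonneg {x : ℝ × ℝ} (hx : 0 < x.2) : ∀ᵐ p ∂(volume.restrict UHP : Measure (ℝ × ℝ)), 0 ≤ GUHP x p := by
  filter_upwards [ae_fst_ne x.1, ae_restrict_mem UHP_meas] with p h1 (h2 : 0 < p.2)
  have e := GUHP_gn (a := x.1) (s := x.2) (b := p.1) (t := p.2) hx h2 h1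
  rw [show x = (x.1, x.2) from rfl, show p = (p.1, p.2) from rfl, e]
  have hab : 0 < (x.1 - p.1) ^ 2 := by have := sub_ne_zero.2 h1; positivity
  have := gn_anti (a := (x.1 - p.1) ^ 2 + (x.2 ^ 2 + p.2 ^ 2) - 2 * x.2 * p.2) (b := (x.1 - p.1) ^ 2 + (x.2 ^ 2 + p.2 ^ 2) + 2 * x.2 * p.2)
    (by nlinarith [sq_nonneg (x.2 - p.2)]) (by nlinarith [mul_pos hx h2])
  have : 0 ≤ (4 * π)⁻¹ := by positivity
  exact mul_nonneg this (by linarith)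

lemma lf_meas {ζ : ℝ × ℝ → ℝ} (hz : Measurable ζ) : Measurable (lf ζ) :=
  (hz.comp pr_meas).div rho_meas

lemma cv_lf {ζ : ℝ × ℝ → ℝ} (hz : Measurable ζ) (h0 : ∀ x, 0 ≤ ζ x) {x : VV} (hx : 0 < rho x) :
    cv gv (lf ζ) x = Gop ζ (pr x) / rho x := by
  have hF : Measurable fun p : ℝ × ℝ => ENNReal.ofReal (ζ p / p.2) := by fun_prop
  have k := ker_all hx hF
  have e1 : cv gv (lf ζ) x = (∫⁻ y, ENNReal.ofReal (gv (x - y)) * ENNReal.ofReal (ζ (pr y) / (pr y).2)).toReal := by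
    unfold cv
    rw [integral_eq_lintegral_of_nonneg_ae]
    · congr 1; refine lintegral_congr fun y => ?_
      rw [ENNReal.ofReal_mul (gv_nonneg _)]; rfl
    · exact Eventually.of_forall fun y => mul_nonneg (gv_nonneg _) (div_nonneg (h0 _) (rho_nonneg _))
    · exact ((gv_measurable.comp (measurable_const.sub measurable_id)).mul (lf_meas hz)).aestronglyMeasurable
  have e2 : Gop ζ (pr x) / rho x = (∫⁻ p in UHP, ENNReal.ofReal (p.2 / rho x * GUHP (pr x) p) * ENNReal.ofReal (ζ p / p.2)).toReal := by
    unfold Gop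
    rw [← integral_div, integral_eq_lintegral_of_nonneg_ae]
    · congr 1; refine lintegral_congr_ae ?_
      filter_upwards [GUHP_nonneg (x := pr x) hx, ae_restrict_mem UHP_meas] with p h1 (h2 : 0 < p.2)
      rw [← ENNReal.ofReal_mul (by positivity)]
      congr 1; field_simp
    · filter_upwards [GUHP_nonneg (x := pr x) hx] with p h1
      exact div_nonneg (mul_nonneg h1 (h0 _)) hx.le
    · exact (((GUHP_meas.comp (measurable_const.prodMk measurable_id)).mul hz).div_const _).aestronglyMeasurable
  rw [e1, e2, k]

lemma Gop_meas {ζ : ℝ × ℝ → ℝ} (hz : Measurable ζ) : Measurable (Gop ζ) := by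
  unfold Gop
  have : StronglyMeasurable (fun p : (ℝ × ℝ) × (ℝ × ℝ) => GUHP p.1 p.2 * ζ p.2) :=
    (GUHP_meas.mul (hz.comp measurable_snd)).stronglyMeasurable
  exact (this.integral_prod_right (ν := volume.restrict UHP)).measurable

lemma lf_sq_int {f : ℝ × ℝ → ℝ} (hf : Measurable f) :
    Integrable (fun x => lf f x ^ 2) ↔ IntegrableOn (fun p => f p ^ 2) UHP := by
  have h := integrable_pr (F := fun p => (f p / p.2) ^ 2) (by fun_prop)
  change Integrable (fun x => lf f x ^ 2) ↔ _ at h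
  rw [h]
  refine integrableOn_congr_fun (fun p (hp : 0 < p.2) => ?_) UHP_meas
  field_simp

lemma lf_int {f : ℝ × ℝ → ℝ} (hf : Measurable f) :
    Integrable (lf f) ↔ IntegrableOn (fun p => p.2 * f p) UHP := by
  have h := integrable_pr (F := fun p => (f p / p.2)) (by fun_prop)
  change Integrable (lf f) ↔ _ at h
  rw [h]
  refine integrableOn_congr_fun (fun p (hp : 0 < p.2) => ?_) UHP_meas
  field_simp

lemma lf_memLp {f : ℝ × ℝ → ℝ} (hf : Measurable f) (h : IntegrableOn (fun p => f p ^ 2) UHP) :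
    MemLp (lf f) 2 := by
  rw [memLp_two_iff_integrable_sq (lf_meas hf).aestronglyMeasurable]
  exact (lf_sq_int hf).2 h

lemma lf_N2 {f : ℝ × ℝ → ℝ} (hf : Measurable f) : N2 (lf f) = 4 * π * ∫ p in UHP, f p ^ 2 := by
  have h := int_pr (F := fun p => (f p / p.2) ^ 2) (by fun_prop)
  change N2 (lf f) = _ at h
  rw [h]; congr 1
  refine setIntegral_congr_fun UHP_meas (fun p (hp : 0 < p.2) => ?_)
  field_simp

lemma lf_integral {f : ℝ × ℝ → ℝ} (hf : Measurable f) : ∫ x, lf f x = 4 * π * ∫ p in UHP, p.2 * f p := by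
  have h := int_pr (F := fun p => (f p / p.2)) (by fun_prop)
  change ∫ x, lf f x = _ at h
  rw [h]; congr 1
  refine setIntegral_congr_fun UHP_meas (fun p (hp : 0 < p.2) => ?_)
  field_simp

lemma lf_energy {ζ : ℝ × ℝ → ℝ} (hz : Measurable ζ) (h0 : ∀ x, 0 ≤ ζ x)
    (h : IntegrableOn (fun p => ζ p ^ 2) UHP) : Bf gv (lf ζ) (lf ζ) = 8 * π * kineticE ζ := by
  rw [Bf_eq_cv gv_integrable (lf_memLp hz h) (lf_memLp hz h)]
  have e1 : ∫ x, lf ζ x * cv gv (lf ζ) x = ∫ x : VV, (fun p : ℝ × ℝ => ζ p / p.2 * (Gop ζ p / p.2)) (pr x) := by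
    apply integral_congr_ae
    filter_upwards [rho_pos_ae] with x hx
    rw [cv_lf hz h0 hx]; rfl
  have hm := Gop_meas hz
  rw [e1, int_pr (F := fun p : ℝ × ℝ => ζ p / p.2 * (Gop ζ p / p.2)) (by fun_prop)]
  unfold kineticE
  have : ∫ p in UHP, p.2 ^ 2 * (ζ p / p.2 * (Gop ζ p / p.2)) = ∫ p in UHP, ζ p * Gop ζ p := by
    refine setIntegral_congr_fun UHP_meas (fun p (hp : 0 < p.2) => ?_)
    field_simp
  rw [this]; ring

lemma lf_Adm {ζ : ℝ × ℝ → ℝ} (hz : Measurable ζ) (h0 : ∀ x, 0 ≤ ζ x)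
    (h2 : IntegrableOn (fun p => ζ p ^ 2) UHP) (h1 : IntegrableOn (fun p => p.2 * ζ p) UHP) : Adm (lf ζ) :=
  ⟨lf_memLp hz h2, (lf_int hz).2 h1, fun x => div_nonneg (h0 _) (rho_nonneg _)⟩

end LambPart18

section LambPart19
open Set Topology

lemma young_lim {A X : ℕ → ℝ} {K : ℝ} (hK : 0 ≤ K) (hA : Tendsto A atTop (𝓝 0))
    (h : ∀ n s, 0 < s → |X n| ≤ s * K + s⁻¹ * A n) : Tendsto X atTop (𝓝 0) := by
  rw [Metric.tendsto_atTop]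
  intro ε hε
  set s := ε / (2 * (K + 1)) with hs
  have hs0 : 0 < s := by positivity
  have h1 : s * K < ε / 2 := by
    rw [hs, div_mul_eq_mul_div, div_lt_div_iff₀ (by positivity) (by norm_num)]; nlinarith
  obtain ⟨N, hN⟩ := eventually_atTop.1 (hA.eventually (gt_mem_nhds (show (0:ℝ) < s * (ε / 2) by positivity)))
  refine ⟨N, fun n hn => ?_⟩
  rw [Real.dist_eq, sub_zero]
  have h2 : s⁻¹ * A n < ε / 2 := by
    rw [inv_mul_lt_iff₀ hs0]; exact hN n hn
  linarith [h n s hs0]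

lemma N2_tri {u v w : VV → ℝ} (hu : MemLp u 2) (hv : MemLp v 2) (hw : MemLp w 2) :
    N2 (fun x => u x - w x) ≤ 2 * N2 (fun x => u x - v x) + 2 * N2 (fun x => v x - w x) := by
  have i1 : Integrable (fun x => (u x - w x) ^ 2) := L2sq (hu.sub hw)
  have i2 : Integrable (fun x => (u x - v x) ^ 2) := L2sq (hu.sub hv)
  have i3 : Integrable (fun x => (v x - w x) ^ 2) := L2sq (hv.sub hw)
  unfold N2
  rw [← integral_const_mul, ← integral_const_mul, ← integral_add (i2.const_mul 2) (i3.const_mul 2)]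
  refine integral_mono i1 ((i2.const_mul 2).add (i3.const_mul 2)) fun x => ?_
  simp only
  nlinarith [sq_nonneg (u x - v x - (v x - w x))]

lemma memLp_tr {f : VV → ℝ} (hf : MemLp f 2) (p : VV) : MemLp (fun x => f (x + p)) 2 :=
  hf.comp_measurePreserving (trE_mp p)

noncomputable def tau (f : VV → ℝ) (t : VV) : ℝ := N2 fun x => f (x + t) - f x

lemma tau_double {f : VV → ℝ} (hf : MemLp f 2) (t : VV) : tau f ((2:ℝ) • t) ≤ 4 * tau f t := by
  have h := N2_tri (memLp_tr hf ((2:ℝ) • t)) (memLp_tr hf t) hf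
  have e : N2 (fun x => f (x + (2:ℝ) • t) - f (x + t)) = tau f t := by
    unfold tau
    rw [← N2_translate (fun x => f (x + t) - f x) t]
    congr 1; ext x; rw [two_smul, add_assoc]
  rw [e] at h
  change tau f _ ≤ _ + 2 * tau f t at h
  linarith

lemma tau_pow {f : VV → ℝ} (hf : MemLp f 2) (t : VV) (m : ℕ) :
    tau f (((2:ℝ) ^ m) • t) ≤ 4 ^ m * tau f t := by
  induction m with
  | zero => simp
  | succ k ih =>
    have := tau_double hf (((2:ℝ) ^ k) • t)
    rw [smul_smul, ← pow_succ'] at this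
    calc _ ≤ _ := this
      _ ≤ 4 * (4 ^ k * tau f t) := by gcongr
      _ = _ := by ring

lemma tau_far {f : VV → ℝ} (hf : MemLp f 2) {R : ℝ} (hR : ∀ x, R ≤ ‖x‖ → f x = 0) {t : VV}
    (ht : 2 * R ≤ ‖t‖) : tau f t = 2 * N2 f := by
  unfold tau
  have i1 : Integrable (fun x => f (x + t) ^ 2) := L2sq (memLp_tr hf t)
  have i2 : Integrable (fun x => f x ^ 2) := L2sq hf
  have e : N2 (fun x => f (x + t)) = N2 f := N2_translate f t
  rw [two_mul]
  nth_rewrite 1 [← e]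
  unfold N2
  rw [← integral_add i1 i2]
  congr 1; ext x
  have : f (x + t) = 0 ∨ f x = 0 := by
    by_contra! h
    have h1 : ‖x + t‖ < R := by by_contra! h'; exact h.1 (hR _ h')
    have h2 : ‖x‖ < R := by by_contra! h'; exact h.2 (hR _ h')
    have := norm_sub_le (x + t) x
    rw [add_sub_cancel_left] at this
    linarith
  rcases this with h | h <;> simp [h]

lemma tau_small {f : VV → ℝ} (hf : MemLp f 2) {R : ℝ} (hR : ∀ x, R ≤ ‖x‖ → f x = 0)
    (hp : 0 < N2 f) {t : ℕ → VV} (ht : Tendsto (fun n => tau f (t n)) atTop (𝓝 0)) :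
    Tendsto (fun n => ‖t n‖) atTop (𝓝 0) := by
  rw [Metric.tendsto_atTop]
  intro ε hε
  obtain ⟨m, hm⟩ := pow_unbounded_of_one_lt (2 * R / ε) (by norm_num : (1:ℝ) < 2)
  obtain ⟨N, hN⟩ := eventually_atTop.1 (ht.eventually (gt_mem_nhds (show (0:ℝ) < N2 f / 4 ^ m by positivity)))
  refine ⟨N, fun n hn => ?_⟩
  rw [Real.dist_eq, sub_zero, abs_norm]
  by_contra! h
  have h1 := tau_pow hf (t n) m
  rw [tau_far hf hR] at h1
  · have h2 := hN n hn
    rw [lt_div_iff₀ (by positivity)] at h2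
    linarith
  · rw [norm_smul, Real.norm_of_nonneg (by positivity)]
    rw [div_lt_iff₀ hε] at hm
    nlinarith [pow_pos (by norm_num : (0:ℝ) < 2) m]

lemma tau_cont {f : VV → ℝ} (hf : Continuous f) {R : ℝ} (hR : ∀ x, R ≤ ‖x‖ → f x = 0)
    {t : ℕ → VV} (ht : Tendsto t atTop (𝓝 0)) :
    Tendsto (fun n => tau f (t n)) atTop (𝓝 0) := by
  have hcs : HasCompactSupport f := by
    refine HasCompactSupport.intro (isCompact_closedBall 0 R) fun x hx => hR x ?_
    rw [mem_closedBall_zero_iff] at hx; push Not at hx; exact hx.le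
  obtain ⟨C, hC⟩ := hcs.exists_bound_of_continuous hf
  have hC0 : 0 ≤ C := (norm_nonneg _).trans (hC 0)
  have key : Tendsto (fun n => ∫ x, (f (x + t n) - f x) ^ 2) atTop (𝓝 (∫ x : VV, (0:ℝ))) := by
    refine tendsto_integral_filter_of_dominated_convergence ((Metric.closedBall (0:VV) (R + 1)).indicator fun _ => (2 * C) ^ 2) ?_ ?_ ?_ ?_
    · exact Eventually.of_forall fun n => (by fun_prop : Continuous fun x => (f (x + t n) - f x) ^ 2).aestronglyMeasurable
    · have : ∀ᶠ n in atTop, ‖t n‖ < 1 := by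
        have := ht.norm; rw [norm_zero] at this
        exact this.eventually (gt_mem_nhds one_pos)
      filter_upwards [this] with n hn
      refine Eventually.of_forall fun x => ?_
      by_cases hx : x ∈ Metric.closedBall (0:VV) (R + 1)
      · rw [indicator_of_mem hx, Real.norm_of_nonneg (sq_nonneg _)]
        have a1 := hC (x + t n)
        have a2 := hC x
        rw [Real.norm_eq_abs, abs_le] at a1 a2
        exact sq_le_sq' (by linarith) (by linarith)
      · rw [indicator_of_notMem hx]
        rw [mem_closedBall_zero_iff] at hx; push Not at hx
        have b1 : f x = 0 := hR x (by linarith)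
        have b2 : f (x + t n) = 0 := by
          refine hR _ ?_
          have := norm_sub_le (x + t n) (t n)
          rw [add_sub_cancel_right] at this
          linarith
        simp [b1, b2]
    · rw [integrable_indicator_iff Metric.isClosed_closedBall.measurableSet]
      exact integrableOn_const (isCompact_closedBall 0 (R+1)).measure_lt_top.ne
    · refine Eventually.of_forall fun x => ?_
      have h1 : Tendsto (fun n => x + t n) atTop (𝓝 (x + 0)) := tendsto_const_nhds.add ht
      have h2 := (((hf.tendsto _).comp h1).sub_const (f x)).pow 2
      simpa using h2
  simpa [tau, N2] using key

lemma axis4 {f : VV → ℝ} (hf2 : MemLp f 2) (hf : Continuous f) {R : ℝ} (hR : ∀ x, R ≤ ‖x‖ → f x = 0)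
    (hrad : ∀ x y, ‖x‖ = ‖y‖ → f x = f y) (hp : 0 < N2 f) {w : ℕ → VV → ℝ} (hw : ∀ n, MemLp (w n) 2)
    (hs : ∀ n x (i : Fin 4), i ≠ 0 → w n (sg (ei i) 0 x) = w n x) {P : ℕ → VV}
    (hP : Tendsto (fun n => N2 fun x => w n (x + P n) - f x) atTop (𝓝 0)) :
    Tendsto (fun n => N2 fun x => w n x - f (x + (-(P n 0)) • ei 0)) atTop (𝓝 0) := by
  have a1 : ∀ n, N2 (fun x => w n x - f (x + -P n)) = N2 fun x => w n (x + P n) - f x := by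
    intro n
    rw [← N2_translate _ (P n)]
    congr 1; ext x; rw [add_neg_cancel_right]
  have a2 : ∀ n (i : Fin 4), i ≠ 0 → N2 (fun x => w n x - f (x + -(sg (ei i) 0 (P n)))) = N2 fun x => w n (x + P n) - f x := by
    intro n i hi
    rw [← a1, ← N2_comp (sg (ei i) 0) (sg_mp _ _) (w := fun x => w n x - f (x + -P n))]
    congr 1; ext x; rw [hs n x i hi]
    congr 1
    apply hrad
    rw [← sub_eq_add_neg, ← sub_eq_add_neg]
    have := sg_dist (ei i) 0 x (sg (ei i) 0 (P n))
    rw [sg_sg (ei_norm i)] at this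
    exact this.symm
  have a3 : ∀ n (i : Fin 4), i ≠ 0 → tau f (sg (ei i) 0 (P n) - P n) ≤ 4 * N2 fun x => w n (x + P n) - f x := by
    intro n i hi
    have h := N2_tri (memLp_tr hf2 (-P n)) (hw n) (memLp_tr hf2 (-(sg (ei i) 0 (P n))))
    rw [a2 n i hi] at h
    have e1 : N2 (fun x => f (x + -P n) - w n x) = N2 fun x => w n (x + P n) - f x := by
      rw [← a1]; unfold N2; congr 1; ext x; ring
    have e2 : N2 (fun x => f (x + -P n) - f (x + -(sg (ei i) 0 (P n)))) = tau f (sg (ei i) 0 (P n) - P n) := by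
      unfold tau
      rw [← N2_translate (fun x => f (x + -P n) - f (x + -(sg (ei i) 0 (P n)))) (sg (ei i) 0 (P n))]
      congr 1; ext x; rw [add_neg_cancel_right, sub_eq_add_neg (sg (ei i) 0 (P n)), add_assoc]
    rw [e1, e2] at h; linarith
  have a4 : ∀ i : Fin 4, i ≠ 0 → Tendsto (fun n => P n i) atTop (𝓝 0) := by
    intro i hi
    have h1 : Tendsto (fun n => tau f (sg (ei i) 0 (P n) - P n)) atTop (𝓝 0) := by
      refine squeeze_zero (fun n => N2_nonneg _) (fun n => a3 n i hi) ?_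
      simpa using hP.const_mul 4
    have h2 := tau_small hf2 hR hp h1
    have h3 : ∀ n, ‖sg (ei i) 0 (P n) - P n‖ = 2 * |P n i| := by
      intro n
      rw [sg_apply (ei_norm i), ei_inner, sub_zero, sub_sub_cancel_left, norm_neg, norm_smul, ei_norm, mul_one,
        Real.norm_eq_abs, abs_mul, abs_two]
    simp_rw [h3] at h2
    have h4 := h2.const_mul (2⁻¹)
    simp only [inv_mul_cancel_left₀ (two_ne_zero' ℝ), mul_zero] at h4
    exact (tendsto_zero_iff_abs_tendsto_zero _).2 h4
  have a5 : Tendsto (fun n => P n 0 • ei 0 - P n) atTop (𝓝 0) := by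
    rw [tendsto_zero_iff_norm_tendsto_zero]
    have e : ∀ n, ‖P n 0 • ei 0 - P n‖ = √(P n 1 ^ 2 + (P n 2 ^ 2 + P n 3 ^ 2)) := by
      intro n
      rw [← Real.sqrt_sq (norm_nonneg (P n 0 • ei 0 - P n)), norm_sq_VV]
      simp [ei]
    simp_rw [e]
    have := ((a4 1 (by decide)).pow 2).add (((a4 2 (by decide)).pow 2).add ((a4 3 (by decide)).pow 2))
    have h5 := (Real.continuous_sqrt.tendsto _).comp this
    simpa [Function.comp_def] using h5
  have a6 := tau_cont hf hR a5
  have a7 : ∀ n, N2 (fun x => f (x + -P n) - f (x + (-(P n 0)) • ei 0)) = tau f (P n 0 • ei 0 - P n) := by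
    intro n
    unfold tau
    rw [← N2_translate (fun x => f (x + -P n) - f (x + (-(P n 0)) • ei 0)) (P n 0 • ei 0)]
    congr 1; ext x; rw [neg_smul, add_neg_cancel_right, sub_eq_add_neg (P n 0 • ei 0), add_assoc]
  refine squeeze_zero (fun n => N2_nonneg _) (fun n => N2_tri (hw n) (memLp_tr hf2 (-P n)) (memLp_tr hf2 _)) ?_
  simp_rw [a1, a7]
  simpa using (hP.const_mul 2).add (a6.const_mul 2)

lemma Bf_cont {a : ℕ → VV → ℝ} {b : VV → ℝ} (ha : ∀ n, MemLp (a n) 2) (hb : MemLp b 2)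
    (h : Tendsto (fun n => N2 fun x => a n x - b x) atTop (𝓝 0)) :
    Tendsto (fun n => Bf gv (a n) (a n)) atTop (𝓝 (Bf gv b b)) ∧
    Tendsto (fun n => N2 (a n)) atTop (𝓝 (N2 b)) := by
  set d : ℕ → VV → ℝ := fun n x => a n x - b x with hd
  have hdm : ∀ n, MemLp (d n) 2 := fun n => (ha n).sub hb
  have hab : ∀ n, a n = fun x => b x + d n x := by intro n; ext x; simp [hd]
  have g1 : ∫ x, |gv x| = 1 := by
    rw [← gv_integral]; congr 1; ext x; exact abs_of_nonneg (gv_nonneg x)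
  constructor
  · have t1 : Tendsto (fun n => Bf gv b (d n)) atTop (𝓝 0) := by
      refine young_lim (K := 2⁻¹ * N2 b) (by have := N2_nonneg b; positivity) (by simpa using h.const_mul 2⁻¹) fun n s hs => ?_
      have := Bf_bound gv_integrable hb (hdm n) hs
      rw [g1] at this
      refine this.trans_eq ?_; ring
    have t2 : Tendsto (fun n => Bf gv (d n) (d n)) atTop (𝓝 0) := by
      refine squeeze_zero_norm (fun n => ?_) h
      have := Bf_bound_self gv_integrable (hdm n)
      rw [g1, one_mul] at this; exact this
    have e : ∀ n, Bf gv (a n) (a n) = Bf gv b b + 2 * Bf gv b (d n) + Bf gv (d n) (d n) := by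
      intro n
      rw [hab n, Bf_add_left gv_integrable hb (hdm n) (by exact hb.add (hdm n) : MemLp (fun x => b x + d n x) 2), Bf_add_right gv_integrable hb (hdm n) hb,
        Bf_add_right gv_integrable hb (hdm n) (hdm n), Bf_symm gv_neg (d n) b]
      ring
    simp_rw [e]
    simpa using ((t1.const_mul 2).const_add (Bf gv b b)).add t2
  · have t1 : Tendsto (fun n => ∫ x, b x * d n x) atTop (𝓝 0) := by
      refine young_lim (K := 2⁻¹ * N2 b) (by have := N2_nonneg b; positivity) (by simpa using h.const_mul 2⁻¹) fun n s hs => ?_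
      refine (L2young hb (hdm n) hs).trans_eq ?_; ring
    have e : ∀ n, N2 (a n) = N2 b + 2 * (∫ x, b x * d n x) + N2 (d n) := by
      intro n
      have i1 : Integrable (fun x => b x ^ 2) := L2sq hb
      have i2 : Integrable (fun x => 2 * (b x * d n x)) := (L2mul hb (hdm n)).const_mul 2
      have i3 : Integrable (fun x => d n x ^ 2) := L2sq (hdm n)
      have i4 : Integrable (fun x => b x ^ 2 + 2 * (b x * d n x)) := i1.add i2
      unfold N2
      rw [← integral_const_mul, ← integral_add i1 i2, ← integral_add i4 i3]
      congr 1; ext x; rw [hab n]; ring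
    simp_rw [e]
    have h5 := ((t1.const_mul 2).const_add (N2 b)).add h
    rw [mul_zero, add_zero, add_zero] at h5
    exact h5

end LambPart19

section LambPart20
open Set Topology

lemma wk_strong {u : ℕ → VV → ℝ} {v f : VV → ℝ} {q : VV} (hu : ∀ n, MemLp (u n) 2) (hf : MemLp f 2)
    (hwk : WkTo u v) (hvf : ∀ᵐ x, v (x + q) = f x)
    (hN : Tendsto (fun n => N2 (u n)) atTop (𝓝 (N2 f))) :
    Tendsto (fun n => N2 fun x => u n (x + q) - f x) atTop (𝓝 0) := by
  have h1 := hwk (fun x => f (x + -q)) (memLp_tr hf _)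
  have e1 : ∀ g : VV → ℝ, ∫ x, g x * f (x + -q) = ∫ x, g (x + q) * f x := by
    intro g
    rw [← integral_add_right_eq_self (fun x => g x * f (x + -q)) q]
    simp only [add_neg_cancel_right]
  simp_rw [e1] at h1
  have e2 : ∫ x, v (x + q) * f x = N2 f := by
    unfold N2; apply integral_congr_ae
    filter_upwards [hvf] with x hx; rw [hx]; ring
  rw [e2] at h1
  have e3 : ∀ n, N2 (fun x => u n (x + q) - f x) = N2 (u n) - 2 * (∫ x, u n (x + q) * f x) + N2 f := by
    intro n
    rw [← N2_translate (u n) q]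
    have i1 : Integrable (fun x => u n (x + q) ^ 2) := L2sq (memLp_tr (hu n) q)
    have i2 : Integrable (fun x => 2 * (u n (x + q) * f x)) := (L2mul (memLp_tr (hu n) q) hf).const_mul 2
    have i3 : Integrable (fun x => f x ^ 2) := L2sq hf
    have i4 : Integrable (fun x => u n (x + q) ^ 2 - 2 * (u n (x + q) * f x)) := i1.sub i2
    unfold N2
    rw [← integral_const_mul, ← integral_sub i1 i2, ← integral_add i4 i3]
    congr 1; ext x; ring
  simp_rw [e3]
  have := (hN.sub (h1.const_mul 2)).add_const (N2 f)
  rwa [show N2 f - 2 * N2 f + N2 f = 0 by ring] at this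

lemma core4 {lam : ℝ} (hl : 1 < lam) {f : VV → ℝ} (hM : IsMx lam f) (hf : Continuous f) {R : ℝ}
    (hR : ∀ x, R ≤ ‖x‖ → f x = 0) (hrad : ∀ x y, ‖x‖ = ‖y‖ → f x = f y) (hpos : 0 < ∫ x, f x)
    (huniq : ∀ v, IsMx lam v → ∫ x, v x = ∫ x, f x → ∃ p, ∀ᵐ x, v (x + p) = f x)
    {w : ℕ → VV → ℝ} (hw : ∀ n, Adm (w n))
    (hs : ∀ n x (i : Fin 4), i ≠ 0 → w n (sg (ei i) 0 x) = w n x)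
    (hI : Tendsto (fun n => ∫ x, w n x) atTop (𝓝 (∫ x, f x)))
    (hN : Tendsto (fun n => N2 (w n)) atTop (𝓝 (N2 f)))
    (hB : Tendsto (fun n => Bf gv (w n) (w n)) atTop (𝓝 (Bf gv f f))) :
    ∃ φ : ℕ → ℕ, StrictMono φ ∧ ∃ c : ℕ → ℝ,
      Tendsto (fun n => N2 fun x => w (φ n) x - f (x + c n • ei 0)) atTop (𝓝 0) := by
  obtain ⟨K, hK⟩ := hN.bddAbove_range
  have hD : Tendsto (fun n => Df lam (w n)) atTop (𝓝 (Cst lam * (∫ x, f x) ^ 2)) := by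
    rw [← hM.2]
    exact hB.sub (hN.const_mul _)
  obtain ⟨φ, hφ, p, v, hv, hv1, hv2, hwk⟩ := concentration hl hpos hw (fun n => hK ⟨n, rfl⟩) hI hD
  obtain ⟨q, hq⟩ := huniq v ⟨hv, by rw [hv1]; exact hv2⟩ hv1
  have hu : ∀ n, MemLp (fun x => w (φ n) (x + p n)) 2 := fun n => memLp_tr (hw _).l2 _
  have hN' : Tendsto (fun n => N2 fun x => w (φ n) (x + p n)) atTop (𝓝 (N2 f)) := by
    simp_rw [N2_translate]
    exact hN.comp hφ.tendsto_atTop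
  have h1 := wk_strong hu hM.1.l2 hwk hq hN'
  have hN0 : 0 < N2 f := by
    rcases (N2_nonneg f).lt_or_eq with h | h
    · exact h
    · exfalso
      have h2 : (fun x => f x ^ 2) =ᵐ[volume] 0 :=
        (integral_eq_zero_iff_of_nonneg (fun x => sq_nonneg _) (L2sq hM.1.l2)).1 h.symm
      have h3 : ∫ x, f x = 0 := integral_eq_zero_of_ae (h2.mono fun x hx => by simpa using hx)
      linarith
  have h2 := axis4 hM.1.l2 hf hR hrad hN0 (w := fun n => w (φ n)) (fun n => (hw _).l2) (fun n x i hi => hs _ x i hi)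
    (P := fun n => q + p n) (by simpa only [add_assoc] using h1)
  exact ⟨φ, hφ, fun n => -((q + p n) 0), h2⟩

end LambPart20

section LambPart21
open Set Topology

lemma scheffe {α : Type*} [MeasurableSpace α] {μ : Measure α} {h z o : α → ℝ} {S : Set α} {H m s : ℝ}
    (hs : 0 < s) (hS : MeasurableSet S) (hSf : μ S ≠ ⊤) (hSm : (μ S).toReal ≤ m)
    (hh : ∀ᵐ x ∂μ, 0 ≤ h x) (hz : ∀ x, 0 ≤ z x) (ho : ∀ᵐ x ∂μ, x ∉ S → o x = 0) (hH0 : 0 ≤ H)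
    (hH : ∀ᵐ x ∂μ, x ∈ S → h x ≤ H)
    (i1 : Integrable (fun x => h x * z x) μ) (i2 : Integrable (fun x => h x * o x) μ)
    (i3 : Integrable (fun x => (z x - o x) ^ 2) μ) :
    ∫ x, h x * |z x - o x| ∂μ ≤ (∫ x, h x * z x ∂μ - ∫ x, h x * o x ∂μ) + (s * (2 * H * m) + s⁻¹ * (2 * H * ∫ x, (z x - o x) ^ 2 ∂μ)) := by
  have j1 : Integrable (S.indicator fun _ => (1:ℝ)) μ := by
    rw [integrable_indicator_iff hS]; exact integrableOn_const hSf
  have j2 : Integrable (fun x => h x * z x - h x * o x) μ := i1.sub i2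
  have j3 : Integrable (fun x => s * (2 * H) * (S.indicator (fun _ => (1:ℝ)) x)) μ := j1.const_mul _
  have j4 : Integrable (fun x => s⁻¹ * (2 * H) * (z x - o x) ^ 2) μ := i3.const_mul _
  have j5 : Integrable (fun x => s * (2 * H) * (S.indicator (fun _ => (1:ℝ)) x) + s⁻¹ * (2 * H) * (z x - o x) ^ 2) μ := j3.add j4
  have j6 : Integrable (fun x => h x * |z x - o x|) μ := by
    refine (j2.abs).congr ?_
    filter_upwards [hh] with x hx
    rw [← mul_sub, abs_mul, abs_of_nonneg hx]
  have key : ∫ x, h x * |z x - o x| ∂μ ≤ ∫ x, ((h x * z x - h x * o x) + (s * (2 * H) * (S.indicator (fun _ => (1:ℝ)) x) + s⁻¹ * (2 * H) * (z x - o x) ^ 2)) ∂μ := by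
    refine integral_mono_ae j6 (j2.add j5) ?_
    filter_upwards [hh, ho, hH] with x hx hox hHx
    have hsq : 0 ≤ s⁻¹ * (2 * H) * (z x - o x) ^ 2 := by positivity
    rcases le_or_gt (o x) (z x) with hle | hlt
    · have : 0 ≤ S.indicator (fun _ => (1:ℝ)) x := indicator_nonneg (fun _ _ => zero_le_one) x
      rw [abs_of_nonneg (by linarith)]
      have : 0 ≤ s * (2 * H) * S.indicator (fun _ => (1:ℝ)) x := by positivity
      nlinarith
    · have hxS : x ∈ S := by
        by_contra hx'
        rw [hox hx'] at hlt; linarith [hz x]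
      rw [indicator_of_mem hxS, abs_of_neg (by linarith)]
      set d := o x - z x with hd
      have hd0 : 0 < d := by simp only [hd]; linarith
      have e1 : (z x - o x) ^ 2 = d ^ 2 := by rw [hd]; ring
      rw [e1]
      have e2 : d ≤ s + s⁻¹ * d ^ 2 := by
        rw [inv_mul_eq_div, ← sub_le_iff_le_add', le_div_iff₀ hs]; nlinarith [sq_nonneg (d - s)]
      have e3 : h x * d ≤ H * (s + s⁻¹ * d ^ 2) := mul_le_mul (hHx hxS) e2 hd0.le hH0
      have e4 : h x * z x - h x * o x = - (h x * d) := by rw [hd]; ring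
      have e5 : h x * -(z x - o x) = h x * d := by rw [hd]; ring
      rw [e4, e5]; nlinarith
  rw [integral_add j2 j5, integral_sub i1 i2, integral_add j3 j4, integral_const_mul, integral_const_mul,
    integral_indicator hS, setIntegral_const] at key
  refine key.trans ?_
  have : μ.real S • (1:ℝ) ≤ m := by simpa [Measure.real] using hSm
  have : s * (2 * H) * (μ.real S • (1:ℝ)) ≤ s * (2 * H) * m := by gcongr
  linarith

lemma scheffe_lim {α : Type*} [MeasurableSpace α] {μ : Measure α} {h : α → ℝ} {z o : ℕ → α → ℝ} {S : ℕ → Set α} {H m : ℝ}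
    (hS : ∀ n, MeasurableSet (S n)) (hSf : ∀ n, μ (S n) ≠ ⊤) (hSm : ∀ n, (μ (S n)).toReal ≤ m)
    (hh : ∀ᵐ x ∂μ, 0 ≤ h x) (hz : ∀ n x, 0 ≤ z n x) (ho : ∀ n, ∀ᵐ x ∂μ, x ∉ S n → o n x = 0) (hH0 : 0 ≤ H)
    (hH : ∀ n, ∀ᵐ x ∂μ, x ∈ S n → h x ≤ H)
    (i1 : ∀ n, Integrable (fun x => h x * z n x) μ) (i2 : ∀ n, Integrable (fun x => h x * o n x) μ)
    (i3 : ∀ n, Integrable (fun x => (z n x - o n x) ^ 2) μ)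
    (t1 : Tendsto (fun n => ∫ x, h x * z n x ∂μ - ∫ x, h x * o n x ∂μ) atTop (𝓝 0))
    (t2 : Tendsto (fun n => ∫ x, (z n x - o n x) ^ 2 ∂μ) atTop (𝓝 0)) :
    Tendsto (fun n => ∫ x, h x * |z n x - o n x| ∂μ) atTop (𝓝 0) := by
  have hm : 0 ≤ m := ENNReal.toReal_nonneg.trans (hSm 0)
  have t3 : Tendsto (fun n => max (∫ x, h x * |z n x - o n x| ∂μ - (∫ x, h x * z n x ∂μ - ∫ x, h x * o n x ∂μ)) 0) atTop (𝓝 0) := by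
    refine young_lim (K := 2 * H * m) (A := fun n => 2 * H * ∫ x, (z n x - o n x) ^ 2 ∂μ) (by positivity)
      (by simpa using t2.const_mul (2 * H)) fun n s hs => ?_
    rw [abs_of_nonneg (le_max_right _ _)]
    have := scheffe hs (hS n) (hSf n) (hSm n) hh (hz n) (ho n) hH0 (hH n) (i1 n) (i2 n) (i3 n)
    have h0 : 0 ≤ ∫ x, (z n x - o n x) ^ 2 ∂μ := integral_nonneg fun _ => sq_nonneg _
    refine max_le (by linarith) (by positivity)
  refine squeeze_zero (fun n => integral_nonneg_of_ae (hh.mono fun x hx => mul_nonneg hx (abs_nonneg _)))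
    (fun n => ?_) (by simpa using t3.add t1)
  linarith [le_max_left (∫ x, h x * |z n x - o n x| ∂μ - (∫ x, h x * z n x ∂μ - ∫ x, h x * o n x ∂μ)) 0]

/-- the dipole written through its profile -/
noncomputable def om (V : ℝ → ℝ) (x : ℝ × ℝ) : ℝ := if 0 < x.2 then x.2 * V (rad x ^ 2) else 0

lemma om_meas {V : ℝ → ℝ} (hV : Continuous V) : Measurable (om V) := by
  unfold om
  refine Measurable.ite (measurableSet_lt measurable_const measurable_snd) ?_ measurable_const
  refine measurable_snd.mul (hV.measurable.comp ?_)
  unfold rad; fun_prop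

lemma om_nonneg {V : ℝ → ℝ} (hV : ∀ q, 0 ≤ V q) (x : ℝ × ℝ) : 0 ≤ om V x := by
  unfold om; split_ifs with h
  · exact mul_nonneg h.le (hV _)
  · exact le_rfl

lemma rad_sq (x : ℝ × ℝ) : rad x ^ 2 = x.1 ^ 2 + x.2 ^ 2 := Real.sq_sqrt (by positivity)

def boxS (R c : ℝ) : Set (ℝ × ℝ) := Icc (-R - c) (R - c) ×ˢ Icc 0 R

lemma boxS_meas (R c : ℝ) : MeasurableSet (boxS R c) := measurableSet_Icc.prod measurableSet_Icc

lemma boxS_vol (R c : ℝ) : (volume.restrict UHP) (boxS R c) ≤ ENNReal.ofReal (2 * R) * ENNReal.ofReal R := by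
  refine (Measure.restrict_apply_le _ _).trans ?_
  unfold boxS
  rw [Measure.volume_eq_prod, Measure.prod_prod, Real.volume_Icc, Real.volume_Icc]
  apply le_of_eq; congr 2 <;> ring

lemma om_zero {V : ℝ → ℝ} {R : ℝ} (hR0 : 0 ≤ R) (hR : ∀ q, R ^ 2 ≤ q → V q = 0) {c : ℝ} {x : ℝ × ℝ} (hx : x ∉ boxS R c) :
    om V (x + (c, 0)) = 0 := by
  unfold om
  split_ifs with h
  · rw [hR, mul_zero]
    rw [rad_sq]
    simp only [Prod.fst_add, Prod.snd_add, add_zero] at h ⊢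
    by_contra! hlt
    apply hx
    have a1 : (x.1 + c) ^ 2 < R ^ 2 := by nlinarith [sq_nonneg x.2]
    have a2 : x.2 ^ 2 < R ^ 2 := by nlinarith [sq_nonneg (x.1 + c)]
    have a3 := abs_le.1 (abs_le_of_sq_le_sq a1.le hR0)
    have a4 := abs_le_of_sq_le_sq a2.le hR0
    rw [abs_of_pos h] at a4
    exact ⟨⟨by linarith [a3.1], by linarith [a3.2]⟩, h.le, a4⟩
  · rfl

lemma tr_mp (c : ℝ) : MeasurePreserving (MeasurableEquiv.addRight ((c, 0) : ℝ × ℝ)) (volume.restrict UHP) (volume.restrict UHP) := by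
  have h : MeasurePreserving (MeasurableEquiv.addRight ((c, 0) : ℝ × ℝ)) volume volume := measurePreserving_add_right volume _
  have := h.restrict_preimage UHP_meas
  have e : (MeasurableEquiv.addRight ((c, 0) : ℝ × ℝ)) ⁻¹' UHP = UHP := by
    ext x; simp [UHP, MeasurableEquiv.addRight]
  rwa [e] at this

lemma tr_int (c : ℝ) (F : ℝ × ℝ → ℝ) : ∫ x in UHP, F (x + (c, 0)) = ∫ x in UHP, F x :=
  (tr_mp c).integral_comp (MeasurableEquiv.measurableEmbedding _) F

lemma tr_integrable {c : ℝ} {F : ℝ × ℝ → ℝ} (h : IntegrableOn F UHP) : IntegrableOn (fun x => F (x + (c, 0))) UHP :=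
  (tr_mp c).integrable_comp_of_integrable h

lemma lf_om {V : ℝ → ℝ} {c : ℝ} {x : VV} (hx : 0 < rho x) : lf (fun y => om V (y + (c, 0))) x = V (‖x + c • ei 0‖ ^ 2) := by
  have h1 : 0 < (pr x + (c, 0)).2 := by simpa [pr] using hx
  unfold lf om; beta_reduce
  rw [if_pos h1, rad_sq, norm_sq_VV]
  simp only [pr, Prod.fst_add, Prod.snd_add, add_zero, rho_sq]
  rw [mul_div_cancel_left₀ _ hx.ne']
  simp [ei]

end LambPart21

section LambPart22
open Set Topology

lemma normL2_sq (f : ℝ × ℝ → ℝ) : normL2 f ^ 2 = ∫ x in UHP, f x ^ 2 := by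
  unfold normL2
  rw [← Real.sqrt_eq_rpow, Real.sq_sqrt (integral_nonneg fun _ => sq_nonneg _)]

lemma normL1_nonneg (f : ℝ × ℝ → ℝ) : 0 ≤ normL1 f := integral_nonneg fun _ => abs_nonneg _
lemma normL2_nonneg (f : ℝ × ℝ → ℝ) : 0 ≤ normL2 f := by
  unfold normL2; exact Real.rpow_nonneg (integral_nonneg fun _ => sq_nonneg _) _

structure Good (z : ℕ → ℝ × ℝ → ℝ) : Prop where
  ms : ∀ n, Measurable (z n)
  nn : ∀ n x, 0 ≤ z n x
  i1 : ∀ n, IntegrableOn (z n) UHP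
  i2 : ∀ n, IntegrableOn (fun x => z n x ^ 2) UHP
  iw : ∀ n, IntegrableOn (fun x => x.2 * z n x) UHP

lemma lf_sym (z : ℝ × ℝ → ℝ) (x : VV) (i : Fin 4) (hi : i ≠ 0) : lf z (sg (ei i) 0 x) = lf z x := by
  have h := pr_sg (ei_norm i) (by simp [ei, hi.symm]) x
  have h2 : rho (sg (ei i) 0 x) = rho x := congrArg Prod.snd h
  unfold lf; rw [h, h2]

lemma int_close {z o : ℝ × ℝ → ℝ} (hz : IntegrableOn z UHP) (ho : IntegrableOn o UHP) :
    |(∫ x in UHP, z x) - ∫ x in UHP, o x| ≤ normL1 fun x => z x - o x := by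
  rw [← integral_sub hz ho]
  exact abs_integral_le_integral_abs

lemma sqrt_lim {X : ℕ → ℝ} (h : Tendsto (fun n => X n ^ 2) atTop (𝓝 0)) (h0 : ∀ n, 0 ≤ X n) : Tendsto X atTop (𝓝 0) := by
  have := (Real.continuous_sqrt.tendsto _).comp h
  simpa [Function.comp_def, Real.sqrt_sq (h0 _)] using this

lemma core2 {lam : ℝ} (hl : 1 < lam) {V : ℝ → ℝ} (hV : Continuous V) (hV0 : ∀ q, 0 ≤ V q) {R : ℝ} (hR0 : 0 < R)
    (hR : ∀ q, R ^ 2 ≤ q → V q = 0)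
    {f : VV → ℝ} (hf : f = fun x => V (‖x‖ ^ 2)) (hM : IsMx lam f) (hpos : 0 < ∫ x, f x)
    (huniq : ∀ v, IsMx lam v → ∫ x, v x = ∫ x, f x → ∃ p, ∀ᵐ x, v (x + p) = f x)
    {z₀ z : ℕ → ℝ × ℝ → ℝ} (g₀ : Good z₀) (g : Good z)
    (hE : ∀ n, kineticE (z n) = kineticE (z₀ n)) (hI : ∀ n, impulse (z n) = impulse (z₀ n))
    (h1 : ∀ n, normL1 (z n) = normL1 (z₀ n)) (h2 : ∀ n, normL2 (z n) = normL2 (z₀ n))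
    {c : ℕ → ℝ}
    (hd : Tendsto (fun n => normL1 (fun x => z₀ n x - om V (x + (c n, 0))) + normL2 (fun x => z₀ n x - om V (x + (c n, 0))) +
      normL1 (fun x => x.2 * (z₀ n x - om V (x + (c n, 0))))) atTop (𝓝 0)) :
    ∃ φ : ℕ → ℕ, ∃ c : ℕ → ℝ, Tendsto (fun n => normL1 (fun x => z (φ n) x - om V (x + (c n, 0))) + normL2 (fun x => z (φ n) x - om V (x + (c n, 0))) +
      normL1 (fun x => x.2 * (z (φ n) x - om V (x + (c n, 0))))) atTop (𝓝 0) := by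
  have hfc : Continuous f := by rw [hf]; fun_prop
  have hom := om_meas hV
  have homc : ∀ c : ℝ, Measurable fun x => om V (x + (c, 0)) := fun c => hom.comp (measurable_id.add_const _)
  have hlf : ∀ c : ℝ, lf (fun y => om V (y + (c, 0))) =ᵐ[volume] fun x => f (x + c • ei 0) := by
    intro c
    filter_upwards [rho_pos_ae] with x hx
    rw [lf_om hx, hf]
  have hlf0 : lf (om V) =ᵐ[volume] f := by
    have := hlf 0
    simpa [Prod.mk_zero_zero] using this
  -- integrability of the dipole
  have o2 : IntegrableOn (fun x => om V x ^ 2) UHP := by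
    rw [← lf_sq_int hom]
    exact (L2sq hM.1.l2).congr (hlf0.mono fun x hx => by simp only [hx])
  have ow : IntegrableOn (fun x => x.2 * om V x) UHP := by
    rw [← lf_int hom]
    exact hM.1.l1.congr hlf0.symm
  have hbt : (volume.restrict UHP) (boxS R 0) ≠ ⊤ := ((boxS_vol R 0).trans_lt (ENNReal.mul_lt_top ENNReal.ofReal_lt_top ENNReal.ofReal_lt_top)).ne
  have o1 : IntegrableOn (om V) UHP := by
    have j1 : IntegrableOn ((boxS R 0).indicator fun _ => (1:ℝ)) UHP := by
      rw [IntegrableOn, integrable_indicator_iff (boxS_meas R 0)]; exact integrableOn_const hbt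
    refine Integrable.mono' (j1.add o2) hom.aestronglyMeasurable (Eventually.of_forall fun x => ?_)
    rw [Real.norm_of_nonneg (om_nonneg hV0 x)]
    simp only [Pi.add_apply]
    by_cases hx : x ∈ boxS R 0
    · rw [indicator_of_mem hx]; nlinarith [sq_nonneg (om V x - 1)]
    · have := om_zero hR0.le hR hx
      simp only [Prod.mk_zero_zero, add_zero] at this
      rw [indicator_of_notMem hx, this]; simp
  have o1c : ∀ c : ℝ, IntegrableOn (fun x => om V (x + (c, 0))) UHP := fun c => tr_integrable o1
  have o2c : ∀ c : ℝ, IntegrableOn (fun x => om V (x + (c, 0)) ^ 2) UHP := fun c => tr_integrable (F := fun x => om V x ^ 2) o2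
  have owc : ∀ c : ℝ, IntegrableOn (fun x => x.2 * om V (x + (c, 0))) UHP := fun c => by
    simpa using tr_integrable (c := c) (F := fun x => x.2 * om V x) ow
  have I1 : ∀ c : ℝ, ∫ x in UHP, om V (x + (c, 0)) = ∫ x in UHP, om V x := fun c => tr_int c (om V)
  have Iw : ∀ c : ℝ, ∫ x in UHP, x.2 * om V (x + (c, 0)) = ∫ x in UHP, x.2 * om V x := fun c => by
    simpa using tr_int c (fun x => x.2 * om V x)
  have dif2 : ∀ {u : ℝ × ℝ → ℝ} (c : ℝ), Measurable u → IntegrableOn (fun x => u x ^ 2) UHP →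
      IntegrableOn (fun x => (u x - om V (x + (c, 0))) ^ 2) UHP := by
    intro u c hu hu2
    have m1 := (memLp_two_iff_integrable_sq hu.aestronglyMeasurable).2 hu2
    have m2 := (memLp_two_iff_integrable_sq (homc c).aestronglyMeasurable).2 (o2c c)
    exact (m1.sub m2).integrable_sq
  have dN : ∀ {u : ℝ × ℝ → ℝ} (c : ℝ), Measurable u →
      N2 (fun x => lf u x - f (x + c • ei 0)) = 4 * π * ∫ x in UHP, (u x - om V (x + (c, 0))) ^ 2 := by
    intro u c hu
    rw [← lf_N2 (f := fun x => u x - om V (x + (c, 0))) (hu.sub (homc c))]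
    unfold N2
    apply integral_congr_ae
    filter_upwards [hlf c] with x hx
    rw [← hx]; unfold lf; ring
  -- the initial data
  have t0 : ∀ {X : ℕ → ℝ}, (∀ n, |X n| ≤ normL1 (fun x => z₀ n x - om V (x + (c n, 0))) + normL2 (fun x => z₀ n x - om V (x + (c n, 0))) +
      normL1 (fun x => x.2 * (z₀ n x - om V (x + (c n, 0))))) → Tendsto X atTop (𝓝 0) := fun h => squeeze_zero_norm h hd
  have tA : Tendsto (fun n => ∫ x in UHP, (z₀ n x - om V (x + (c n, 0))) ^ 2) atTop (𝓝 0) := by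
    simp_rw [← normL2_sq]
    have : Tendsto (fun n => normL2 (fun x => z₀ n x - om V (x + (c n, 0)))) atTop (𝓝 0) := t0 fun n => by
      rw [abs_of_nonneg (normL2_nonneg _)]
      linarith [normL1_nonneg (fun x => z₀ n x - om V (x + (c n, 0))), normL1_nonneg (fun x => x.2 * (z₀ n x - om V (x + (c n, 0))))]
    simpa using this.pow 2
  have t1 : Tendsto (fun n => (∫ x in UHP, z n x) - ∫ x in UHP, om V x) atTop (𝓝 0) := t0 fun n => by
    have e : ∫ x in UHP, z n x = ∫ x in UHP, z₀ n x := by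
      have := h1 n
      unfold normL1 at this
      simpa only [abs_of_nonneg (g.nn n _), abs_of_nonneg (g₀.nn n _)] using this
    rw [e, ← I1 (c n)]
    have := int_close (g₀.i1 n) (o1c (c n))
    linarith [normL2_nonneg (fun x => z₀ n x - om V (x + (c n, 0))), normL1_nonneg (fun x => x.2 * (z₀ n x - om V (x + (c n, 0))))]
  have tw : Tendsto (fun n => (∫ x in UHP, x.2 * z n x) - ∫ x in UHP, x.2 * om V x) atTop (𝓝 0) := t0 fun n => by
    have e : ∫ x in UHP, x.2 * z n x = ∫ x in UHP, x.2 * z₀ n x := hI n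
    rw [e, ← Iw (c n)]
    have := int_close (g₀.iw n) (owc (c n))
    simp only [← mul_sub] at this
    linarith [normL2_nonneg (fun x => z₀ n x - om V (x + (c n, 0))), normL1_nonneg (fun x => z₀ n x - om V (x + (c n, 0)))]
  -- four dimensional limits
  have m0 : ∀ n, MemLp (lf (z₀ n)) 2 := fun n => lf_memLp (g₀.ms n) (g₀.i2 n)
  have tN0 : Tendsto (fun n => N2 fun x => lf (z₀ n) (x + (-(c n)) • ei 0) - f x) atTop (𝓝 0) := by
    have e : ∀ n, N2 (fun x => lf (z₀ n) (x + (-(c n)) • ei 0) - f x) = 4 * π * ∫ x in UHP, (z₀ n x - om V (x + (c n, 0))) ^ 2 := by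
      intro n
      rw [← dN (c n) (g₀.ms n), ← N2_translate (fun x => lf (z₀ n) x - f (x + c n • ei 0)) ((-(c n)) • ei 0)]
      congr 1; ext x; rw [neg_smul, neg_add_cancel_right]
    simp_rw [e]
    simpa using tA.const_mul (4 * π)
  obtain ⟨tB, tN⟩ := Bf_cont (fun n => memLp_tr (m0 n) ((-(c n)) • ei 0)) hM.1.l2 tN0
  simp_rw [Bf_translate] at tB
  simp_rw [N2_translate] at tN
  have hB : Tendsto (fun n => Bf gv (lf (z n)) (lf (z n))) atTop (𝓝 (Bf gv f f)) := by
    refine tB.congr fun n => ?_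
    rw [lf_energy (g.ms n) (g.nn n) (g.i2 n), lf_energy (g₀.ms n) (g₀.nn n) (g₀.i2 n), hE n]
  have hN : Tendsto (fun n => N2 (lf (z n))) atTop (𝓝 (N2 f)) := by
    refine tN.congr fun n => ?_
    rw [lf_N2 (g.ms n), lf_N2 (g₀.ms n), ← normL2_sq, ← normL2_sq, h2 n]
  have hIf : ∫ x, f x = 4 * π * ∫ x in UHP, x.2 * om V x := by
    rw [← lf_integral hom]; exact integral_congr_ae hlf0.symm
  have hIz : Tendsto (fun n => ∫ x, lf (z n) x) atTop (𝓝 (∫ x, f x)) := by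
    have e : ∀ n, ∫ x, lf (z n) x = 4 * π * ((∫ x in UHP, x.2 * z n x) - ∫ x in UHP, x.2 * om V x) + ∫ x, f x := by
      intro n; rw [lf_integral (g.ms n), hIf]; ring
    simp_rw [e]
    simpa using (tw.const_mul (4 * π)).add_const (∫ x, f x)
  obtain ⟨φ, hφ, c', hc'⟩ := core4 hl hM hfc (R := R) (by
      intro x hx; rw [hf]; exact hR _ (by gcongr)) (by intro x y hxy; rw [hf]; simp only [hxy]) hpos huniq
    (w := fun n => lf (z n)) (fun n => lf_Adm (g.ms n) (g.nn n) (g.i2 n) (g.iw n)) (fun n x i hi => lf_sym _ x i hi) hIz hN hB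
  refine ⟨φ, c', ?_⟩
  have tA' : Tendsto (fun n => ∫ x in UHP, (z (φ n) x - om V (x + (c' n, 0))) ^ 2) atTop (𝓝 0) := by
    have e : ∀ n, N2 (fun x => lf (z (φ n)) x - f (x + c' n • ei 0)) = 4 * π * ∫ x in UHP, (z (φ n) x - om V (x + (c' n, 0))) ^ 2 :=
      fun n => dN (c' n) (g.ms _)
    simp_rw [e] at hc'
    have := hc'.const_mul (4 * π)⁻¹
    simpa only [inv_mul_cancel_left₀ (by positivity : (4 * π) ≠ 0), mul_zero] using this
  have bfin : ∀ c, (volume.restrict UHP) (boxS R c) ≠ ⊤ := fun c => ((boxS_vol R c).trans_lt (ENNReal.mul_lt_top ENNReal.ofReal_lt_top ENNReal.ofReal_lt_top)).ne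
  have bm : ∀ c, ((volume.restrict UHP) (boxS R c)).toReal ≤ 2 * R * R := fun c => by
    have := ENNReal.toReal_mono (ENNReal.mul_lt_top ENNReal.ofReal_lt_top ENNReal.ofReal_lt_top).ne (boxS_vol R c)
    rwa [ENNReal.toReal_mul, ENNReal.toReal_ofReal (by positivity), ENNReal.toReal_ofReal hR0.le] at this
  have s1 := scheffe_lim (μ := volume.restrict UHP) (h := fun _ => 1) (z := fun n => z (φ n)) (o := fun n x => om V (x + (c' n, 0)))
    (S := fun n => boxS R (c' n)) (H := 1) (m := 2 * R * R) (fun n => boxS_meas _ _) (fun n => bfin _) (fun n => bm _)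
    (Eventually.of_forall fun _ => zero_le_one) (fun n x => g.nn _ x) (fun n => Eventually.of_forall fun x hx => om_zero hR0.le hR hx)
    zero_le_one (fun n => Eventually.of_forall fun _ _ => le_rfl) (fun n => by simp only [one_mul]; exact g.i1 (φ n)) (fun n => by simp only [one_mul]; exact o1c _)
    (fun n => dif2 _ (g.ms _) (g.i2 _)) (by
      simp only [one_mul, I1]; exact t1.comp hφ.tendsto_atTop) tA'
  have sw := scheffe_lim (μ := volume.restrict UHP) (h := fun x => x.2) (z := fun n => z (φ n)) (o := fun n x => om V (x + (c' n, 0)))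
    (S := fun n => boxS R (c' n)) (H := R) (m := 2 * R * R) (fun n => boxS_meas _ _) (fun n => bfin _) (fun n => bm _)
    ((ae_restrict_mem UHP_meas).mono fun x (hx : 0 < x.2) => hx.le) (fun n x => g.nn _ x) (fun n => Eventually.of_forall fun x hx => om_zero hR0.le hR hx)
    hR0.le (fun n => Eventually.of_forall fun _ hx => hx.2.2) (fun n => g.iw (φ n)) (fun n => owc (c' n))
    (fun n => dif2 _ (g.ms _) (g.i2 _)) (by
      simp only [Iw]; exact tw.comp hφ.tendsto_atTop) tA'
  have n2 : Tendsto (fun n => normL2 (fun x => z (φ n) x - om V (x + (c' n, 0)))) atTop (𝓝 0) :=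
    sqrt_lim (by simpa only [normL2_sq] using tA') (fun n => normL2_nonneg _)
  have n1 : Tendsto (fun n => normL1 (fun x => z (φ n) x - om V (x + (c' n, 0)))) atTop (𝓝 0) := by
    simpa only [normL1, one_mul] using s1
  have nw : Tendsto (fun n => normL1 (fun x => x.2 * (z (φ n) x - om V (x + (c' n, 0))))) atTop (𝓝 0) := by
    refine sw.congr fun n => ?_
    unfold normL1
    refine setIntegral_congr_fun UHP_meas fun x (hx : 0 < x.2) => ?_
    simp only [abs_mul, abs_of_pos hx]
  simpa using (n1.add n2).add nw

end LambPart22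

section LambPart23
open Set Topology

lemma meas_replace {u : ℝ × ℝ → ℝ} (h : NonnegL1L2 u) (hw : IntegrableOn (fun x => x.2 * u x) UHP) :
    ∃ v : ℝ × ℝ → ℝ, Measurable v ∧ (∀ x, 0 ≤ v x) ∧ v =ᵐ[volume.restrict UHP] u ∧ IntegrableOn v UHP ∧
      IntegrableOn (fun x => v x ^ 2) UHP ∧ IntegrableOn (fun x => x.2 * v x) UHP ∧ kineticE v = kineticE u ∧
      impulse v = impulse u ∧ normL1 v = normL1 u ∧ normL2 v = normL2 u ∧
      ∀ S, distToSet S v = distToSet S u := by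
  obtain ⟨hn, h1, h2⟩ := h
  set m := h1.aestronglyMeasurable.mk u with hm
  have hme : u =ᵐ[volume.restrict UHP] m := h1.aestronglyMeasurable.ae_eq_mk
  have hmm : Measurable m := h1.aestronglyMeasurable.stronglyMeasurable_mk.measurable
  have e : (fun x => max (m x) 0) =ᵐ[volume.restrict UHP] u := by
    filter_upwards [hme, ae_restrict_mem UHP_meas] with x hx hxU
    rw [← hx, max_eq_left (hn x hxU)]
  set v : ℝ × ℝ → ℝ := fun x => max (m x) 0 with hv
  have hG : Gop v = Gop u := by
    ext x; unfold Gop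
    exact integral_congr_ae (e.mono fun y hy => by simp only [hy])
  have c1 : ∀ o : ℝ × ℝ → ℝ, normL1 (fun x => v x - o x) = normL1 (fun x => u x - o x) := fun o =>
    integral_congr_ae (e.mono fun y hy => by simp only [hy])
  have c2 : ∀ o : ℝ × ℝ → ℝ, normL2 (fun x => v x - o x) = normL2 (fun x => u x - o x) := fun o => by
    unfold normL2
    rw [integral_congr_ae (e.mono fun y hy => by simp only [hy] : _ =ᵐ[volume.restrict UHP] fun x => (u x - o x) ^ 2)]
  have c3 : ∀ o : ℝ × ℝ → ℝ, normL1 (fun x => x.2 * (v x - o x)) = normL1 (fun x => x.2 * (u x - o x)) := fun o =>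
    integral_congr_ae (e.mono fun y hy => by simp only [hy])
  refine ⟨v, hmm.max measurable_const, fun x => le_max_right _ _, e, h1.congr e.symm,
    h2.congr (e.mono fun y hy => by simp only [hy]), hw.congr (e.mono fun y hy => by simp only [hy]), ?_, ?_, ?_, ?_, ?_⟩
  · unfold kineticE; rw [hG]; congr 1
    exact integral_congr_ae (e.mono fun y hy => by simp only [hy])
  · exact integral_congr_ae (e.mono fun y hy => by simp only [hy])
  · simpa using c1 (fun _ => 0)
  · simpa using c2 (fun _ => 0)
  · intro S; unfold distToSet; simp only [c1, c2, c3]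

lemma seq_final {lam W : ℝ} (hl : 1 < lam) (hW : 0 < W) {z₀ z : ℕ → ℝ × ℝ → ℝ} (g₀ : Good z₀) (g : Good z)
    (hE : ∀ n, kineticE (z n) = kineticE (z₀ n)) (hI : ∀ n, impulse (z n) = impulse (z₀ n))
    (h1 : ∀ n, normL1 (z n) = normL1 (z₀ n)) (h2 : ∀ n, normL2 (z n) = normL2 (z₀ n))
    (hd : ∀ n : ℕ, distToSet {f | ∃ c : ℝ, f = fun x => omegaL lam W (x + (c, 0))} (z₀ n) ≤ 1 / ((n:ℝ) + 1)) {ε : ℝ} (hε : 0 < ε) :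
    ∃ n, distToSet {f | ∃ c : ℝ, f = fun x => omegaL lam W (x + (c, 0))} (z n) ≤ ε := by
  obtain ⟨U, hU, hUa, ⟨R', hR'⟩, -, hPsi, hM, hpos, huniq⟩ := wL_exists hl hW
  set V : ℝ → ℝ := fun q => lam * max (U q - W) 0 with hVdef
  have hV : Continuous V := by fun_prop
  have hV0 : ∀ q, 0 ≤ V q := fun q => mul_nonneg (by linarith) (le_max_right _ _)
  have hom : omegaL lam W = om V := by
    ext x
    unfold omegaL om
    split_ifs with hx
    · rw [hPsi x hx, hVdef]
      have : x.2 * U (rad x ^ 2) - W * x.2 = x.2 * (U (rad x ^ 2) - W) := by ring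
      rw [this, ← mul_zero x.2, ← mul_max_of_nonneg _ _ hx.le]; simp only [mul_zero]; ring
    · rfl
  rw [hom] at hd ⊢
  have hRb : ∀ q, (max R' 1) ^ 2 ≤ q → V q = 0 := by
    intro q hq
    have a1 : 1 ≤ max R' 1 := le_max_right _ _
    have a2 : R' ≤ max R' 1 := le_max_left _ _
    have : U q ≤ U R' := hUa (by nlinarith)
    simp only [hVdef]
    rw [max_eq_right (by linarith), mul_zero]
  have hc : ∀ n : ℕ, ∃ c : ℝ, normL1 (fun x => z₀ n x - om V (x + (c, 0))) + normL2 (fun x => z₀ n x - om V (x + (c, 0))) +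
      normL1 (fun x => x.2 * (z₀ n x - om V (x + (c, 0)))) < 2 * (1 / ((n:ℝ) + 1)) := by
    intro n
    have h := hd n
    unfold distToSet at h
    have hp : (0:ℝ) < 1 / ((n:ℝ) + 1) := by positivity
    obtain ⟨d, ⟨o, ⟨c, rfl⟩, rfl⟩, hlt⟩ := exists_lt_of_csInf_lt (by exact ⟨_, _, ⟨0, rfl⟩, rfl⟩) (lt_of_le_of_lt h (by linarith : 1 / ((n:ℝ) + 1) < 2 * (1 / ((n:ℝ) + 1))))
    exact ⟨c, hlt⟩
  choose c hc using hc
  have hlim : Tendsto (fun n : ℕ => 2 * (1 / ((n:ℝ) + 1))) atTop (𝓝 0) := by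
    simpa using (tendsto_one_div_add_atTop_nhds_zero_nat (𝕜 := ℝ)).const_mul 2
  obtain ⟨φ, c', ht⟩ := core2 hl hV hV0 (R := max R' 1) (by positivity) hRb (f := wL lam W U) rfl hM hpos huniq g₀ g hE hI h1 h2 (c := c)
    (squeeze_zero (fun n => add_nonneg (add_nonneg (normL1_nonneg _) (normL2_nonneg _)) (normL1_nonneg _)) (fun n => (hc n).le) hlim)
  obtain ⟨n, hn⟩ := (ht.eventually (gt_mem_nhds hε)).exists
  refine ⟨φ n, (csInf_le ?_ ?_).trans hn.le⟩
  · refine ⟨0, ?_⟩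
    rintro d ⟨o, -, rfl⟩
    exact add_nonneg (add_nonneg (normL1_nonneg _) (normL2_nonneg _)) (normL1_nonneg _)
  · exact ⟨_, ⟨c' n, rfl⟩, rfl⟩

end LambPart23

/-- orbital stability of the Lamb dipole `ω_L^{λ,W}` under the
conservation laws. -/
theorem stmt18 (lam W : ℝ) (hlam : 1 < lam) (hW : 0 < W) :
    ∀ ε : ℝ, 0 < ε → ∃ δ : ℝ, 0 < δ ∧
      ∀ ζ₀ ζ : ℝ × ℝ → ℝ, NonnegL1L2 ζ₀ → NonnegL1L2 ζ →
        IntegrableOn (fun x => x.2 * ζ₀ x) UHP →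
        IntegrableOn (fun x => x.2 * ζ x) UHP →
        kineticE ζ = kineticE ζ₀ → impulse ζ = impulse ζ₀ →
        normL1 ζ = normL1 ζ₀ → normL2 ζ = normL2 ζ₀ →
        distToSet {f | ∃ c : ℝ, f = fun x => omegaL lam W (x + (c, 0))} ζ₀ ≤ δ →
        distToSet {f | ∃ c : ℝ, f = fun x => omegaL lam W (x + (c, 0))} ζ ≤ ε := by
  intro ε hε
  by_contra hcon
  have hx : ∀ n : ℕ, ∃ u v : ℝ × ℝ → ℝ, (Measurable u ∧ (∀ x, 0 ≤ u x) ∧ IntegrableOn u UHP ∧ IntegrableOn (fun x => u x ^ 2) UHP ∧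
      IntegrableOn (fun x => x.2 * u x) UHP) ∧ (Measurable v ∧ (∀ x, 0 ≤ v x) ∧ IntegrableOn v UHP ∧ IntegrableOn (fun x => v x ^ 2) UHP ∧
      IntegrableOn (fun x => x.2 * v x) UHP) ∧ kineticE v = kineticE u ∧ impulse v = impulse u ∧ normL1 v = normL1 u ∧ normL2 v = normL2 u ∧
      distToSet {f | ∃ c : ℝ, f = fun x => omegaL lam W (x + (c, 0))} u ≤ 1 / ((n:ℝ) + 1) ∧
      ¬ distToSet {f | ∃ c : ℝ, f = fun x => omegaL lam W (x + (c, 0))} v ≤ ε := by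
    intro n
    by_contra hn
    apply hcon
    refine ⟨1 / ((n:ℝ) + 1), by positivity, fun z₀ z a₀ a w₀ w hE hI h1 h2 hd => ?_⟩
    by_contra hne
    apply hn
    obtain ⟨u, u1, u2, -, u3, u4, u5, u6, u7, u8, u9, u10⟩ := meas_replace a₀ w₀
    obtain ⟨v, v1, v2, -, v3, v4, v5, v6, v7, v8, v9, v10⟩ := meas_replace a w
    exact ⟨u, v, ⟨u1, u2, u3, u4, u5⟩, ⟨v1, v2, v3, v4, v5⟩, by rw [v6, u6, hE], by rw [v7, u7, hI], by rw [v8, u8, h1], by rw [v9, u9, h2],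
      by rw [u10]; exact hd, by rw [v10]; exact hne⟩
  choose u v hu hv hE hI h1 h2 hd hne using hx
  obtain ⟨n, hn⟩ := seq_final hlam hW (z₀ := u) (z := v)
    ⟨fun n => (hu n).1, fun n => (hu n).2.1, fun n => (hu n).2.2.1, fun n => (hu n).2.2.2.1, fun n => (hu n).2.2.2.2⟩
    ⟨fun n => (hv n).1, fun n => (hv n).2.1, fun n => (hv n).2.2.1, fun n => (hv n).2.2.2.1, fun n => (hv n).2.2.2.2⟩
    hE hI h1 h2 hd hε
  exact hne n hn
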